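/- Let p > 2 and B_1 ⊂ ℝ². There exist constants δ_0 > 0 and C > 1, depending only on p, such that: if f ∈ L^∞(B_1) with ‖f‖_{L^∞(B_1)} ≤ δ_0, and u ∈ C¹(B_1) is a weak solution of -Δ_p u = f in B_1 with ‖u‖_{L^∞(B_1)} ≤ 1, then for every r with 0 < r ≤ 1/2, sup_{x ∈ B_r} | u(x) − u(0) | ≤ C r^{p'} ( 1 + |∇u(0)| · r^{1/(1-p)} ). -/

import Mathlib

open MeasureTheory Metric Real
open scoped RealInnerProductSpace ENNReal

noncomputable section

/-- The open ball of radius `r` centered at the origin of `ℝ^d`. -/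
abbrev B (d : ℕ) (r : ℝ) : Set (EuclideanSpace ℝ (Fin d)) := ball 0 r

/-- `u` is a weak solution of `-Δ_p u = f` in the ball `B_r ⊂ ℝ^d`. -/
def IsPLaplaceWeakSolution {d : ℕ} (p r : ℝ)
    (u f : EuclideanSpace ℝ (Fin d) → ℝ) : Prop :=
  ∀ φ : EuclideanSpace ℝ (Fin d) → ℝ, ContDiff ℝ (⊤ : ℕ∞) φ → HasCompactSupport φ →
    tsupport φ ⊆ B d r →
    ∫ x in B d r, ‖gradient u x‖ ^ (p - 2) * ⟪gradient u x, gradient φ x⟫ =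
      ∫ x in B d r, f x * φ x

namespace PLap

/-- real dot product on `ℂ`. -/
def dot (a b : ℂ) : ℝ := a.re * b.re + a.im * b.im
/-- real cross product on `ℂ`. -/
def cross (a b : ℂ) : ℝ := a.re * b.im - a.im * b.re

lemma dot_sq_le (a b : ℂ) : dot a b ^ 2 ≤ ‖a‖ ^ 2 * ‖b‖ ^ 2 := by
  rw [← Complex.normSq_eq_norm_sq, ← Complex.normSq_eq_norm_sq, Complex.normSq_apply,
    Complex.normSq_apply, dot]
  nlinarith [sq_nonneg (a.re * b.im - a.im * b.re)]

lemma norm_sq_eq (a : ℂ) : ‖a‖ ^ 2 = a.re ^ 2 + a.im ^ 2 := by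
  rw [← Complex.normSq_eq_norm_sq, Complex.normSq_apply]; ring

lemma abs_dot_le (a b : ℂ) : |dot a b| ≤ ‖a‖ * ‖b‖ := by
  apply abs_le_of_sq_le_sq _ (by positivity)
  rw [mul_pow]; exact dot_sq_le a b

/-- squared cosine of the angle. -/
def cosSq (F T : ℂ) : ℝ := dot F T ^ 2 / ‖F‖ ^ 2

end PLap

namespace PLap

/-- Wirtinger -/
lemma wirtinger (S S' : ℝ → ℂ) (hS : ∀ x, HasDerivAt S (S' x) x) (hc : Continuous S')
    (hper : S π = S (-π)) (hmean : ∫ x in (-π)..π, S x = 0) :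
    ∫ x in (-π)..π, ‖S x‖ ^ 2 ≤ ∫ x in (-π)..π, ‖S' x‖ ^ 2 := by
  have hab : (-π) < π := by linarith [pi_pos]
  have hSc : Continuous S := continuous_iff_continuousAt.2 fun x => (hS x).continuousAt
  have mem : ∀ f : ℝ → ℂ, Continuous f → MemLp f 2 (volume.restrict (Set.Ioc (-π) π)) := by
    intro f hf
    have hmeas : AEStronglyMeasurable f (volume.restrict (Set.Ioc (-π) π)) :=
      hf.aestronglyMeasurable
    rw [memLp_two_iff_integrable_sq_norm hmeas]
    exact ((hf.norm.pow 2).integrableOn_Icc (a := -π) (b := π)).mono_set Set.Ioc_subset_Icc_self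
  have h1 := hasSum_sq_fourierCoeffOn hab (mem S hSc)
  have h2 := hasSum_sq_fourierCoeffOn hab (mem S' hc)
  have hle : ∀ n : ℤ, ‖fourierCoeffOn hab S n‖ ^ 2 ≤ ‖fourierCoeffOn hab S' n‖ ^ 2 := by
    intro n
    by_cases hn : n = 0
    · subst hn
      have : fourierCoeffOn hab S 0 = 0 := by
        rw [fourierCoeffOn_eq_integral]
        simp [hmean]
      rw [this]; simp
    · have := fourierCoeffOn_of_hasDerivAt hab hn (fun x _ => hS x) (hc.intervalIntegrable _ _)
      rw [hper, sub_self, mul_zero, zero_sub] at this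
      rw [this]
      have hn1 : (1 : ℝ) ≤ |(n : ℝ)| := by
        exact_mod_cast Int.one_le_abs hn
      gcongr
      rw [norm_mul, norm_neg, norm_mul]
      have e1 : ‖(1 / (-2 * (π : ℂ) * Complex.I * n))‖ = 1 / (2 * π * |(n : ℝ)|) := by
        simp [abs_of_pos pi_pos]
      have e2 : ‖((π : ℝ) : ℂ) - ((-π : ℝ) : ℂ)‖ = 2 * π := by
        rw [← Complex.ofReal_sub, Complex.norm_real, Real.norm_eq_abs, abs_of_pos (by linarith)]
        ring
      rw [e1, e2, ← mul_assoc]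
      have : 1 / (2 * π * |(n : ℝ)|) * (2 * π) ≤ 1 := by
        rw [div_mul_eq_mul_div, div_le_one (by positivity)]
        nlinarith [pi_pos]
      calc _ ≤ 1 * ‖fourierCoeffOn hab S' n‖ := by gcongr
        _ = _ := one_mul _
  have := hasSum_le hle h1 h2
  simp only [smul_eq_mul] at this
  have hpos : 0 < (π - -π)⁻¹ := by
    have := pi_pos
    rw [inv_pos]; linarith
  exact le_of_mul_le_mul_left this hpos

end PLap

namespace PLap

lemma trig_int (a b : ℂ) :
    ∫ x in (-π)..π, (-a.re * sin x + a.im * cos x - 2 * b.re * sin x * cos x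
      + b.im * (1 - 2 * sin x ^ 2)) ^ 2 = π * (‖a‖ ^ 2 + ‖b‖ ^ 2) := by
  have key : ∀ x ∈ Set.uIcc (-π) π, HasDerivAt (fun x : ℝ =>
      a.re ^ 2 * (x - sin x * cos x) / 2 + a.im ^ 2 * (x + sin x * cos x) / 2
      - a.re * a.im * sin x ^ 2
      + b.re ^ 2 * (x / 2 - sin x * cos x * (1 - 2 * sin x ^ 2) / 2)
      + b.im ^ 2 * (x - (x / 2 - sin x * cos x * (1 - 2 * sin x ^ 2) / 2))
      - b.re * b.im * (2 * sin x ^ 2 - 2 * sin x ^ 4)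
      + 4 * a.re * b.re * sin x ^ 3 / 3 - 2 * a.re * b.im * (cos x * (1/3 + 2/3 * sin x ^ 2))
      + 4 * a.im * b.re * (cos x * (1 - sin x ^ 2)) / 3
      + 2 * a.im * b.im * (sin x - 2 * sin x ^ 3 / 3))
      ((-a.re * sin x + a.im * cos x - 2 * b.re * sin x * cos x
      + b.im * (1 - 2 * sin x ^ 2)) ^ 2) x := by
    intro x _
    have hs := hasDerivAt_sin x
    have hc := hasDerivAt_cos x
    have hx := hasDerivAt_id x
    have hsc := hs.mul hc
    have hp2 := ((hs.pow 2).const_mul 2).const_sub 1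
    have hX := (hx.div_const 2).sub ((hsc.mul hp2).div_const 2)
    have := (((((((((((hx.sub hsc).const_mul (a.re ^ 2)).div_const 2).add
      (((hx.add hsc).const_mul (a.im ^ 2)).div_const 2)).sub
      ((hs.pow 2).const_mul (a.re * a.im))).add (hX.const_mul (b.re ^ 2))).add
      ((hx.sub hX).const_mul (b.im ^ 2))).sub
      ((((hs.pow 2).const_mul 2).sub ((hs.pow 4).const_mul 2)).const_mul (b.re * b.im))).add
      (((hs.pow 3).const_mul (4 * a.re * b.re)).div_const 3)).sub
      ((hc.mul (((hs.pow 2).const_mul (2/3)).const_add (1/3))).const_mul (2 * a.re * b.im))).add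
      (((hc.mul ((hs.pow 2).const_sub 1)).const_mul (4 * a.im * b.re)).div_const 3)).add
      ((hs.sub (((hs.pow 3).const_mul 2).div_const 3)).const_mul (2 * a.im * b.im))
    refine this.congr_deriv ?_
    have h1 : cos x ^ 2 = 1 - sin x ^ 2 := by rw [cos_sq']
    have h3 : cos x ^ 3 = (1 - sin x ^ 2) * cos x := by rw [pow_succ, h1]
    have h4 : cos x ^ 4 = (1 - sin x ^ 2) ^ 2 := by rw [show 4 = 2 * 2 from rfl, pow_mul, h1]
    simp
    ring_nf
    simp only [h1, h3, h4]
    ring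
  rw [intervalIntegral.integral_eq_sub_of_hasDerivAt key]
  · simp [norm_sq_eq]
    ring
  · apply Continuous.intervalIntegrable
    fun_prop

lemma dot_add_left (a b c : ℂ) : dot (a + b) c = dot a c + dot b c := by
  simp [dot]; ring
lemma dot_sub_left (a b c : ℂ) : dot (a - b) c = dot a c - dot b c := by
  simp [dot]; ring
lemma norm_add_sq' (a b : ℂ) : ‖a + b‖ ^ 2 = ‖a‖ ^ 2 + ‖b‖ ^ 2 + 2 * dot a b := by
  simp only [norm_sq_eq, dot, Complex.add_re, Complex.add_im]; ring
lemma norm_sub_sq' (a b : ℂ) : ‖a - b‖ ^ 2 = ‖a‖ ^ 2 + ‖b‖ ^ 2 - 2 * dot a b := by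
  simp only [norm_sq_eq, dot, Complex.sub_re, Complex.sub_im]; ring
lemma dot_self (a : ℂ) : dot a a = ‖a‖ ^ 2 := by simp only [norm_sq_eq, dot]; ring

lemma cosSq_nonneg (F T : ℂ) : 0 ≤ cosSq F T := by unfold cosSq; positivity
lemma cosSq_le_one (F T : ℂ) (hT : ‖T‖ = 1) : cosSq F T ≤ 1 := by
  unfold cosSq
  by_cases h : F = 0
  · simp [h]
  · rw [div_le_one (by positivity)]
    have := dot_sq_le F T
    simpa [hT] using this

@[fun_prop] lemma continuous_dot {X : Type*} [TopologicalSpace X] {f g : X → ℂ}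
    (hf : Continuous f) (hg : Continuous g) : Continuous fun x => dot (f x) (g x) := by
  unfold dot; fun_prop
@[fun_prop] lemma continuous_cross {X : Type*} [TopologicalSpace X] {f g : X → ℂ}
    (hf : Continuous f) (hg : Continuous g) : Continuous fun x => cross (f x) (g x) := by
  unfold cross; fun_prop

lemma integral_dot_const (f : ℝ → ℂ) (hf : Continuous f) (c : ℂ) (a b : ℝ) :
    ∫ x in a..b, dot (f x) c = dot (∫ x in a..b, f x) c := by
  let L : ℂ →L[ℝ] ℝ := c.re • Complex.reCLM + c.im • Complex.imCLM
  have hL : ∀ z, dot z c = L z := by intro z; simp [L, dot]; ring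
  simp only [hL]
  exact L.intervalIntegral_comp_comm (hf.intervalIntegrable _ _)

/-- unit rotating vector. -/
def E (x : ℝ) : ℂ := Complex.exp (x * Complex.I)
lemma hasDerivAt_E (x : ℝ) : HasDerivAt E (Complex.I * E x) x := by
  unfold E
  have h : HasDerivAt (fun x : ℝ => (x : ℂ) * Complex.I) (1 * Complex.I) x :=
    (Complex.ofRealCLM.hasDerivAt (x := x)).mul_const _
  have := h.cexp
  refine this.congr_deriv ?_
  ring
@[fun_prop] lemma continuous_E : Continuous E := by unfold E; fun_prop
lemma norm_E (x : ℝ) : ‖E x‖ = 1 := Complex.norm_exp_ofReal_mul_I x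
lemma E_pi : E π = -1 := by simp [E]
lemma E_neg_pi : E (-π) = -1 := by
  simp [E, Complex.exp_neg]
lemma E_re (x : ℝ) : (E x).re = cos x := Complex.exp_ofReal_mul_I_re x
lemma E_im (x : ℝ) : (E x).im = sin x := Complex.exp_ofReal_mul_I_im x

/-- first part of the circle lemma. -/
lemma circle1 (F F' : ℝ → ℂ) (hF : ∀ x, HasDerivAt F (F' x) x) (hc : Continuous F')
    (hper : F π = F (-π)) : ∃ b : ℂ,
    (∫ x in (-π)..π, ‖F' x + Complex.I * b * E (-x)‖ ^ 2) =
      (∫ x in (-π)..π, ‖F' x‖ ^ 2) - 2 * π * ‖b‖ ^ 2 ∧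
    (∫ x in (-π)..π, ‖F' x‖ ^ 2) - 2 * π * ‖b‖ ^ 2 ≤
      2 * ((∫ x in (-π)..π, ‖F' x‖ ^ 2) + ∫ x in (-π)..π, cross (F x) (F' x)) := by
  have hFc : Continuous F := continuous_iff_continuousAt.2 fun x => (hF x).continuousAt
  set S : ℝ → ℂ := fun x => E x * F x with hS
  set S' : ℝ → ℂ := fun x => Complex.I * E x * F x + E x * F' x with hS'
  have hd : ∀ x, HasDerivAt S (S' x) x := fun x => (hasDerivAt_E x).mul (hF x)
  have hSc : Continuous S := by fun_prop
  have hSc' : Continuous S' := by fun_prop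
  set b : ℂ := (2 * π : ℂ)⁻¹ * ∫ x in (-π)..π, S x with hb
  have hpi : (2 * π : ℂ) ≠ 0 := by simp
  have hbS : ∫ x in (-π)..π, S x = 2 * π * b := by rw [hb]; field_simp
  have hSper : S π = S (-π) := by simp [hS, E_pi, E_neg_pi, hper]
  have hW := wirtinger (fun x => S x - b) S' (fun x => (hd x).sub_const b) hSc'
    (by simp [hSper]) (by
      rw [intervalIntegral.integral_sub (hSc.intervalIntegrable _ _)
        (continuous_const.intervalIntegrable _ _), hbS]
      simp
      ring)
  have ii : ∀ f : ℝ → ℝ, Continuous f → IntervalIntegrable f volume (-π) π :=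
    fun f hf => hf.intervalIntegrable _ _
  have ic : ∀ f : ℝ → ℂ, Continuous f → IntervalIntegrable f volume (-π) π :=
    fun f hf => hf.intervalIntegrable _ _
  have e1 : ∫ x in (-π)..π, ‖S x - b‖ ^ 2 = (∫ x in (-π)..π, ‖F x‖ ^ 2) - 2 * π * ‖b‖ ^ 2 := by
    have : ∀ x, ‖S x - b‖ ^ 2 = ‖F x‖ ^ 2 + ‖b‖ ^ 2 - 2 * dot (S x) b := by
      intro x; rw [norm_sub_sq']; simp [hS, norm_E]
    simp only [this]
    rw [intervalIntegral.integral_sub (ii _ (by fun_prop)) (ii _ (by fun_prop)),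
      intervalIntegral.integral_add (ii _ (by fun_prop)) (ii _ (by fun_prop)),
      intervalIntegral.integral_const_mul, integral_dot_const _ hSc, hbS]
    have : dot (2 * π * b) b = 2 * π * ‖b‖ ^ 2 := by
      rw [← dot_self]; simp [dot]; ring
    rw [this]; simp; ring
  have e2 : ∫ x in (-π)..π, ‖S' x‖ ^ 2 = (∫ x in (-π)..π, ‖F' x‖ ^ 2)
      + (∫ x in (-π)..π, ‖F x‖ ^ 2) + 2 * ∫ x in (-π)..π, cross (F x) (F' x) := by
    have : ∀ x, ‖S' x‖ ^ 2 = ‖F' x‖ ^ 2 + ‖F x‖ ^ 2 + 2 * cross (F x) (F' x) := by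
      intro x
      have : S' x = E x * (F' x + Complex.I * F x) := by simp only [hS']; ring
      rw [this, norm_mul, norm_E, one_mul, norm_add_sq']
      simp [dot, cross]; ring
    simp only [this]
    rw [intervalIntegral.integral_add (ii _ (by fun_prop)) (ii _ (by fun_prop)),
      intervalIntegral.integral_add (ii _ (by fun_prop)) (ii _ (by fun_prop)),
      intervalIntegral.integral_const_mul]
  have e3 : ∫ x in (-π)..π, E x * F' x = - Complex.I * (2 * π * b) := by
    have h0 : ∫ x in (-π)..π, S' x = 0 := by
      rw [intervalIntegral.integral_eq_sub_of_hasDerivAt (fun x _ => hd x) (ic _ hSc'), hSper,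
        sub_self]
    have : ∀ x, S' x = Complex.I * S x + E x * F' x := by
      intro x; simp only [hS', hS]; ring
    simp only [this] at h0
    rw [intervalIntegral.integral_add (ic _ (by fun_prop)) (ic _ (by fun_prop)),
      intervalIntegral.integral_const_mul, hbS] at h0
    linear_combination h0
  have e4 : (∫ x in (-π)..π, ‖F' x + Complex.I * b * E (-x)‖ ^ 2) =
      (∫ x in (-π)..π, ‖F' x‖ ^ 2) - 2 * π * ‖b‖ ^ 2 := by
    have : ∀ x, ‖F' x + Complex.I * b * E (-x)‖ ^ 2
        = ‖F' x‖ ^ 2 + ‖b‖ ^ 2 + 2 * dot (E x * F' x) (Complex.I * b) := by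
      intro x
      rw [norm_add_sq']
      simp only [norm_mul, norm_E, Complex.norm_I, one_mul, mul_one]
      congr 2
      have h1 := E_re x
      have h2 := E_im x
      have h3 := E_re (-x)
      have h4 := E_im (-x)
      rw [cos_neg] at h3; rw [sin_neg] at h4
      simp [dot, h1, h2, h3, h4]; ring
    simp only [this]
    rw [intervalIntegral.integral_add (ii _ (by fun_prop)) (ii _ (by fun_prop)),
      intervalIntegral.integral_add (ii _ (by fun_prop)) (ii _ (by fun_prop)),
      intervalIntegral.integral_const_mul, integral_dot_const _ (by fun_prop), e3]
    have : dot (-Complex.I * (2 * π * b)) (Complex.I * b) = - 2 * π * ‖b‖ ^ 2 := by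
      rw [← dot_self]; simp [dot]; ring
    rw [this]; simp; ring
  refine ⟨b, e4, ?_⟩
  rw [e1, e2] at hW
  linarith

end PLap

namespace PLap

lemma cs {α : Type*} [MeasurableSpace α] (μ : Measure α) (f g : α → ℝ)
    (hf : Integrable (fun x => f x ^ 2) μ) (hg : Integrable (fun x => g x ^ 2) μ)
    (hfg : Integrable (fun x => f x * g x) μ) :
    (∫ x, f x * g x ∂μ) ^ 2 ≤ (∫ x, f x ^ 2 ∂μ) * ∫ x, g x ^ 2 ∂μ := by
  have h : ∀ s : ℝ, 0 ≤ (∫ x, f x ^ 2 ∂μ) * (s * s) + (2 * ∫ x, f x * g x ∂μ) * s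
      + ∫ x, g x ^ 2 ∂μ := by
    intro s
    have h0 : 0 ≤ ∫ x, (s * f x + g x) ^ 2 ∂μ := integral_nonneg fun x => by positivity
    have e : ∀ x, (s * f x + g x) ^ 2 = s * s * f x ^ 2 + (2 * s) * (f x * g x) + g x ^ 2 := by
      intro x; ring
    simp only [e] at h0
    have hi : Integrable (fun x => s * s * f x ^ 2 + (2 * s) * (f x * g x)) μ :=
      (hf.const_mul _).add (hfg.const_mul _)
    rw [integral_add hi hg,
      integral_add (hf.const_mul _) (hfg.const_mul _), integral_const_mul, integral_const_mul] at h0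
    linarith
  have := discrim_le_zero h
  unfold discrim at this
  nlinarith

lemma cs_one (f : ℝ → ℝ) (hf : Continuous f) (a b : ℝ) (hab : a ≤ b) :
    (∫ x in a..b, f x) ^ 2 ≤ (b - a) * ∫ x in a..b, f x ^ 2 := by
  have ic : ∀ f : ℝ → ℝ, Continuous f → Integrable f (volume.restrict (Set.Ioc a b)) :=
    fun f hf => (hf.intervalIntegrable a b).1
  rw [intervalIntegral.integral_of_le hab, intervalIntegral.integral_of_le hab]
  have := cs (volume.restrict (Set.Ioc a b)) (fun _ => 1) f (ic _ (by fun_prop))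
    (ic _ (by fun_prop)) (ic _ (by fun_prop))
  simpa [hab] using this

lemma cosSq_measurable (F : ℝ → ℂ) (hF : Continuous F) :
    Measurable fun x => cosSq (F x) (Complex.I * E x) := by
  unfold cosSq
  exact Measurable.div (by fun_prop : Continuous fun x => dot (F x) (Complex.I * E x) ^ 2).measurable
    (by fun_prop : Continuous fun x => ‖F x‖ ^ 2).measurable

lemma norm_IE (x : ℝ) : ‖Complex.I * E x‖ = 1 := by simp [norm_E]

lemma intervalIntegrable_cosSq (F : ℝ → ℂ) (hF : Continuous F) (g : ℝ → ℝ) (hg : Continuous g) :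
    IntervalIntegrable (fun x => g x * cosSq (F x) (Complex.I * E x)) volume (-π) π := by
  have h1 : IntervalIntegrable g volume (-π) π := hg.intervalIntegrable _ _
  refine h1.mono_fun ((hg.measurable.mul (cosSq_measurable F hF)).aestronglyMeasurable) ?_
  refine Filter.Eventually.of_forall fun x => ?_
  simp only [norm_mul]
  have : ‖cosSq (F x) (Complex.I * E x)‖ ≤ 1 := by
    rw [Real.norm_eq_abs, abs_of_nonneg (cosSq_nonneg _ _)]
    exact cosSq_le_one _ _ (norm_IE x)
  nlinarith [norm_nonneg (g x)]

/-- deviation bound -/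
lemma sup_dev (R R' : ℝ → ℂ) (hR : ∀ x, HasDerivAt R (R' x) x) (hc : Continuous R') :
    ∀ x ∈ Set.Icc (-π) π, ‖R x - R (-π)‖ ^ 2 ≤ 2 * π * ∫ x in (-π)..π, ‖R' x‖ ^ 2 := by
  intro x hx
  have hpi := pi_pos
  have h1 : ‖R x - R (-π)‖ ≤ ∫ x in (-π)..π, ‖R' x‖ := by
    have e := intervalIntegral.integral_eq_sub_of_hasDerivAt (a := -π) (b := x)
      (fun x _ => hR x) (hc.intervalIntegrable _ _)
    rw [← e]
    refine (intervalIntegral.norm_integral_le_integral_norm hx.1).trans ?_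
    exact intervalIntegral.integral_mono_interval le_rfl hx.1 hx.2
      (Filter.Eventually.of_forall fun _ => norm_nonneg _) (hc.norm.intervalIntegrable _ _)
  have h2 := cs_one (fun x => ‖R' x‖) hc.norm (-π) π (by linarith)
  calc _ ≤ (∫ x in (-π)..π, ‖R' x‖) ^ 2 := by gcongr
    _ ≤ _ := h2.trans (by rw [show π - -π = 2 * π by ring])

set_option maxHeartbeats 1000000 in
lemma circle2 (F F' : ℝ → ℂ) (hF : ∀ x, HasDerivAt F (F' x) x) (hc : Continuous F') (b : ℂ)
    (hX : ∫ x in (-π)..π, ‖F' x + Complex.I * b * E (-x)‖ ^ 2 ≤ 1 / 1000 * (2 * π * ‖b‖ ^ 2)) :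
    1 / 100 * (2 * π * ‖b‖ ^ 2) ≤ ∫ x in (-π)..π, ‖F' x‖ ^ 2 * cosSq (F x) (Complex.I * E x) := by
  have hFc : Continuous F := continuous_iff_continuousAt.2 fun x => (hF x).continuousAt
  have hpi := pi_pos
  have hpi4 := pi_le_four
  have hpi2 := pi_lt_d2
  by_cases hb : b = 0
  · subst hb
    simp
    apply intervalIntegral.integral_nonneg (by linarith)
    intro x _
    have := cosSq_nonneg (F x) (Complex.I * E x)
    positivity
  have hb' : 0 < ‖b‖ := norm_pos_iff.2 hb
  set R : ℝ → ℂ := fun x => F x - b * E (-x) with hRdef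
  set R' : ℝ → ℂ := fun x => F' x + Complex.I * b * E (-x) with hR'def
  have hE : ∀ x, HasDerivAt (fun x => E (-x)) (-(Complex.I * E (-x))) x := by
    intro x
    have := (hasDerivAt_E (-x)).scomp x (hasDerivAt_neg x)
    have e : (fun x => E (-x)) = E ∘ Neg.neg := rfl
    rw [e]
    simpa using this
  have hR : ∀ x, HasDerivAt R (R' x) x := by
    intro x
    refine ((hF x).sub ((hE x).const_mul b)).congr_deriv ?_
    simp only [hR'def]; ring
  have hR'c : Continuous R' := by fun_prop
  set a := R (-π) with ha
  set X := ∫ x in (-π)..π, ‖R' x‖ ^ 2 with hXdef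
  have hdev : ∀ x ∈ Set.Icc (-π) π, ‖R x - a‖ ^ 2 ≤ (1 / 25) * ‖b‖ ^ 2 := by
    intro x hx
    refine (sup_dev R R' hR hR'c x hx).trans ?_
    have : 2 * π * X ≤ 2 * π * (1 / 1000 * (2 * π * ‖b‖ ^ 2)) := by gcongr
    refine this.trans ?_
    have : π ^ 2 ≤ 10 := by nlinarith
    nlinarith [sq_nonneg ‖b‖]
  set D := ‖a‖ + 2 * ‖b‖ with hD
  have hDpos : 0 < D := by positivity
  have hD2 : D ^ 2 ≤ 5 * (‖a‖ ^ 2 + ‖b‖ ^ 2) := by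
    simp only [hD]; nlinarith [sq_nonneg (2 * ‖a‖ - ‖b‖)]
  set g : ℝ → ℝ := fun x => (-a.re * sin x + a.im * cos x - 2 * b.re * sin x * cos x
      + b.im * (1 - 2 * sin x ^ 2)) with hg
  have hgc : Continuous g := by fun_prop
  have hpt : ∀ x ∈ Set.Icc (-π) π, ‖b‖ ^ 2 / (2 * D ^ 2) * (1 / 2 * g x ^ 2 - 1 / 25 * ‖b‖ ^ 2)
      - ‖R' x‖ ^ 2 ≤ ‖F' x‖ ^ 2 * cosSq (F x) (Complex.I * E x) := by
    intro x hx
    have hd := hdev x hx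
    set T := Complex.I * E x with hT
    set c := cosSq (F x) T with hcdef
    have hc0 : 0 ≤ c := cosSq_nonneg _ _
    have hc1 : c ≤ 1 := cosSq_le_one _ _ (norm_IE x)
    have hFD : ‖F x‖ ≤ D := by
      have : F x = a + b * E (-x) + (R x - a) := by simp only [hRdef]; ring
      rw [this]
      have h5 : ‖R x - a‖ ≤ ‖b‖ := by
        apply le_of_sq_le_sq _ hb'.le
        nlinarith [sq_nonneg ‖b‖]
      calc _ ≤ ‖a‖ + ‖b * E (-x)‖ + ‖R x - a‖ := norm_add₃_le
        _ ≤ D := by rw [norm_mul, norm_E]; linarith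
    have hdotT : dot (F x) T = g x + dot (R x - a) T := by
      have : F x = a + b * E (-x) + (R x - a) := by simp only [hRdef]; ring
      rw [this, dot_add_left]
      congr 1
      have h1 := E_re x
      have h2 := E_im x
      have h3 := E_re (-x)
      have h4 := E_im (-x)
      rw [cos_neg] at h3; rw [sin_neg] at h4
      have h5 := sin_sq_add_cos_sq x
      simp [dot, hT, h1, h2, h3, h4, hg]
      have h6 : cos x ^ 2 = 1 - sin x ^ 2 := by linarith
      linear_combination b.im * h6
    have hcD : dot (F x) T ^ 2 / D ^ 2 ≤ c := by
      by_cases hF0 : F x = 0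
      · rw [hF0]; simp [dot]; exact hc0
      · have : 0 < ‖F x‖ := norm_pos_iff.2 hF0
        simp only [hcdef, cosSq]
        gcongr
    have hdT : dot (R x - a) T ^ 2 ≤ 1 / 25 * ‖b‖ ^ 2 := by
      refine (dot_sq_le _ _).trans ?_
      rw [hT, norm_IE]; simpa using hd
    have hF' : 1 / 2 * ‖b‖ ^ 2 - ‖R' x‖ ^ 2 ≤ ‖F' x‖ ^ 2 := by
      have h1 : Complex.I * b * E (-x) = R' x - F' x := by simp only [hR'def]; ring
      have h2 : ‖b‖ ^ 2 = ‖R' x - F' x‖ ^ 2 := by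
        rw [← h1]; simp [norm_E]
      have h3 := norm_sub_le (R' x) (F' x)
      have h4 : ‖R' x - F' x‖ ^ 2 ≤ (‖R' x‖ + ‖F' x‖) ^ 2 := by gcongr
      nlinarith [sq_nonneg (‖R' x‖ - ‖F' x‖)]
    have h7 : 1 / 2 * g x ^ 2 - 1 / 25 * ‖b‖ ^ 2 ≤ dot (F x) T ^ 2 := by
      rw [hdotT]
      nlinarith [sq_nonneg (g x + 2 * dot (R x - a) T)]
    have h8 : ‖b‖ ^ 2 / (2 * D ^ 2) * (1 / 2 * g x ^ 2 - 1 / 25 * ‖b‖ ^ 2) ≤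
        1 / 2 * ‖b‖ ^ 2 * c := by
      calc _ ≤ ‖b‖ ^ 2 / (2 * D ^ 2) * dot (F x) T ^ 2 := by gcongr
        _ = 1 / 2 * ‖b‖ ^ 2 * (dot (F x) T ^ 2 / D ^ 2) := by field_simp
        _ ≤ _ := by gcongr
    nlinarith [sq_nonneg ‖R' x‖]
  have ii : ∀ f : ℝ → ℝ, Continuous f → IntervalIntegrable f volume (-π) π :=
    fun f hf => hf.intervalIntegrable _ _
  have h_intg := intervalIntegral.integral_mono_on (by linarith : -π ≤ π)
    (ii _ (by fun_prop)) (intervalIntegrable_cosSq F hFc (fun x => ‖F' x‖ ^ 2) (by fun_prop)) hpt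
  refine le_trans ?_ h_intg
  rw [intervalIntegral.integral_sub (ii _ (by fun_prop)) (ii _ (by fun_prop)),
    intervalIntegral.integral_const_mul, intervalIntegral.integral_sub (ii _ (by fun_prop))
    (ii _ (by fun_prop)), intervalIntegral.integral_const_mul, trig_int]
  simp only [intervalIntegral.integral_const, smul_eq_mul]
  have h9 : ‖b‖ ^ 2 / 10 * (1 / 2 * π - 2 / 25 * π) ≤ ‖b‖ ^ 2 / (2 * D ^ 2) *
      (1 / 2 * (π * (‖a‖ ^ 2 + ‖b‖ ^ 2)) - (π - -π) * (1 / 25 * ‖b‖ ^ 2)) := by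
    have h10 : (1 / 2 * π - 2 / 25 * π) * (‖a‖ ^ 2 + ‖b‖ ^ 2) ≤
      (1 / 2 * (π * (‖a‖ ^ 2 + ‖b‖ ^ 2)) - (π - -π) * (1 / 25 * ‖b‖ ^ 2)) := by
      nlinarith [mul_nonneg hpi.le (sq_nonneg ‖a‖)]
    have h11 : (1 / 2 * π - 2 / 25 * π) * D ^ 2 ≤ 5 * ((1 / 2 * π - 2 / 25 * π) * (‖a‖ ^ 2 + ‖b‖ ^ 2)) := by
      nlinarith
    rw [div_mul_eq_mul_div (‖b‖ ^ 2) 10, div_mul_eq_mul_div (‖b‖ ^ 2) (2 * D ^ 2), div_le_div_iff₀ (by norm_num) (by positivity)]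
    have : 0 ≤ ‖b‖ ^ 2 := by positivity
    nlinarith [mul_le_mul_of_nonneg_left (h11.trans (mul_le_mul_of_nonneg_left h10 (by norm_num : (0:ℝ) ≤ 5))) this]
  have : 0 ≤ π * ‖b‖ ^ 2 := by positivity
  nlinarith

/-- Circle inequality. -/
def CircleIneq (m κ : ℝ) : Prop := ∀ F F' : ℝ → ℂ, (∀ x, HasDerivAt F (F' x) x) → Continuous F' →
    F π = F (-π) → -∫ x in (-π)..π, cross (F x) (F' x) ≤
      κ * ∫ x in (-π)..π, ‖F' x‖ ^ 2 * (1 + m * cosSq (F x) (Complex.I * E x))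

lemma circle_zero : CircleIneq 0 1 := by
  intro F F' hF hc hper
  obtain ⟨b, h1, h2⟩ := circle1 F F' hF hc hper
  have : 0 ≤ ∫ x in (-π)..π, ‖F' x + Complex.I * b * E (-x)‖ ^ 2 :=
    intervalIntegral.integral_nonneg (by linarith [pi_pos]) fun x _ => by positivity
  simp only [zero_mul, add_zero, mul_one, one_mul]
  linarith

lemma circle_pos (m : ℝ) (hm : 0 < m) : ∃ κ, 0 < κ ∧ κ < 1 ∧ CircleIneq m κ := by
  set η := min (m / 400) (1 / 4000) with hη
  have hη0 : 0 < η := by positivity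
  have hη1 : η ≤ 1 / 4000 := min_le_right _ _
  have hη2 : η ≤ m / 400 := min_le_left _ _
  refine ⟨1 - η, by linarith, by linarith, ?_⟩
  intro F F' hF hc hper
  have hFc : Continuous F := continuous_iff_continuousAt.2 fun x => (hF x).continuousAt
  obtain ⟨b, h1, h2⟩ := circle1 F F' hF hc hper
  have hX0 : 0 ≤ ∫ x in (-π)..π, ‖F' x + Complex.I * b * E (-x)‖ ^ 2 :=
    intervalIntegral.integral_nonneg (by linarith [pi_pos]) fun x _ => by positivity
  have hY0 : 0 ≤ ∫ x in (-π)..π, ‖F' x‖ ^ 2 * cosSq (F x) (Complex.I * E x) := by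
    apply intervalIntegral.integral_nonneg (by linarith [pi_pos])
    intro x _
    have := cosSq_nonneg (F x) (Complex.I * E x)
    positivity
  have h3 := circle2 F F' hF hc b
  have e : ∫ x in (-π)..π, ‖F' x‖ ^ 2 * (1 + m * cosSq (F x) (Complex.I * E x)) =
      (∫ x in (-π)..π, ‖F' x‖ ^ 2) +
        m * ∫ x in (-π)..π, ‖F' x‖ ^ 2 * cosSq (F x) (Complex.I * E x) := by
    rw [← intervalIntegral.integral_const_mul, ← intervalIntegral.integral_add
      ((by fun_prop : Continuous fun x => ‖F' x‖ ^ 2).intervalIntegrable _ _)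
      ((intervalIntegrable_cosSq F hFc (fun x => ‖F' x‖ ^ 2) (by fun_prop)).const_mul _)]
    congr 1; ext x; ring
  rw [e]
  have hy : 0 ≤ 2 * π * ‖b‖ ^ 2 := by have := pi_pos; positivity
  rw [h1] at h3 hX0
  set N := ∫ x in (-π)..π, ‖F' x‖ ^ 2
  set Y := ∫ x in (-π)..π, ‖F' x‖ ^ 2 * cosSq (F x) (Complex.I * E x)
  set y := 2 * π * ‖b‖ ^ 2
  set Q := ∫ x in (-π)..π, cross (F x) (F' x)
  have hmY : 0 ≤ m * Y := by positivity
  by_cases hcase : N - y ≤ 1 / 1000 * y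
  · have h4 := h3 hcase
    have : η * N ≤ m / 400 * (2 * y) := by
      apply mul_le_mul hη2 (by linarith) (by linarith) (by positivity)
    have : m * (1 / 100 * y) ≤ m * Y := by gcongr
    nlinarith
  · push Not at hcase
    have : η * N ≤ 1 / 4000 * N := by
      apply mul_le_mul_of_nonneg_right hη1 (by linarith)
    nlinarith

end PLap

namespace PLap

lemma young_abs {v A B e : ℝ} (hA : 0 ≤ A) (hB : 0 ≤ B) (he : 0 < e) (h : v ^ 2 ≤ A * B) :
    |v| ≤ e * A + B / (4 * e) := by
  apply abs_le_of_sq_le_sq _ (by positivity)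
  have : (e * A + B / (4 * e)) ^ 2 = (e * A - B / (4 * e)) ^ 2 + A * B := by
    field_simp; ring
  nlinarith [sq_nonneg (e * A - B / (4 * e))]

lemma Y2_le {k1 s τ γ : ℝ} (hk : 1 ≤ k1) :
    τ ^ 2 + (γ - k1 * s) ^ 2 ≤ 2 * γ ^ 2 + 2 * k1 * (k1 * s ^ 2 + τ ^ 2) := by
  nlinarith [sq_nonneg (γ + k1 * s), mul_nonneg (by linarith : 0 ≤ k1 - 1) (sq_nonneg τ), sq_nonneg τ]

lemma flux_sq (τ q c σ : ℝ) : (τ * c + q * σ) ^ 2 ≤ (τ ^ 2 + q ^ 2) * (c ^ 2 + σ ^ 2) := by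
  nlinarith [sq_nonneg (τ * σ - q * c)]

/-- low frequency part is bounded below -/
lemma low_bound {k1 s τ γ c σ φ l x B e : ℝ} (hk : 1 ≤ k1) (hφ : 0 ≤ φ) (hl : 0 ≤ l) (hB : 0 ≤ B)
    (he : 0 < e) (hx : x ^ 2 * (c ^ 2 + σ ^ 2) ≤ B * (φ * l)) :
    (1 - 2 * k1 * e) * (φ * l * (k1 * s ^ 2 + τ ^ 2)) - (1 + 2 * e) * (φ * l * γ ^ 2) - B / (4 * e) ≤
    2 * φ * l * (τ ^ 2 - s * (γ - k1 * s)) + x * (τ * c + (γ - k1 * s) * σ) := by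
  set q := γ - k1 * s with hq
  set j := k1 * s ^ 2 + τ ^ 2 with hj
  have hfl : 0 ≤ φ * l := by positivity
  have h1 : j / 2 - γ ^ 2 / 2 ≤ τ ^ 2 - s * q := by
    rw [hj, hq]; nlinarith [sq_nonneg (γ - s), mul_nonneg (by linarith : 0 ≤ k1 - 1) (sq_nonneg s), sq_nonneg τ]
  have h2 : (x * (τ * c + q * σ)) ^ 2 ≤ (φ * l * (τ ^ 2 + q ^ 2)) * B := by
    have := flux_sq τ q c σ
    calc _ = x ^ 2 * (τ * c + q * σ) ^ 2 := by ring
      _ ≤ x ^ 2 * ((τ ^ 2 + q ^ 2) * (c ^ 2 + σ ^ 2)) := by gcongr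
      _ = (x ^ 2 * (c ^ 2 + σ ^ 2)) * (τ ^ 2 + q ^ 2) := by ring
      _ ≤ (B * (φ * l)) * (τ ^ 2 + q ^ 2) := by gcongr
      _ = _ := by ring
  have h3 := young_abs (by positivity) hB he h2
  have h4 := neg_abs_le (x * (τ * c + q * σ))
  have h5 : τ ^ 2 + q ^ 2 ≤ 2 * γ ^ 2 + 2 * k1 * j := Y2_le hk
  have h6 := mul_le_mul_of_nonneg_left h5 hfl
  have h6' := mul_le_mul_of_nonneg_left h6 he.le
  have h7 := mul_le_mul_of_nonneg_left h1 hfl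
  nlinarith

lemma det_lb {k1 s τ γ e : ℝ} (hk : 1 ≤ k1) (he : 0 < e) :
    (1 - e) * (k1 * s ^ 2 + τ ^ 2) - γ ^ 2 / (4 * e) ≤ τ ^ 2 - s * (γ - k1 * s) := by
  have h1 : γ ^ 2 / (4 * e) - γ * s + e * s ^ 2 = (γ / 2 - e * s) ^ 2 / e := by
    field_simp; ring
  have h2 : 0 ≤ (γ / 2 - e * s) ^ 2 / e := by positivity
  have h3 : 0 ≤ e * τ ^ 2 := by positivity
  have h4 : 0 ≤ e * ((k1 - 1) * s ^ 2) := by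
    have : 0 ≤ k1 - 1 := by linarith
    positivity
  linarith

set_option maxHeartbeats 2000000 in
lemma pw_mid {k1 κ m β M c0 : ℝ} (hk : 1 ≤ k1) (hκ : 0 ≤ κ) (hm : 0 ≤ m) (hβ : 0 ≤ β) (hM : 0 ≤ M)
    (hc0 : 0 ≤ c0) : ∃ Λ, 0 ≤ Λ ∧ ∃ C, 0 ≤ C ∧
    ∀ s τ γ c σ ω φ p1 p2 α α' ρ l x B : ℝ, 0 ≤ φ → 0 ≤ l → 0 ≤ B → 0 ≤ p1 → 0 ≤ α → 0 ≤ α' →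
    0 ≤ ω → ω ≤ 1 →
    p1 * (c ^ 2 + σ ^ 2) ≤ 2 * β * φ → p2 ^ 2 * (c ^ 2 + σ ^ 2) ≤ 16 * φ →
    x ^ 2 * (c ^ 2 + σ ^ 2) ≤ B * (φ * l) → α ^ 2 ≤ M * l → α' ^ 2 ≤ M * l → α ^ 2 * ρ ^ 2 ≤ M →
    c0 * (φ * (α' ^ 2 * (s ^ 2 + τ ^ 2) + α ^ 2 * (τ ^ 2 + (γ - k1 * s) ^ 2)))
      + κ * p1 * (α' ^ 2 * (s * c + τ * σ) ^ 2 + α ^ 2 * (τ * c + (γ - k1 * s) * σ) ^ 2) * (1 + m * ω)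
    ≤ 2 * φ * (α * α') * (τ ^ 2 - s * (γ - k1 * s)) + p2 * (α ^ 2 * ρ * (τ * c + (γ - k1 * s) * σ))
      + Λ * (2 * φ * l * (τ ^ 2 - s * (γ - k1 * s)) + x * (τ * c + (γ - k1 * s) * σ))
      + C * (1 + B + φ * l * γ ^ 2) := by
  set Q := c0 * M + 2 * κ * β * (1 + m) * M with hQ
  have hQ0 : 0 ≤ Q := by positivity
  set Λ := 2 * (Q * (1 + 2 * k1) + 2 * k1) with hΛ
  have hΛ0 : 0 ≤ Λ := by positivity
  refine ⟨Λ, hΛ0, 2 * Q + M + 2 + 4 * M ^ 2 + Λ * (2 + k1), by positivity, ?_⟩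
  intro s τ γ c σ ω φ p1 p2 α α' ρ l x B hφ hl hB hp1 hα hα' hω0 hω1 h1 h2 hx ha ha' har
  have hlow := low_bound (s := s) (τ := τ) (γ := γ) hk hφ hl hB (by positivity : 0 < 1 / (4 * k1)) hx
  set q := γ - k1 * s with hq
  set j := k1 * s ^ 2 + τ ^ 2 with hj
  have hj0 : 0 ≤ j := by positivity
  have hsj : s ^ 2 + τ ^ 2 ≤ j := by rw [hj]; nlinarith [sq_nonneg s]
  set y := τ * c + q * σ with hy
  have hY2 : τ ^ 2 + q ^ 2 ≤ 2 * γ ^ 2 + 2 * k1 * j := Y2_le hk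
  have hfl : 0 ≤ φ * l := by positivity
  -- term 1
  have t1 : α' ^ 2 * (s ^ 2 + τ ^ 2) + α ^ 2 * (τ ^ 2 + q ^ 2) ≤ M * l * (j + (2 * γ ^ 2 + 2 * k1 * j)) := by
    have := mul_le_mul ha' hsj (by positivity) (by positivity)
    have := mul_le_mul ha hY2 (by positivity) (by positivity)
    linarith
  have t2 : κ * p1 * (α' ^ 2 * (s * c + τ * σ) ^ 2 + α ^ 2 * y ^ 2) * (1 + m * ω) ≤
      κ * (2 * β * φ) * (M * l * (j + (2 * γ ^ 2 + 2 * k1 * j))) * (1 + m) := by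
    have f1 : (s * c + τ * σ) ^ 2 ≤ j * (c ^ 2 + σ ^ 2) :=
      (flux_sq s τ c σ).trans (by gcongr)
    have f2 : y ^ 2 ≤ (2 * γ ^ 2 + 2 * k1 * j) * (c ^ 2 + σ ^ 2) :=
      (flux_sq τ q c σ).trans (by gcongr)
    calc _ ≤ κ * p1 * ((M * l) * (j * (c ^ 2 + σ ^ 2)) + (M * l) * ((2 * γ ^ 2 + 2 * k1 * j) * (c ^ 2 + σ ^ 2))) * (1 + m * 1) := by gcongr
      _ = κ * (p1 * (c ^ 2 + σ ^ 2)) * (M * l * (j + (2 * γ ^ 2 + 2 * k1 * j))) * (1 + m) := by ring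
      _ ≤ _ := by gcongr
  have t3 : -(M * (φ * l * γ ^ 2)) ≤ 2 * φ * (α * α') * (τ ^ 2 - s * q) := by
    have g1 : - γ ^ 2 / 4 ≤ τ ^ 2 - s * q := by
      have := det_lb (s := s) (τ := τ) (γ := γ) hk one_pos
      linarith
    have g2 : α * α' ≤ M * l := by
      have := two_mul_le_add_sq α α'
      linarith
    have g3 : 2 * φ * (α * α') * (-γ ^ 2 / 4) ≤ 2 * φ * (α * α') * (τ ^ 2 - s * q) := by gcongr
    have g4 : φ * γ ^ 2 * (α * α') ≤ φ * γ ^ 2 * (M * l) := by gcongr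
    have : 0 ≤ φ * γ ^ 2 * (M * l) := by positivity
    linarith
  have t4 : -(φ * l * (2 * γ ^ 2 + 2 * k1 * j) + 4 * M ^ 2) ≤ p2 * (α ^ 2 * ρ * y) := by
    have v2 : (p2 * (α ^ 2 * ρ * y)) ^ 2 ≤ (φ * l * (2 * γ ^ 2 + 2 * k1 * j)) * (16 * M ^ 2) := by
      have f2 : y ^ 2 ≤ (2 * γ ^ 2 + 2 * k1 * j) * (c ^ 2 + σ ^ 2) :=
        (flux_sq τ q c σ).trans (by gcongr)
      calc _ = p2 ^ 2 * α ^ 2 * (α ^ 2 * ρ ^ 2) * y ^ 2 := by ring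
        _ ≤ p2 ^ 2 * (M * l) * M * ((2 * γ ^ 2 + 2 * k1 * j) * (c ^ 2 + σ ^ 2)) := by gcongr
        _ = (p2 ^ 2 * (c ^ 2 + σ ^ 2)) * (M * l * M * (2 * γ ^ 2 + 2 * k1 * j)) := by ring
        _ ≤ (16 * φ) * (M * l * M * (2 * γ ^ 2 + 2 * k1 * j)) := by gcongr
        _ = _ := by ring
    have := young_abs (by positivity) (by positivity) one_pos v2
    have := neg_abs_le (p2 * (α ^ 2 * ρ * y))
    linarith
  have e1 : 1 - 2 * k1 * (1 / (4 * k1)) = 1 / 2 := by field_simp; norm_num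
  have e2 : 1 + 2 * (1 / (4 * k1)) ≤ 2 := by
    have : 1 / (4 * k1) ≤ 1 / 4 := by apply one_div_le_one_div_of_le <;> linarith
    linarith
  have e3 : B / (4 * (1 / (4 * k1))) = B * k1 := by field_simp
  rw [e1, e3] at hlow
  have hlow2 : 1 / 2 * (φ * l * j) - 2 * (φ * l * γ ^ 2) - B * k1 ≤
      2 * φ * l * (τ ^ 2 - s * q) + x * y := by
    have : (1 + 2 * (1 / (4 * k1))) * (φ * l * γ ^ 2) ≤ 2 * (φ * l * γ ^ 2) := by gcongr
    linarith
  have t5 := mul_le_mul_of_nonneg_left hlow2 hΛ0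
  have t1' := mul_le_mul_of_nonneg_left (mul_le_mul_of_nonneg_left t1 hφ) hc0
  have hg : 0 ≤ φ * l * γ ^ 2 := by positivity
  set P := φ * l * γ ^ 2 with hP
  set J := φ * l * j with hJ
  have hJ0 : 0 ≤ J := by positivity
  have t12 : c0 * (φ * (M * l * (j + (2 * γ ^ 2 + 2 * k1 * j)))) +
     κ * (2 * β * φ) * (M * l * (j + (2 * γ ^ 2 + 2 * k1 * j))) * (1 + m) = Q * ((1 + 2 * k1) * J + 2 * P) := by
    rw [hQ, hP, hJ]; ring
  have t44 : φ * l * (2 * γ ^ 2 + 2 * k1 * j) = 2 * P + 2 * k1 * J := by rw [hP, hJ]; ring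
  rw [t44] at t4
  have e5 : Λ * (1 / 2 * J - 2 * P - B * k1) = (Q * (1 + 2 * k1) + 2 * k1) * J - Λ * (2 * P + B * k1) := by
    rw [hΛ]; ring
  rw [e5] at t5
  have fin : 2 * Q * P + M * P + 2 * P + 4 * M ^ 2 + Λ * (2 * P + B * k1) ≤
      (2 * Q + M + 2 + 4 * M ^ 2 + Λ * (2 + k1)) * (1 + B + P) := by
    have : 0 ≤ (2 * Q + M + 2 + Λ * (2 + k1)) * 1 := by positivity
    have : 0 ≤ (2 * Q + M + 2 + 4 * M ^ 2 + Λ * 2) * B := by positivity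
    have : 0 ≤ (4 * M ^ 2 + Λ * k1) * P := by positivity
    linarith
  linarith

end PLap

namespace PLap

/-- structural inequality -/
def Struct (k1 b K m : ℝ) : Prop := ∀ s τ c σ ω : ℝ, 0 ≤ ω → ω ≤ 1 → ω * (c ^ 2 + σ ^ 2) = c ^ 2 →
  (b ^ 2 * (s * c + τ * σ) ^ 2 + (τ * c - k1 * s * σ) ^ 2) * (1 + m * ω) ≤
    b * K * (k1 * s ^ 2 + τ ^ 2) * (c ^ 2 + σ ^ 2)

lemma sq_add_le {x y e : ℝ} (he : 0 < e) : (x + y) ^ 2 ≤ (1 + e) * x ^ 2 + (1 + 1 / e) * y ^ 2 := by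
  have : (1 + e) * x ^ 2 + (1 + 1 / e) * y ^ 2 - (x + y) ^ 2 = (e * x - y) ^ 2 / e := by
    field_simp; ring
  have h2 : 0 ≤ (e * x - y) ^ 2 / e := by positivity
  linarith

set_option maxHeartbeats 2000000 in
lemma pw_high {k1 b K κ m β : ℝ} (hk : 1 ≤ k1) (hb : 0 < b) (hK : 0 < K) (hκ : 0 ≤ κ) (hm : 0 ≤ m)
    (hβ : 0 ≤ β) (hS : Struct k1 b K m) (hlt : β * κ * K < 1) : ∃ c0, 0 < c0 ∧ ∀ M Λ : ℝ, 0 ≤ M →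
    0 ≤ Λ → ∃ C, 0 ≤ C ∧
    ∀ s τ γ c σ ω φ p1 p2 α ρ l x B : ℝ, 0 ≤ φ → 0 ≤ l → 0 ≤ B → 0 ≤ p1 → 0 ≤ α →
    0 ≤ ω → ω ≤ 1 → ω * (c ^ 2 + σ ^ 2) = c ^ 2 →
    p1 * (c ^ 2 + σ ^ 2) ≤ 2 * β * φ → p2 ^ 2 * (c ^ 2 + σ ^ 2) ≤ 16 * φ →
    x ^ 2 * (c ^ 2 + σ ^ 2) ≤ B * (φ * l) → α ^ 2 * ρ ^ 2 ≤ M →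
    c0 * (φ * ((b * α) ^ 2 * (s ^ 2 + τ ^ 2) + α ^ 2 * (τ ^ 2 + (γ - k1 * s) ^ 2)))
      + κ * p1 * ((b * α) ^ 2 * (s * c + τ * σ) ^ 2 + α ^ 2 * (τ * c + (γ - k1 * s) * σ) ^ 2) * (1 + m * ω)
    ≤ 2 * φ * (α * (b * α)) * (τ ^ 2 - s * (γ - k1 * s)) + p2 * (α ^ 2 * ρ * (τ * c + (γ - k1 * s) * σ))
      + Λ * (2 * φ * l * (τ ^ 2 - s * (γ - k1 * s)) + x * (τ * c + (γ - k1 * s) * σ))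
      + C * (1 + B + φ * l * γ ^ 2 + φ * α ^ 2 * γ ^ 2) := by
  set N := 2 * b * (β * κ * K) + 2 * k1 + 2 * b with hN
  have hN0 : 0 < N := by positivity
  set gap := 2 * b * (1 - β * κ * K) with hgap
  have hgap0 : 0 < gap := by
    have : 0 < 1 - β * κ * K := by linarith
    positivity
  set e := gap / (2 * N) with he
  have he0 : 0 < e := by positivity
  have heN : e * N = gap / 2 := by rw [he]; field_simp
  set c0 := gap / 2 / (b ^ 2 + 2 * k1) with hc0
  have hc00 : 0 < c0 := by positivity
  have hc0e : c0 * (b ^ 2 + 2 * k1) = gap / 2 := by rw [hc0]; field_simp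
  refine ⟨c0, hc00, fun M Λ hM hΛ => ?_⟩
  set A := 2 * c0 + κ * (2 * β) * ((1 + 1 / e) * (1 + m)) + 2 * b / (4 * e) + 2 * e with hA
  have hA0 : 0 ≤ A := by positivity
  refine ⟨A + 4 * M / e + Λ * (2 + k1), by positivity, ?_⟩
  intro s τ γ c σ ω φ p1 p2 α ρ l x B hφ hl hB hp1 hα hω0 hω1 hω h1 h2 hx har
  have hlow := low_bound (s := s) (τ := τ) (γ := γ) hk hφ hl hB (by positivity : 0 < 1 / (2 * k1)) hx
  have hdet := det_lb (s := s) (τ := τ) (γ := γ) hk he0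
  have hSt := hS s τ c σ ω hω0 hω1 hω
  have hY2 := Y2_le (s := s) (τ := τ) (γ := γ) hk
  have hfx := flux_sq τ (γ - k1 * s) c σ
  have hsplit : (τ * c + (γ - k1 * s) * σ) ^ 2 ≤
      (1 + e) * (τ * c - k1 * s * σ) ^ 2 + (1 + 1 / e) * (γ * σ) ^ 2 := by
    have := sq_add_le (x := τ * c - k1 * s * σ) (y := γ * σ) he0
    rwa [show τ * c - k1 * s * σ + γ * σ = τ * c + (γ - k1 * s) * σ by ring] at this
  set q := γ - k1 * s with hq
  set j := k1 * s ^ 2 + τ ^ 2 with hj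
  have hj0 : 0 ≤ j := by positivity
  have hsj : s ^ 2 + τ ^ 2 ≤ j := by rw [hj]; nlinarith [sq_nonneg s]
  set y := τ * c + q * σ with hy
  set J := φ * α ^ 2 * j with hJ
  set P := φ * α ^ 2 * γ ^ 2 with hP
  have hJ0 : 0 ≤ J := by positivity
  have hP0 : 0 ≤ P := by positivity
  have hQ0 : 0 ≤ φ * l * γ ^ 2 := by positivity
  have t1 : c0 * (φ * ((b * α) ^ 2 * (s ^ 2 + τ ^ 2) + α ^ 2 * (τ ^ 2 + q ^ 2))) ≤
      gap / 2 * J + 2 * c0 * P := by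
    calc _ ≤ c0 * (φ * ((b * α) ^ 2 * j + α ^ 2 * (2 * γ ^ 2 + 2 * k1 * j))) := by gcongr
      _ = c0 * (b ^ 2 + 2 * k1) * J + 2 * c0 * P := by rw [hJ, hP]; ring
      _ = _ := by rw [hc0e]
  have t2 : κ * p1 * ((b * α) ^ 2 * (s * c + τ * σ) ^ 2 + α ^ 2 * y ^ 2) * (1 + m * ω) ≤
      (1 + e) * (2 * b * (β * κ * K)) * J + κ * (2 * β) * ((1 + 1 / e) * (1 + m)) * P := by
    have f1 : (b ^ 2 * (s * c + τ * σ) ^ 2 + y ^ 2) * (1 + m * ω) ≤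
        (1 + e) * (b * K * j * (c ^ 2 + σ ^ 2)) + (1 + 1 / e) * (1 + m) * γ ^ 2 * (c ^ 2 + σ ^ 2) := by
      calc _ ≤ (b ^ 2 * (s * c + τ * σ) ^ 2 + ((1 + e) * (τ * c - k1 * s * σ) ^ 2 + (1 + 1 / e) * (γ * σ) ^ 2)) * (1 + m * ω) := by gcongr
        _ = (1 + e) * ((b ^ 2 * (s * c + τ * σ) ^ 2 + (τ * c - k1 * s * σ) ^ 2) * (1 + m * ω))
            - e * b ^ 2 * (s * c + τ * σ) ^ 2 * (1 + m * ω) + (1 + 1 / e) * (1 + m * ω) * γ ^ 2 * σ ^ 2 := by ring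
        _ ≤ (1 + e) * (b * K * j * (c ^ 2 + σ ^ 2)) - 0 + (1 + 1 / e) * (1 + m * 1) * γ ^ 2 * (c ^ 2 + σ ^ 2) := by
            gcongr
            · positivity
            · linarith [sq_nonneg c]
        _ = _ := by ring
    calc _ = κ * p1 * α ^ 2 * ((b ^ 2 * (s * c + τ * σ) ^ 2 + y ^ 2) * (1 + m * ω)) := by ring
      _ ≤ κ * p1 * α ^ 2 * ((1 + e) * (b * K * j * (c ^ 2 + σ ^ 2)) + (1 + 1 / e) * (1 + m) * γ ^ 2 * (c ^ 2 + σ ^ 2)) := by gcongr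
      _ = κ * (p1 * (c ^ 2 + σ ^ 2)) * (α ^ 2 * ((1 + e) * (b * K * j) + (1 + 1 / e) * (1 + m) * γ ^ 2)) := by ring
      _ ≤ κ * (2 * β * φ) * (α ^ 2 * ((1 + e) * (b * K * j) + (1 + 1 / e) * (1 + m) * γ ^ 2)) := by gcongr
      _ = _ := by rw [hJ, hP]; ring
  have t3 : 2 * b * (1 - e) * J - 2 * b / (4 * e) * P ≤ 2 * φ * (α * (b * α)) * (τ ^ 2 - s * q) := by
    calc _ = 2 * φ * (α * (b * α)) * ((1 - e) * j - γ ^ 2 / (4 * e)) := by rw [hJ, hP]; ring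
      _ ≤ _ := by gcongr
  have t4 : -(2 * e * P + 2 * k1 * e * J + 4 * M / e) ≤ p2 * (α ^ 2 * ρ * y) := by
    have v2 : (p2 * (α ^ 2 * ρ * y)) ^ 2 ≤ (φ * α ^ 2 * (2 * γ ^ 2 + 2 * k1 * j)) * (16 * M) := by
      have f2 : y ^ 2 ≤ (2 * γ ^ 2 + 2 * k1 * j) * (c ^ 2 + σ ^ 2) := hfx.trans (by gcongr)
      calc _ = p2 ^ 2 * α ^ 2 * (α ^ 2 * ρ ^ 2) * y ^ 2 := by ring
        _ ≤ p2 ^ 2 * α ^ 2 * M * ((2 * γ ^ 2 + 2 * k1 * j) * (c ^ 2 + σ ^ 2)) := by gcongr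
        _ = (p2 ^ 2 * (c ^ 2 + σ ^ 2)) * (α ^ 2 * M * (2 * γ ^ 2 + 2 * k1 * j)) := by ring
        _ ≤ (16 * φ) * (α ^ 2 * M * (2 * γ ^ 2 + 2 * k1 * j)) := by gcongr
        _ = _ := by ring
    have h := young_abs (by positivity) (by positivity) he0 v2
    have h' := neg_abs_le (p2 * (α ^ 2 * ρ * y))
    have e1 : e * (φ * α ^ 2 * (2 * γ ^ 2 + 2 * k1 * j)) + 16 * M / (4 * e) =
      2 * e * P + 2 * k1 * e * J + 4 * M / e := by rw [hJ, hP]; field_simp; ring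
    linarith
  have e1 : 1 - 2 * k1 * (1 / (2 * k1)) = 0 := by field_simp; norm_num
  have e2 : 1 + 2 * (1 / (2 * k1)) ≤ 2 := by
    have : 1 / (2 * k1) ≤ 1 / 2 := by apply one_div_le_one_div_of_le <;> linarith
    linarith
  have e3 : B / (4 * (1 / (2 * k1))) = B * k1 / 2 := by field_simp; norm_num
  rw [e1, e3] at hlow
  have hlow2 : - (2 * (φ * l * γ ^ 2)) - B * k1 ≤ 2 * φ * l * (τ ^ 2 - s * q) + x * y := by
    have h5 : (1 + 2 * (1 / (2 * k1))) * (φ * l * γ ^ 2) ≤ 2 * (φ * l * γ ^ 2) := by gcongr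
    have h6 : 0 ≤ B * k1 := by positivity
    linarith
  have t5 := mul_le_mul_of_nonneg_left hlow2 hΛ
  have key : gap / 2 * J + (1 + e) * (2 * b * (β * κ * K)) * J + 2 * k1 * e * J ≤ 2 * b * (1 - e) * J := by
    have : gap / 2 + (1 + e) * (2 * b * (β * κ * K)) + 2 * k1 * e = 2 * b * (1 - e) := by
      have h7 : e * (2 * b * (β * κ * K) + 2 * k1 + 2 * b) = gap / 2 := by rw [← hN]; exact heN
      have h8 : gap = 2 * b - 2 * b * (β * κ * K) := by rw [hgap]; ring
      linarith
    rw [← this]; apply le_of_eq; ring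
  set Q := φ * l * γ ^ 2 with hQ
  have hMe : 0 ≤ 4 * M / e := by positivity
  have fin : A * P + 4 * M / e + Λ * (2 * Q + B * k1) ≤
      (A + 4 * M / e + Λ * (2 + k1)) * (1 + B + Q + P) := by
    have : 0 ≤ (A + Λ * (2 + k1)) * 1 := by positivity
    have : 0 ≤ (A + 4 * M / e + Λ * 2) * B := by positivity
    have : 0 ≤ (A + 4 * M / e + Λ * k1) * Q := by positivity
    have : 0 ≤ (4 * M / e + Λ * (2 + k1)) * P := by positivity
    linarith
  have hAP : A * P = 2 * c0 * P + κ * (2 * β) * ((1 + 1 / e) * (1 + m)) * P + 2 * b / (4 * e) * P + 2 * e * P := by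
    rw [hA]; ring
  linarith

end PLap

namespace PLap

lemma struct_sqrt {k : ℝ} (hk : 1 < k) : Struct (k ^ 2) k k ((k ^ 2 - 1) / k ^ 2) := by
  intro s τ c σ ω h0 h1 h
  have hk1 : 0 < k ^ 2 - 1 := by nlinarith
  set m := (k ^ 2 - 1) / k ^ 2 with hm
  have hmk : m * k ^ 2 = k ^ 2 - 1 := by rw [hm]; field_simp
  have hm0 : 0 ≤ m := by positivity
  have e : k ^ 2 * (s * c + τ * σ) ^ 2 + (τ * c - k ^ 2 * s * σ) ^ 2 =
    (k ^ 2 * s ^ 2 + τ ^ 2) * (c ^ 2 + k ^ 2 * σ ^ 2) := by ring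
  have e2 : c ^ 2 + k ^ 2 * σ ^ 2 = (k ^ 2 - (k ^ 2 - 1) * ω) * (c ^ 2 + σ ^ 2) := by
    linear_combination (k ^ 2 - 1) * h
  have e3 : (k ^ 2 - (k ^ 2 - 1) * ω) * (1 + m * ω) ≤ k ^ 2 := by
    have : (k ^ 2 - (k ^ 2 - 1) * ω) * (1 + m * ω) = k ^ 2 - m * (k ^ 2 - 1) * ω ^ 2 := by
      linear_combination ω * hmk
    rw [this]
    have : 0 ≤ m * (k ^ 2 - 1) * ω ^ 2 := by positivity
    linarith
  rw [e, e2]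
  calc _ = (k ^ 2 * s ^ 2 + τ ^ 2) * (c ^ 2 + σ ^ 2) * ((k ^ 2 - (k ^ 2 - 1) * ω) * (1 + m * ω)) := by ring
    _ ≤ (k ^ 2 * s ^ 2 + τ ^ 2) * (c ^ 2 + σ ^ 2) * k ^ 2 := by gcongr
    _ = _ := by ring

lemma struct_full {k1 : ℝ} (hk : 1 < k1) : Struct k1 k1 k1 0 := by
  intro s τ c σ ω h0 h1 h
  have a1 : 0 ≤ (k1 - 1) * (k1 * s * σ - τ * c) ^ 2 := by
    have : 0 ≤ k1 - 1 := by linarith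
    positivity
  have a2 : 0 ≤ (k1 - 1) * (k1 * (τ * c) ^ 2) := by
    have : 0 ≤ k1 - 1 := by linarith
    positivity
  have a3 : 0 ≤ (k1 - 1) * (k1 ^ 2 * (s * c) ^ 2) := by
    have : 0 ≤ k1 - 1 := by linarith
    positivity
  nlinarith

/-- integration by parts identity -/
lemma ibp (f g : ℂ → ℝ) (hf : ContDiff ℝ 1 f) (hfs : HasCompactSupport f) (hg : ContDiff ℝ 1 g)
    (v : ℂ) : ∫ z, f z * fderiv ℝ g z v = -∫ z, fderiv ℝ f z v * g z := by
  have hfc := hf.continuous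
  have hgc := hg.continuous
  have h1 : Continuous fun z => fderiv ℝ f z v := (hf.continuous_fderiv (by norm_num)).clm_apply continuous_const
  have h2 : Continuous fun z => fderiv ℝ g z v := (hg.continuous_fderiv (by norm_num)).clm_apply continuous_const
  have h3 : HasCompactSupport fun z => fderiv ℝ f z v := hfs.fderiv_apply ℝ v
  apply integral_mul_fderiv_eq_neg_fderiv_mul_of_integrable
  · exact (h1.mul hgc).integrable_of_hasCompactSupport h3.mul_right
  · exact (hfc.mul h2).integrable_of_hasCompactSupport hfs.mul_right
  · exact (hfc.mul hgc).integrable_of_hasCompactSupport hfs.mul_right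
  · exact fun x _ => hf.differentiable (by norm_num) x
  · exact fun x _ => hg.differentiable (by norm_num) x

lemma cross_hasFDerivAt {f g : ℂ → ℂ} {f' g' : ℂ →L[ℝ] ℂ} {z : ℂ} (hf : HasFDerivAt f f' z)
    (hg : HasFDerivAt g g' z) : ∃ L : ℂ →L[ℝ] ℝ, HasFDerivAt (fun z => cross (f z) (g z)) L z ∧
      ∀ v, L v = cross (f' v) (g z) + cross (f z) (g' v) := by
  have a1 := Complex.reCLM.hasFDerivAt.comp z hf
  have a2 := Complex.imCLM.hasFDerivAt.comp z hf
  have b1 := Complex.reCLM.hasFDerivAt.comp z hg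
  have b2 := Complex.imCLM.hasFDerivAt.comp z hg
  refine ⟨_, (a1.mul b2).sub (a2.mul b1), fun v => ?_⟩
  simp [cross]; ring

lemma normSq_hasFDerivAt {f : ℂ → ℂ} {f' : ℂ →L[ℝ] ℂ} {z : ℂ} (hf : HasFDerivAt f f' z) :
    ∃ L : ℂ →L[ℝ] ℝ, HasFDerivAt (fun z => ‖f z‖ ^ 2) L z ∧ ∀ v, L v = 2 * dot (f z) (f' v) := by
  have a1 := Complex.reCLM.hasFDerivAt.comp z hf
  have a2 := Complex.imCLM.hasFDerivAt.comp z hf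
  simp only [norm_sq_eq]
  refine ⟨_, (a1.pow 2).add (a2.pow 2), fun v => ?_⟩
  simp [dot]; ring

lemma contDiff_cross {n : WithTop ℕ∞} {f g : ℂ → ℂ} (hf : ContDiff ℝ n f) (hg : ContDiff ℝ n g) :
    ContDiff ℝ n fun z => cross (f z) (g z) := by
  unfold cross
  have a1 := Complex.reCLM.contDiff.comp hf
  have a2 := Complex.imCLM.contDiff.comp hf
  have b1 := Complex.reCLM.contDiff.comp hg
  have b2 := Complex.imCLM.contDiff.comp hg
  exact (a1.mul b2).sub (a2.mul b1)

lemma contDiff_normSq {n : WithTop ℕ∞} {f : ℂ → ℂ} (hf : ContDiff ℝ n f) :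
    ContDiff ℝ n fun z => ‖f z‖ ^ 2 := by
  simp only [norm_sq_eq]
  have a1 := Complex.reCLM.contDiff.comp hf
  have a2 := Complex.imCLM.contDiff.comp hf
  exact (a1.pow 2).add (a2.pow 2)

lemma identity (φ : ℂ → ℝ) (hφ : ContDiff ℝ 1 φ) (hφs : HasCompactSupport φ) (m : ℝ → ℝ)
    (hm : ContDiff ℝ 1 m) (Z : ℂ → ℂ) (hZ : ContDiff ℝ 2 Z) :
    ∫ z, (2 * φ z * (m (‖Z z‖ ^ 2) + ‖Z z‖ ^ 2 * deriv m (‖Z z‖ ^ 2)) *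
        (-cross (fderiv ℝ Z z 1) (fderiv ℝ Z z Complex.I))
      - m (‖Z z‖ ^ 2) * (fderiv ℝ φ z 1 * cross (Z z) (fderiv ℝ Z z Complex.I)
          - fderiv ℝ φ z Complex.I * cross (Z z) (fderiv ℝ Z z 1))) = 0 := by
  have hZ1 : ContDiff ℝ 1 Z := hZ.of_le (by norm_num)
  have hdZ : ∀ v, ContDiff ℝ 1 fun z => fderiv ℝ Z z v := fun v =>
    (hZ.fderiv_right (m := 1) (by norm_num)).clm_apply contDiff_const
  have hV : ∀ v, ContDiff ℝ 1 fun z => cross (Z z) (fderiv ℝ Z z v) := fun v =>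
    contDiff_cross hZ1 (hdZ v)
  set f : ℂ → ℝ := fun z => φ z * m (‖Z z‖ ^ 2) with hf
  have hfd : ContDiff ℝ 1 f := hφ.mul (hm.comp (contDiff_normSq hZ1))
  have hfs : HasCompactSupport f := hφs.mul_right
  have i1 := ibp f _ hfd hfs (hV Complex.I) 1
  have i2 := ibp f _ hfd hfs (hV 1) Complex.I
  have hZd : ∀ z, HasFDerivAt Z (fderiv ℝ Z z) z := fun z =>
    ((hZ1.differentiable (by norm_num)) z).hasFDerivAt
  have hDd : ∀ z, HasFDerivAt (fderiv ℝ Z) (fderiv ℝ (fderiv ℝ Z) z) z := fun z =>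
    (((hZ.fderiv_right (m := 1) (by norm_num)).differentiable (by norm_num)) z).hasFDerivAt
  have hDv : ∀ z v, HasFDerivAt (fun z => fderiv ℝ Z z v) ((fderiv ℝ (fderiv ℝ Z) z).flip v) z := by
    intro z v
    have := (hDd z).clm_apply (hasFDerivAt_const v z)
    refine this.congr_fderiv ?_
    ext1 w
    simp
  have hsymm : ∀ z v w, fderiv ℝ (fderiv ℝ Z) z v w = fderiv ℝ (fderiv ℝ Z) z w v := by
    intro z v w
    exact (hZ.contDiffAt.isSymmSndFDerivAt (by simp)) v w
  have dV : ∀ z v w, fderiv ℝ (fun z => cross (Z z) (fderiv ℝ Z z v)) z w =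
      cross (fderiv ℝ Z z w) (fderiv ℝ Z z v) + cross (Z z) (fderiv ℝ (fderiv ℝ Z) z w v) := by
    intro z v w
    obtain ⟨L, hL, hLv⟩ := cross_hasFDerivAt (hZd z) (hDv z v)
    rw [hL.fderiv, hLv]; rfl
  have df : ∀ z v, fderiv ℝ f z v = fderiv ℝ φ z v * m (‖Z z‖ ^ 2) +
      φ z * (deriv m (‖Z z‖ ^ 2) * (2 * dot (Z z) (fderiv ℝ Z z v))) := by
    intro z v
    obtain ⟨L, hL, hLv⟩ := normSq_hasFDerivAt (hZd z)
    have h1 : HasFDerivAt φ (fderiv ℝ φ z) z := ((hφ.differentiable (by norm_num)) z).hasFDerivAt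
    have h2 : HasDerivAt m (deriv m (‖Z z‖ ^ 2)) (‖Z z‖ ^ 2) :=
      ((hm.differentiable (by norm_num)) _).hasDerivAt
    have h3 := h1.mul (h2.comp_hasFDerivAt z hL)
    have h4 : fderiv ℝ f z = _ := h3.fderiv
    rw [h4]
    simp [hLv]
    ring
  have cf1 : ∀ v w, Continuous fun z => f z * fderiv ℝ (fun z => cross (Z z) (fderiv ℝ Z z v)) z w :=
    fun v w => hfd.continuous.mul (((hV v).continuous_fderiv (by norm_num)).clm_apply continuous_const)
  have cf2 : ∀ v w, Continuous fun z => fderiv ℝ f z w * cross (Z z) (fderiv ℝ Z z v) :=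
    fun v w => (((hfd).continuous_fderiv (by norm_num)).clm_apply continuous_const).mul (hV v).continuous
  have I1 : ∀ v w, Integrable fun z => f z * fderiv ℝ (fun z => cross (Z z) (fderiv ℝ Z z v)) z w :=
    fun v w => (cf1 v w).integrable_of_hasCompactSupport hfs.mul_right
  have I2 : ∀ v w, Integrable fun z => fderiv ℝ f z w * cross (Z z) (fderiv ℝ Z z v) :=
    fun v w => (cf2 v w).integrable_of_hasCompactSupport (hfs.fderiv_apply ℝ w).mul_right
  have tot : ∫ z, (f z * fderiv ℝ (fun z => cross (Z z) (fderiv ℝ Z z Complex.I)) z 1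
      + fderiv ℝ f z 1 * cross (Z z) (fderiv ℝ Z z Complex.I)
      - (f z * fderiv ℝ (fun z => cross (Z z) (fderiv ℝ Z z 1)) z Complex.I
      + fderiv ℝ f z Complex.I * cross (Z z) (fderiv ℝ Z z 1))) = 0 := by
    rw [integral_sub, integral_add (I1 _ _) (I2 _ _), integral_add (I1 _ _) (I2 _ _), i1, i2]
    · ring
    · exact (I1 _ _).add (I2 _ _)
    · exact (I1 _ _).add (I2 _ _)
  rw [← neg_zero, ← tot, ← integral_neg]
  congr 1
  ext z
  rw [dV, dV, df, df, hsymm z Complex.I 1]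
  have e := norm_sq_eq (Z z)
  simp only [hf]
  set mm := m (‖Z z‖ ^ 2)
  set dm := deriv m (‖Z z‖ ^ 2)
  rw [e]
  simp only [cross, dot]
  ring

end PLap

namespace PLap

lemma polar_symm_eq (p : ℝ × ℝ) : Complex.polarCoord.symm p = p.1 * E p.2 := by
  rw [Complex.polarCoord_symm_apply]
  congr 1
  apply Complex.ext
  · rw [E_re]; simp [Complex.cos_ofReal_re]
  · rw [E_im]; simp [Complex.sin_ofReal_re]

lemma polar_target : Complex.polarCoord.target = Set.Ioi (0 : ℝ) ×ˢ Set.Ioo (-π) π := rfl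

lemma integral_polar {V : Type*} [NormedAddCommGroup V] [NormedSpace ℝ V] (f : ℂ → V) :
    ∫ z, f z = ∫ p in Set.Ioi (0 : ℝ) ×ˢ Set.Ioo (-π) π, p.1 • f (p.1 * E p.2) := by
  rw [← Complex.integral_comp_polarCoord_symm, ← polar_target]
  simp only [polar_symm_eq]
  rfl

lemma integrableOn_polar (f : ℂ → ℝ) (hf : Continuous f) (hi : Integrable f) :
    IntegrableOn (fun p : ℝ × ℝ => p.1 * f (p.1 * E p.2)) (Set.Ioi (0 : ℝ) ×ˢ Set.Ioo (-π) π) := by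
  refine ⟨(by fun_prop : Continuous fun p : ℝ × ℝ => p.1 * f (p.1 * E p.2)).aestronglyMeasurable, ?_⟩
  have h := hi.2
  unfold HasFiniteIntegral at h ⊢
  rw [← Complex.lintegral_comp_polarCoord_symm] at h
  refine lt_of_le_of_lt (le_of_eq ?_) h
  refine setLIntegral_congr_fun (measurableSet_Ioi.prod measurableSet_Ioo) ?_
  intro p hp
  have h0 : 0 < p.1 := hp.1
  simp only [polar_symm_eq, enorm_mul, smul_eq_mul]
  rw [Real.enorm_eq_ofReal h0.le]

lemma integral_Ioo_eq (f : ℝ → ℝ) : ∫ x in Set.Ioo (-π) π, f x = ∫ x in (-π)..π, f x := by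
  rw [intervalIntegral.integral_of_le (by linarith [pi_pos]), integral_Ioc_eq_integral_Ioo]

lemma polar_nonneg (D : ℂ → ℝ) (h : ∀ r : ℝ, 0 < r → 0 ≤ ∫ x in (-π)..π, D (r * E x)) :
    0 ≤ ∫ z, D z := by
  rw [integral_polar]
  by_cases hi : IntegrableOn (fun p : ℝ × ℝ => p.1 • D (p.1 * E p.2)) (Set.Ioi (0 : ℝ) ×ˢ Set.Ioo (-π) π)
    (volume.prod volume)
  · rw [Measure.volume_eq_prod, setIntegral_prod _ hi]
    apply setIntegral_nonneg measurableSet_Ioi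
    intro r hr
    simp only [smul_eq_mul, integral_const_mul]
    rw [integral_Ioo_eq]
    exact mul_nonneg (le_of_lt hr) (h r hr)
  · rw [integral_undef (by exact hi)]

/-- restricting to an annulus -/
lemma polar_annulus (g : ℂ → ℝ) (hg : Continuous g) (hi : Integrable g) (h0 : ∀ z, 0 ≤ g z)
    (a b : ℝ) (ha : 0 < a) (hab : a ≤ b) :
    ∫ x in (-π)..π, ∫ s in a..b, s * g (s * E x) ≤ ∫ z, g z := by
  rw [integral_polar]
  have hI := integrableOn_polar g hg hi
  have hsub : Set.Ioc a b ×ˢ Set.Ioo (-π) π ⊆ Set.Ioi (0 : ℝ) ×ˢ Set.Ioo (-π) π := by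
    apply Set.prod_mono_left
    intro x hx; exact ha.trans hx.1
  have hm : ∫ p in Set.Ioc a b ×ˢ Set.Ioo (-π) π, p.1 * g (p.1 * E p.2) ≤
      ∫ p in Set.Ioi (0 : ℝ) ×ˢ Set.Ioo (-π) π, p.1 • g (p.1 * E p.2) := by
    apply setIntegral_mono_set hI
    · refine (ae_restrict_iff' (measurableSet_Ioi.prod measurableSet_Ioo)).2 ?_
      exact Filter.Eventually.of_forall fun p hp => mul_nonneg (le_of_lt hp.1) (h0 _)
    · exact Filter.Eventually.of_forall hsub
  refine le_trans (le_of_eq ?_) hm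
  have hI2 := hI.mono_set hsub
  rw [Measure.volume_eq_prod] at hI2 ⊢
  rw [← setIntegral_prod_swap, setIntegral_prod]
  · rw [integral_Ioo_eq]
    congr 1
    ext x
    rw [intervalIntegral.integral_of_le hab]
    rfl
  · have := hI2
    unfold IntegrableOn at this ⊢
    rw [← Measure.prod_restrict] at this ⊢
    exact this.swap

lemma fderiv_circle (F : ℂ → ℂ) (hF : ContDiff ℝ 1 F) (r : ℝ) (x : ℝ) :
    HasDerivAt (fun x : ℝ => F (r * E x)) (fderiv ℝ F (r * E x) (Complex.I * (r * E x))) x := by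
  have h1 : HasFDerivAt F (fderiv ℝ F (r * E x)) (r * E x) :=
    ((hF.differentiable (by norm_num)) _).hasFDerivAt
  have h2 := (hasDerivAt_E x).const_mul (r : ℂ)
  have := h1.comp_hasDerivAt x h2
  rw [show Complex.I * (r * E x) = r * (Complex.I * E x) by ring]
  exact this

lemma fderiv_radial (F : ℂ → ℂ) (hF : ContDiff ℝ 1 F) (r : ℝ) (x : ℝ) :
    HasDerivAt (fun r : ℝ => F (r * E x)) (fderiv ℝ F (r * E x) (E x)) r := by
  have h1 : HasFDerivAt F (fderiv ℝ F (r * E x)) (r * E x) :=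
    ((hF.differentiable (by norm_num)) _).hasFDerivAt
  have h2 : HasDerivAt (fun r : ℝ => (r : ℂ) * E x) (1 * E x) r :=
    (Complex.ofRealCLM.hasDerivAt (x := r)).mul_const (E x)
  have := h1.comp_hasDerivAt r h2
  rw [one_mul] at this
  exact this

/-- the circle defect -/
def circD (m κ : ℝ) (h : ℝ → ℝ) (F : ℂ → ℂ) (z : ℂ) : ℝ :=
  h ‖z‖ * (κ * (‖fderiv ℝ F z (Complex.I * z)‖ ^ 2 * (1 + m * cosSq (F z) (Complex.I * (z / ‖z‖))))
    + cross (F z) (fderiv ℝ F z (Complex.I * z)))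

lemma circle_plane {m κ : ℝ} (hC : CircleIneq m κ) (h : ℝ → ℝ) (h0 : ∀ r, 0 < r → 0 ≤ h r) (F : ℂ → ℂ)
    (hF : ContDiff ℝ 1 F) : 0 ≤ ∫ z, circD m κ h F z := by
  apply polar_nonneg
  intro r hr
  have hn : ∀ x, ‖(r : ℂ) * E x‖ = r := by
    intro x; rw [norm_mul, norm_E, Complex.norm_real, mul_one, Real.norm_eq_abs, abs_of_pos hr]
  have hdiv : ∀ x, (r : ℂ) * E x / (r : ℂ) = E x := by
    intro x
    have : (r : ℂ) ≠ 0 := by exact_mod_cast hr.ne'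
    field_simp
  simp only [circD, hn, hdiv, intervalIntegral.integral_const_mul]
  apply mul_nonneg (h0 r hr)
  have hFc := hF.continuous
  have hdc : Continuous fun x : ℝ => fderiv ℝ F (r * E x) (Complex.I * (r * E x)) := by
    have := hF.continuous_fderiv (by norm_num)
    exact (this.comp (by fun_prop)).clm_apply (by fun_prop)
  have := hC (fun x => F (r * E x)) _ (fun x => fderiv_circle F hF r x) hdc
    (by simp [E_pi, E_neg_pi])
  have hcF : Continuous fun x : ℝ => F (r * E x) := by fun_prop
  rw [intervalIntegral.integral_add, intervalIntegral.integral_const_mul]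
  · linarith
  · apply IntervalIntegrable.const_mul
    have e : ∀ x, ‖fderiv ℝ F (r * E x) (Complex.I * (r * E x))‖ ^ 2 * (1 + m * cosSq (F (r * E x)) (Complex.I * E x))
      = ‖fderiv ℝ F (r * E x) (Complex.I * (r * E x))‖ ^ 2 +
        m * (‖fderiv ℝ F (r * E x) (Complex.I * (r * E x))‖ ^ 2 * cosSq (F (r * E x)) (Complex.I * E x)) := by
      intro x; ring
    simp only [e]
    apply IntervalIntegrable.add
    · exact (by fun_prop : Continuous fun x => ‖fderiv ℝ F (r * E x) (Complex.I * (r * E x))‖ ^ 2).intervalIntegrable _ _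
    · apply IntervalIntegrable.const_mul
      exact intervalIntegrable_cosSq _ hcF _ (by fun_prop)
  · exact (by fun_prop : Continuous fun x : ℝ => cross (F (r * E x)) (fderiv ℝ F (r * E x) (Complex.I * (r * E x)))).intervalIntegrable _ _

end PLap

namespace PLap

/-- positive part squared -/
def posq (x : ℝ) : ℝ := (max x 0) ^ 2

lemma posq_nonneg (x : ℝ) : 0 ≤ posq x := sq_nonneg _

lemma posq_of_nonpos {x : ℝ} (h : x ≤ 0) : posq x = 0 := by simp [posq, max_eq_right h]
lemma posq_of_nonneg {x : ℝ} (h : 0 ≤ x) : posq x = x ^ 2 := by simp [posq, max_eq_left h]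

lemma posq_hasDerivAt (x : ℝ) : HasDerivAt posq (2 * max x 0) x := by
  rcases lt_trichotomy x 0 with h | h | h
  · have : HasDerivAt (fun _ : ℝ => (0:ℝ)) 0 x := hasDerivAt_const x 0
    rw [max_eq_right h.le, mul_zero]
    refine this.congr_of_eventuallyEq ?_
    filter_upwards [Iio_mem_nhds h] with y hy
    exact posq_of_nonpos (le_of_lt hy)
  · subst h
    rw [hasDerivAt_iff_isLittleO_nhds_zero]
    simp only [zero_add, max_self, mul_zero, smul_zero, sub_zero, posq_of_nonpos le_rfl]
    have h1 : (fun h : ℝ => posq h) =O[nhds 0] fun h : ℝ => h ^ 2 := by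
      refine Asymptotics.IsBigO.of_bound 1 (Filter.Eventually.of_forall fun h => ?_)
      rw [one_mul, Real.norm_eq_abs, Real.norm_eq_abs, abs_of_nonneg (posq_nonneg h), abs_of_nonneg (sq_nonneg h)]
      unfold posq
      rcases le_total h 0 with h0 | h0
      · rw [max_eq_right h0]; nlinarith
      · rw [max_eq_left h0]
    refine h1.trans_isLittleO ?_
    have := Asymptotics.isLittleO_pow_id (𝕜 := ℝ) (n := 2) (by norm_num)
    exact this
  · have : HasDerivAt (fun y : ℝ => y ^ 2) (2 * x) x := by simpa using hasDerivAt_pow 2 x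
    rw [max_eq_left h.le]
    refine this.congr_of_eventuallyEq ?_
    filter_upwards [Ioi_mem_nhds h] with y hy
    exact posq_of_nonneg (le_of_lt hy)

lemma posq_contDiff : ContDiff ℝ 1 posq := by
  rw [contDiff_one_iff_deriv]
  refine ⟨fun x => (posq_hasDerivAt x).differentiableAt, ?_⟩
  have : deriv posq = fun x => 2 * max x 0 := funext fun x => (posq_hasDerivAt x).deriv
  rw [this]; fun_prop

/-- spatial weight -/
def wt (β e : ℝ) (z : ℂ) : ℝ := (‖z‖ ^ 2 + e) ^ (-β) * posq (1 - ‖z‖ ^ 2)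
def wp1 (β e s : ℝ) : ℝ := 2 * β * ((s + e) ^ (-β - 1) * posq (1 - s))
def wp2 (β e s : ℝ) : ℝ := 4 * max (1 - s) 0 * (s + e) ^ (-β)

lemma wt_nonneg {β e : ℝ} (he : 0 < e) (z : ℂ) : 0 ≤ wt β e z :=
  mul_nonneg (rpow_nonneg (by positivity) _) (posq_nonneg _)

lemma wt_contDiff {β e : ℝ} (he : 0 < e) : ContDiff ℝ 1 (wt β e) := by
  have h : ContDiff ℝ 1 fun z : ℂ => ‖z‖ ^ 2 := contDiff_normSq contDiff_id
  refine ContDiff.mul (ContDiff.rpow_const_of_ne (h.add contDiff_const) fun z => ?_)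
    (posq_contDiff.comp (contDiff_const.sub h))
  positivity

lemma wt_zero {β e : ℝ} {z : ℂ} (h : 1 ≤ ‖z‖) : wt β e z = 0 := by
  unfold wt; rw [posq_of_nonpos (by nlinarith)]; simp

lemma wt_compact {β e : ℝ} : HasCompactSupport (wt β e) := by
  refine HasCompactSupport.of_support_subset_isCompact (isCompact_closedBall (0:ℂ) 1) ?_
  intro z hz
  rw [mem_closedBall, dist_zero_right]
  by_contra h
  exact hz (wt_zero (not_le.1 h).le)

lemma wt_fderiv {β e : ℝ} (he : 0 < e) (z v : ℂ) :
    fderiv ℝ (wt β e) z v = -(wp1 β e (‖z‖ ^ 2) + wp2 β e (‖z‖ ^ 2)) * dot z v := by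
  obtain ⟨L, hL, hLv⟩ := normSq_hasFDerivAt (hasFDerivAt_id (𝕜 := ℝ) z)
  simp only [id] at hL hLv
  have hpos : 0 < ‖z‖ ^ 2 + e := by positivity
  have h1 : HasDerivAt (fun s : ℝ => (s + e) ^ (-β)) ((-β) * (‖z‖ ^ 2 + e) ^ (-β - 1)) (‖z‖ ^ 2) := by
    have := ((hasDerivAt_id (‖z‖ ^ 2)).add_const e).rpow_const (p := -β) (Or.inl hpos.ne')
    simpa using this
  have h2 : HasDerivAt (fun s : ℝ => posq (1 - s)) (2 * max (1 - ‖z‖ ^ 2) 0 * (-1)) (‖z‖ ^ 2) := by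
    have := (posq_hasDerivAt (1 - ‖z‖ ^ 2)).comp (‖z‖ ^ 2) ((hasDerivAt_id (‖z‖ ^ 2)).const_sub 1)
    exact this
  have h3 := (h1.mul h2).comp_hasFDerivAt z hL
  have h4 : fderiv ℝ (wt β e) z = _ := h3.fderiv
  rw [h4]
  simp only [ContinuousLinearMap.smul_apply, smul_eq_mul, hLv, wp1, wp2]
  simp only [ContinuousLinearMap.id_apply]
  ring

lemma wp1_nonneg {β e s : ℝ} (hβ : 0 ≤ β) (he : 0 < e) (hs : 0 ≤ s) : 0 ≤ wp1 β e s :=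
  mul_nonneg (by positivity) (mul_nonneg (rpow_nonneg (by positivity) _) (posq_nonneg _))

lemma rpow_aux {β e s : ℝ} (hβ : 0 ≤ β) (hβ1 : β ≤ 1) (he : 0 < e) (hs : 0 ≤ s) (hs1 : s ≤ 1) :
    (s + e) ^ (-β) * s ≤ 1 := by
  have hp : 0 < s + e := by positivity
  rw [rpow_neg hp.le, inv_mul_le_iff₀ (rpow_pos_of_pos hp _), mul_one]
  rcases hs.eq_or_lt with h | h
  · rw [← h]; exact rpow_nonneg (by linarith) _
  · calc s = s ^ (1:ℝ) := (rpow_one s).symm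
      _ ≤ s ^ β := rpow_le_rpow_of_exponent_ge h hs1 hβ1
      _ ≤ (s + e) ^ β := rpow_le_rpow hs (by linarith) hβ

lemma wp1_bound {β e : ℝ} (hβ : 0 ≤ β) (he : 0 < e) (z : ℂ) :
    wp1 β e (‖z‖ ^ 2) * ‖z‖ ^ 2 ≤ 2 * β * wt β e z := by
  have hp : 0 < ‖z‖ ^ 2 + e := by positivity
  unfold wp1 wt
  rw [rpow_sub_one hp.ne']
  have h1 : ‖z‖ ^ 2 / (‖z‖ ^ 2 + e) ≤ 1 := by rw [div_le_one hp]; linarith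
  have h2 : 0 ≤ 2 * β * ((‖z‖ ^ 2 + e) ^ (-β) * posq (1 - ‖z‖ ^ 2)) :=
    mul_nonneg (by positivity) (mul_nonneg (rpow_nonneg hp.le _) (posq_nonneg _))
  calc _ = 2 * β * ((‖z‖ ^ 2 + e) ^ (-β) * posq (1 - ‖z‖ ^ 2)) * (‖z‖ ^ 2 / (‖z‖ ^ 2 + e)) := by ring
    _ ≤ _ := mul_le_of_le_one_right h2 h1

lemma wp2_bound {β e : ℝ} (hβ : 0 ≤ β) (hβ1 : β ≤ 1) (he : 0 < e) (z : ℂ) :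
    wp2 β e (‖z‖ ^ 2) ^ 2 * ‖z‖ ^ 2 ≤ 16 * wt β e z := by
  by_cases hs : ‖z‖ ^ 2 ≤ 1
  · have h := rpow_aux hβ hβ1 he (sq_nonneg ‖z‖) hs
    have h2 := wt_nonneg (β := β) he z
    calc _ = 16 * wt β e z * ((‖z‖ ^ 2 + e) ^ (-β) * ‖z‖ ^ 2) := by unfold wp2 wt posq; ring
      _ ≤ _ := mul_le_of_le_one_right (by positivity) h
  · have : wp2 β e (‖z‖ ^ 2) = 0 := by
      unfold wp2; rw [max_eq_right (by linarith)]; ring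
    rw [this]; have := wt_nonneg (β := β) he z; nlinarith

lemma wp_bound {β e : ℝ} (hβ : 0 ≤ β) (hβ1 : β ≤ 1) (he : 0 < e) (he1 : e ≤ 1) (z : ℂ) :
    (wp1 β e (‖z‖ ^ 2) + wp2 β e (‖z‖ ^ 2)) ^ 2 * ‖z‖ ^ 2 ≤ 40 * (e ^ 2)⁻¹ * wt β e z := by
  have hw := wt_nonneg (β := β) he z
  have hp : 0 < ‖z‖ ^ 2 + e := by positivity
  have he2 : 1 ≤ (e ^ 2)⁻¹ := by
    rw [one_le_inv₀ (by positivity)]; nlinarith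
  have h2 : wp2 β e (‖z‖ ^ 2) ^ 2 * ‖z‖ ^ 2 ≤ 16 * ((e ^ 2)⁻¹ * wt β e z) := by
    refine (wp2_bound hβ hβ1 he z).trans ?_
    have : wt β e z ≤ (e ^ 2)⁻¹ * wt β e z := le_mul_of_one_le_left hw he2
    linarith
  have h1 : wp1 β e (‖z‖ ^ 2) ^ 2 * ‖z‖ ^ 2 ≤ 4 * ((e ^ 2)⁻¹ * wt β e z) := by
    by_cases hs : ‖z‖ ^ 2 ≤ 1
    · have h := rpow_aux hβ hβ1 he (sq_nonneg ‖z‖) hs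
      have e1 : wp1 β e (‖z‖ ^ 2) ^ 2 * ‖z‖ ^ 2 = 4 * (β ^ 2 * (((‖z‖ ^ 2 + e) ^ 2)⁻¹ * wt β e z) *
          ((‖z‖ ^ 2 + e) ^ (-β) * ‖z‖ ^ 2) * posq (1 - ‖z‖ ^ 2)) := by
        unfold wp1 wt; rw [rpow_sub_one hp.ne']; field_simp; ring
      rw [e1]
      have a1 : ((‖z‖ ^ 2 + e) ^ 2)⁻¹ ≤ (e ^ 2)⁻¹ := by
        apply inv_anti₀ (by positivity)
        apply pow_le_pow_left₀ he.le; linarith [sq_nonneg ‖z‖]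
      have a2 : posq (1 - ‖z‖ ^ 2) ≤ 1 := by
        rw [posq_of_nonneg (by linarith)]
        have := sq_nonneg ‖z‖
        nlinarith
      have a3 : ((‖z‖ ^ 2 + e) ^ 2)⁻¹ * wt β e z ≤ (e ^ 2)⁻¹ * wt β e z := mul_le_mul_of_nonneg_right a1 hw
      have a4 : β ^ 2 ≤ 1 := by nlinarith
      have a0 : 0 ≤ (e ^ 2)⁻¹ * wt β e z := by positivity
      have b0 : 0 ≤ (‖z‖ ^ 2 + e) ^ (-β) * ‖z‖ ^ 2 := by positivity
      have b1 : β ^ 2 * (((‖z‖ ^ 2 + e) ^ 2)⁻¹ * wt β e z) ≤ (e ^ 2)⁻¹ * wt β e z := by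
        refine (mul_le_of_le_one_left (by positivity) a4).trans a3
      have b2 : β ^ 2 * (((‖z‖ ^ 2 + e) ^ 2)⁻¹ * wt β e z) * ((‖z‖ ^ 2 + e) ^ (-β) * ‖z‖ ^ 2) ≤ (e ^ 2)⁻¹ * wt β e z :=
        (mul_le_of_le_one_right (by positivity) h).trans b1
      have b3 := (mul_le_of_le_one_right (by positivity :
        0 ≤ β ^ 2 * (((‖z‖ ^ 2 + e) ^ 2)⁻¹ * wt β e z) * ((‖z‖ ^ 2 + e) ^ (-β) * ‖z‖ ^ 2)) a2).trans b2
      linarith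
    · have : wp1 β e (‖z‖ ^ 2) = 0 := by
        unfold wp1; rw [posq_of_nonpos (by linarith)]; ring
      rw [this]
      have : 0 ≤ (e ^ 2)⁻¹ * wt β e z := by positivity
      linarith
  nlinarith [sq_nonneg ((wp1 β e (‖z‖ ^ 2) - wp2 β e (‖z‖ ^ 2)) * ‖z‖)]

end PLap

namespace PLap

def zt (x : ℝ) : ℝ := Real.smoothTransition ((4 * x - 1) / 3)
lemma zt_contDiff : ContDiff ℝ 2 zt := by
  unfold zt
  exact (Real.smoothTransition.contDiff (n := 2)).comp (by fun_prop)
lemma zt_nonneg (x : ℝ) : 0 ≤ zt x := Real.smoothTransition.nonneg _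
lemma zt_le_one (x : ℝ) : zt x ≤ 1 := Real.smoothTransition.le_one _
lemma zt_zero {x : ℝ} (h : x ≤ 1/4) : zt x = 0 :=
  Real.smoothTransition.zero_of_nonpos (by linarith)
lemma zt_one {x : ℝ} (h : 1 ≤ x) : zt x = 1 :=
  Real.smoothTransition.one_of_one_le (by linarith)
lemma zt_pos {x : ℝ} (h : 1/4 < x) : 0 < zt x :=
  Real.smoothTransition.pos_of_pos (by linarith)
lemma zt_mono : Monotone zt := by
  intro x y h
  unfold zt
  exact Real.smoothTransition.monotone (by linarith)

lemma zt_deriv_nonneg (x : ℝ) : 0 ≤ deriv zt x := zt_mono.deriv_nonneg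

lemma zt_deriv_cont : Continuous (deriv zt) :=
  zt_contDiff.continuous_deriv (by norm_num)

lemma zt_deriv_zero {x : ℝ} (h : x ≤ 1/4) : deriv zt x = 0 := by
  have h1 : Set.EqOn (deriv zt) (fun _ => 0) (Set.Iio (1/4)) := by
    intro y hy
    have : zt =ᶠ[nhds y] fun _ => 0 := by
      filter_upwards [Iio_mem_nhds hy] with w hw using zt_zero (le_of_lt hw)
    rw [this.deriv_eq]; simp
  have := h1.closure zt_deriv_cont continuous_const
  rw [closure_Iio] at this
  exact this h

lemma zt_deriv_zero' {x : ℝ} (h : 1 ≤ x) : deriv zt x = 0 := by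
  have h1 : Set.EqOn (deriv zt) (fun _ => 0) (Set.Ioi 1) := by
    intro y hy
    have : zt =ᶠ[nhds y] fun _ => 1 := by
      filter_upwards [Ioi_mem_nhds hy] with w hw using zt_one (le_of_lt hw)
    rw [this.deriv_eq]; simp
  have := h1.closure zt_deriv_cont continuous_const
  rw [closure_Ioi] at this
  exact this h

lemma zt_deriv_bdd : ∃ N, 0 ≤ N ∧ ∀ x, deriv zt x ≤ N := by
  obtain ⟨C, hC⟩ := (isCompact_Icc (a := (0:ℝ)) (b := 1)).exists_bound_of_continuousOn zt_deriv_cont.continuousOn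
  refine ⟨max C 0, le_max_right _ _, fun x => ?_⟩
  by_cases h : x ∈ Set.Icc (0:ℝ) 1
  · exact (le_abs_self _).trans ((hC x h).trans (le_max_left _ _))
  · rcases lt_or_ge x 0 with h0 | h0
    · rw [zt_deriv_zero (by linarith)]; exact le_max_right _ _
    · rw [zt_deriv_zero' (by by_contra h2; exact h ⟨h0, (not_le.1 h2).le⟩)]; exact le_max_right _ _

/-- high weight -/
def wf (b t q : ℝ) : ℝ := q ^ ((b - 1) / 2) * zt (q / t ^ 2)
/-- low weight -/
def mlow (b t q : ℝ) : ℝ := t ^ (2 * b) * (posq (q - t ^ 2 / 16) / q ^ 3)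
def llow (b t q : ℝ) : ℝ := t ^ (2 * b) * (2 * max (q - t ^ 2 / 16) 0 * (t ^ 2 / 16) / q ^ 3)

lemma contDiff_of_pos {n : WithTop ℕ∞} {f : ℝ → ℝ} {a : ℝ} (ha : 0 < a) (h0 : ∀ q < a, f q = 0)
    (h1 : ∀ q, 0 < q → ContDiffAt ℝ n f q) : ContDiff ℝ n f := by
  rw [contDiff_iff_contDiffAt]
  intro q
  rcases lt_or_ge q a with h | h
  · refine (contDiffAt_const (c := (0:ℝ))).congr_of_eventuallyEq ?_
    filter_upwards [Iio_mem_nhds h] with y hy using h0 y hy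
  · exact h1 q (ha.trans_le h)

lemma wf_zero {b t q : ℝ} (ht : 0 < t) (h : q ≤ t ^ 2 / 4) : wf b t q = 0 := by
  unfold wf; rw [zt_zero, mul_zero]
  rw [div_le_iff₀ (by positivity)]; linarith

lemma wf_contDiff {b t : ℝ} (ht : 0 < t) : ContDiff ℝ 2 (wf b t) := by
  refine contDiff_of_pos (a := t ^ 2 / 4) (by positivity) (fun q hq => wf_zero ht hq.le) fun q hq => ?_
  refine ContDiffAt.mul (contDiffAt_id.rpow_const_of_ne hq.ne') ?_
  exact (zt_contDiff.comp (by fun_prop : ContDiff ℝ 2 fun q : ℝ => q / t ^ 2)).contDiffAt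

lemma mlow_zero {b t q : ℝ} (h : q ≤ t ^ 2 / 16) : mlow b t q = 0 := by
  unfold mlow; rw [posq_of_nonpos (by linarith)]; simp

lemma mlow_contDiff {b t : ℝ} (ht : 0 < t) : ContDiff ℝ 1 (mlow b t) := by
  refine contDiff_of_pos (a := t ^ 2 / 16) (by positivity) (fun q hq => mlow_zero hq.le) fun q hq => ?_
  refine ContDiffAt.mul contDiffAt_const (ContDiffAt.div ?_ (by fun_prop) (by positivity))
  exact (posq_contDiff.comp (by fun_prop : ContDiff ℝ 1 fun q : ℝ => q - t ^ 2 / 16)).contDiffAt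

lemma mlow_l {b t q : ℝ} (ht : 0 < t) (hq : 0 ≤ q) : mlow b t q + q * deriv (mlow b t) q = llow b t q := by
  rcases hq.eq_or_lt with h | h
  · rw [← h, mlow_zero (by positivity), llow, max_eq_right (by simp; positivity)]; simp
  · have h1 : HasDerivAt (fun q => posq (q - t ^ 2 / 16)) (2 * max (q - t ^ 2 / 16) 0) q := by
      have := (posq_hasDerivAt (q - t ^ 2 / 16)).comp q ((hasDerivAt_id q).sub_const (t ^ 2 / 16))
      rw [mul_one] at this
      exact this
    have h2 := ((h1.div (hasDerivAt_pow 3 q) (by positivity)).const_mul (t ^ (2 * b)))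
    have h3 : deriv (mlow b t) q = _ := h2.deriv
    rw [h3, mlow, llow]
    unfold posq
    rcases le_total (q - t ^ 2 / 16) 0 with h0 | h0
    · rw [max_eq_right h0]; simp
    · rw [max_eq_left h0]; field_simp; ring

lemma llow_nonneg {b t q : ℝ} (ht : 0 < t) (hq : 0 ≤ q) : 0 ≤ llow b t q := by
  unfold llow
  have := le_max_right (q - t ^ 2 / 16) 0
  positivity

lemma llow_zero {b t q : ℝ} (h : q ≤ t ^ 2 / 16) : llow b t q = 0 := by
  unfold llow; rw [max_eq_right (by linarith)]; simp

lemma wf_nonneg {b t q : ℝ} (hq : 0 ≤ q) : 0 ≤ wf b t q :=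
  mul_nonneg (rpow_nonneg hq _) (zt_nonneg _)

lemma wf_pos {b t q : ℝ} (ht : 0 < t) (hq : t ^ 2 / 4 < q) : 0 < wf b t q := by
  have : 0 < q := lt_trans (by positivity) hq
  refine mul_pos (rpow_pos_of_pos this _) (zt_pos ?_)
  rw [lt_div_iff₀ (by positivity)]; linarith

lemma wf_deriv {b t q : ℝ} (ht : 0 < t) (hq : 0 < q) : wf b t q + 2 * q * deriv (wf b t) q =
    q ^ ((b - 1) / 2) * (b * zt (q / t ^ 2) + 2 * (q / t ^ 2) * deriv zt (q / t ^ 2)) := by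
  have h1 : HasDerivAt (fun q : ℝ => q ^ ((b - 1) / 2)) ((b - 1) / 2 * q ^ ((b - 1) / 2 - 1)) q := by
    exact Real.hasDerivAt_rpow_const (Or.inl hq.ne')
  have h2 : HasDerivAt (fun q : ℝ => zt (q / t ^ 2)) (deriv zt (q / t ^ 2) * (1 / t ^ 2)) q := by
    have := ((zt_contDiff.differentiable (by norm_num)) (q / t ^ 2)).hasDerivAt.comp q
      ((hasDerivAt_id q).div_const (t ^ 2))
    exact this
  have h3 : deriv (wf b t) q = _ := (h1.mul h2).deriv
  rw [h3, wf, rpow_sub_one hq.ne']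
  field_simp
  ring

lemma wf_deriv_zero {b t q : ℝ} (ht : 0 < t) (h : q ≤ t ^ 2 / 4) : deriv (wf b t) q = 0 := by
  have h1 : Set.EqOn (deriv (wf b t)) (fun _ => 0) (Set.Iio (t ^ 2 / 4)) := by
    intro y hy
    have : wf b t =ᶠ[nhds y] fun _ => 0 := by
      filter_upwards [Iio_mem_nhds hy] with w hw using wf_zero ht (le_of_lt hw)
    rw [this.deriv_eq]; simp
  have := h1.closure ((wf_contDiff ht).continuous_deriv (by norm_num)) continuous_const
  rw [closure_Iio] at this
  exact this h

/-- alpha prime -/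
def wa (b t q : ℝ) : ℝ := wf b t q + 2 * q * deriv (wf b t) q

lemma wa_zero {b t q : ℝ} (ht : 0 < t) (h : q ≤ t ^ 2 / 4) : wa b t q = 0 := by
  rw [wa, wf_zero ht h, wf_deriv_zero ht h]; ring

lemma wa_high {b t q : ℝ} (ht : 0 < t) (h : t ^ 2 ≤ q) : wa b t q = b * wf b t q := by
  have hq : 0 < q := lt_of_lt_of_le (by positivity) h
  have h1 : 1 ≤ q / t ^ 2 := by rwa [one_le_div (by positivity)]
  rw [wa, wf_deriv ht hq, wf, zt_deriv_zero' h1]; ring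

lemma wa_nonneg {b t q : ℝ} (hb : 0 ≤ b) (ht : 0 < t) (hq : 0 < q) : 0 ≤ wa b t q := by
  rw [wa, wf_deriv ht hq]
  have := zt_nonneg (q / t ^ 2)
  have := zt_deriv_nonneg (q / t ^ 2)
  positivity

lemma wf_le {b t q L : ℝ} (hb : 1 ≤ b) (hq : 0 ≤ q) (hqL : q ≤ L) : wf b t q ≤ L ^ ((b - 1) / 2) := by
  unfold wf
  calc _ ≤ q ^ ((b - 1) / 2) := mul_le_of_le_one_right (rpow_nonneg hq _) (zt_le_one _)
    _ ≤ _ := rpow_le_rpow hq hqL (by linarith)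

lemma sq_rpow_half {t c : ℝ} (ht : 0 < t) : (t ^ 2) ^ (c / 2) = t ^ c := by
  rw [← rpow_natCast, ← rpow_mul ht.le]; congr 1; push_cast; ring

lemma llow_lower {b t q : ℝ} (ht : 0 < t) (h : t ^ 2 / 4 ≤ q) (h2 : q ≤ t ^ 2) :
    (t ^ (b - 1)) ^ 2 ≤ 64 * llow b t q := by
  have hq : 0 < q := lt_of_lt_of_le (by positivity) h
  have e : (t ^ (b - 1)) ^ 2 = t ^ (2 * b) / t ^ 2 := by
    rw [rpow_sub_one ht.ne', div_pow, ← rpow_natCast, ← rpow_mul ht.le]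
    congr 2; push_cast; ring
  rw [e, llow, max_eq_left (by nlinarith)]
  have hT : 0 < t ^ (2 * b) := rpow_pos_of_pos ht _
  rw [show 64 * (t ^ (2 * b) * (2 * (q - t ^ 2 / 16) * (t ^ 2 / 16) / q ^ 3)) =
    t ^ (2 * b) * (8 * (q - t ^ 2 / 16) * t ^ 2 / q ^ 3) by ring, div_eq_mul_inv]
  apply mul_le_mul_of_nonneg_left _ hT.le
  rw [inv_le_iff_one_le_mul₀ (by positivity), mul_comm, ← mul_div_assoc, one_le_div (by positivity)]
  have h3 : q ^ 2 ≤ t ^ 2 * t ^ 2 := by nlinarith [sq_nonneg t]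
  have h4 : q ^ 3 ≤ t ^ 2 * t ^ 2 * q := by nlinarith
  nlinarith [sq_nonneg t, mul_pos (pow_pos ht 2) (pow_pos ht 2)]

lemma wf_mid {b t q : ℝ} (hb : 1 ≤ b) (ht : 0 < t) (hq : 0 ≤ q) (h2 : q ≤ t ^ 2) :
    wf b t q ≤ t ^ (b - 1) := by
  have := wf_le (t := t) hb hq h2
  rwa [sq_rpow_half ht] at this

lemma wa_mid {b t q N : ℝ} (hN : ∀ x, deriv zt x ≤ N) (hb : 1 ≤ b) (ht : 0 < t) (hq : 0 < q) (h2 : q ≤ t ^ 2) :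
    wa b t q ≤ t ^ (b - 1) * (b + 2 * N) := by
  rw [wa, wf_deriv ht hq]
  have h1 : q / t ^ 2 ≤ 1 := by rwa [div_le_one (by positivity)]
  have h3 : q ^ ((b - 1) / 2) ≤ t ^ (b - 1) := by
    rw [← sq_rpow_half ht]; exact rpow_le_rpow hq.le h2 (by linarith)
  have h4 := zt_le_one (q / t ^ 2)
  have h5 := zt_nonneg (q / t ^ 2)
  have h6 := hN (q / t ^ 2)
  have h7 := zt_deriv_nonneg (q / t ^ 2)
  have h0 : 0 ≤ q / t ^ 2 := by positivity
  have h8 : q / t ^ 2 * deriv zt (q / t ^ 2) ≤ N := (mul_le_of_le_one_left h7 h1).trans h6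
  apply mul_le_mul h3 _ (by positivity) (by positivity)
  nlinarith

lemma mlow_sq {b t q L : ℝ} (ht : 0 < t) (hq : 0 < q) (hL : q ≤ L ^ 2) :
    mlow b t q ^ 2 * q ≤ 8 * L ^ 2 * (t ^ (b - 1)) ^ 2 * llow b t q := by
  have e : (t ^ (b - 1)) ^ 2 = t ^ (2 * b) / t ^ 2 := by
    rw [rpow_sub_one ht.ne', div_pow, ← rpow_natCast, ← rpow_mul ht.le]
    congr 2; push_cast; ring
  have hT : 0 < t ^ (2 * b) := rpow_pos_of_pos ht _
  rcases le_total (q - t ^ 2 / 16) 0 with h0 | h0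
  · rw [mlow_zero (by linarith), llow_zero (by linarith)]; simp
  rw [e, mlow, llow, posq_of_nonneg h0, max_eq_left h0]
  set y := q - t ^ 2 / 16 with hy
  have hyq : y ≤ q := by rw [hy]; nlinarith [sq_nonneg t]
  have e2 : (t ^ (2 * b) * (y ^ 2 / q ^ 3)) ^ 2 * q = (t ^ (2 * b)) ^ 2 * y / q ^ 5 * y ^ 3 := by
    field_simp
  have e3 : 8 * L ^ 2 * (t ^ (2 * b) / t ^ 2) * (t ^ (2 * b) * (2 * y * (t ^ 2 / 16) / q ^ 3)) =
     (t ^ (2 * b)) ^ 2 * y / q ^ 5 * (L ^ 2 * q ^ 2) := by field_simp; ring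
  rw [e2, e3]
  apply mul_le_mul_of_nonneg_left _ (by positivity)
  calc y ^ 3 ≤ q ^ 3 := pow_le_pow_left₀ h0 hyq 3
    _ = q * q ^ 2 := by ring
    _ ≤ _ := by gcongr

lemma llow_gam {b t q p : ℝ} (hp : 1 ≤ p) (ht : 0 < t) (h : t ^ 2 / 16 < q) :
    llow b t q * q ^ (2 - p) ≤ 2 * 16 ^ (p - 1) * t ^ (2 * (b - (p - 1))) := by
  have hq : 0 < q := lt_trans (by positivity) h
  have hT : 0 < t ^ (2 * b) := rpow_pos_of_pos ht _
  have ha : 0 < t ^ 2 / 16 := by positivity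
  have h1 : llow b t q ≤ t ^ (2 * b) * (2 * (t ^ 2 / 16) / q ^ 2) := by
    unfold llow
    rw [max_eq_left (by linarith)]
    apply mul_le_mul_of_nonneg_left _ hT.le
    rw [div_le_div_iff₀ (by positivity) (by positivity)]
    nlinarith [mul_pos ha ha, pow_pos hq 2, mul_pos (mul_pos ha ha) (pow_pos hq 2)]
  have h2 : q ^ (2 - p) / q ^ 2 ≤ (t ^ 2 / 16) ^ (- p) := by
    rw [← rpow_natCast q 2, ← rpow_sub hq]
    rw [show 2 - p - (2:ℕ) = -p by push_cast; ring]
    exact rpow_le_rpow_of_nonpos ha h.le (by linarith)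
  calc _ ≤ t ^ (2 * b) * (2 * (t ^ 2 / 16) / q ^ 2) * q ^ (2 - p) := by gcongr
    _ = 2 * t ^ (2 * b) * ((t ^ 2 / 16) * (q ^ (2 - p) / q ^ 2)) := by ring
    _ ≤ 2 * t ^ (2 * b) * ((t ^ 2 / 16) * (t ^ 2 / 16) ^ (- p)) := by gcongr
    _ = 2 * 16 ^ (p - 1) * t ^ (2 * (b - (p - 1))) := by
        have : (t ^ 2 / 16) * (t ^ 2 / 16) ^ (- p) = (t ^ 2 / 16) ^ (1 - p) := by
          rw [sub_eq_add_neg, rpow_add ha, rpow_one]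
        rw [this, div_rpow (by positivity) (by norm_num), ← rpow_natCast t 2, ← rpow_mul ht.le,
          show 2 * (b - (p - 1)) = 2 * b + (2:ℕ) * (1 - p) by push_cast; ring, rpow_add ht,
          show (1 - p) = -(p - 1) by ring, rpow_neg (by norm_num : (0:ℝ) ≤ 16)]
        field_simp

lemma wf_gam {b t q p : ℝ} (hp : b ≤ p - 1) (ht : 0 < t) (h : t ^ 2 / 4 ≤ q) :
    wf b t q ^ 2 * q ^ (2 - p) ≤ 4 ^ (p - 1 - b) * t ^ (2 * (b - (p - 1))) := by
  have hq : 0 < q := lt_of_lt_of_le (by positivity) h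
  have h1 : wf b t q ^ 2 ≤ q ^ (b - 1) := by
    have : wf b t q ≤ q ^ ((b - 1) / 2) := mul_le_of_le_one_right (rpow_nonneg hq.le _) (zt_le_one _)
    calc _ ≤ (q ^ ((b - 1) / 2)) ^ 2 := pow_le_pow_left₀ (wf_nonneg hq.le) this 2
      _ = _ := by rw [← rpow_natCast, ← rpow_mul hq.le]; congr 1; push_cast; ring
  calc _ ≤ q ^ (b - 1) * q ^ (2 - p) := by gcongr
    _ = q ^ (b - (p - 1)) := by rw [← rpow_add hq]; congr 1; ring
    _ ≤ (t ^ 2 / 4) ^ (b - (p - 1)) := rpow_le_rpow_of_nonpos (by positivity) h (by linarith)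
    _ = _ := by
      rw [div_rpow (by positivity) (by norm_num), ← rpow_natCast t 2, ← rpow_mul ht.le,
        show p - 1 - b = -(b - (p - 1)) by ring, rpow_neg (by norm_num : (0:ℝ) ≤ 4)]
      push_cast
      rw [div_eq_mul_inv, mul_comm]

end PLap

namespace PLap

/-- linearised p-Laplacian -/
def gt (p : ℝ) (Z : ℂ) (H : ℂ →L[ℝ] ℂ) : ℝ :=
  ‖Z‖ ^ (p - 2) * ((H 1).re + (H Complex.I).im + (p - 2) * (dot Z (H Z) / ‖Z‖ ^ 2))

lemma H_apply (H : ℂ →L[ℝ] ℂ) (v : ℂ) : H v = v.re • H 1 + v.im • H Complex.I := by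
  conv_lhs => rw [← Complex.re_add_im v]
  rw [map_add]
  congr 1
  · rw [← H.map_smul]; congr 1; simp
  · rw [← H.map_smul]; congr 1

/-- derivative of `w(|Z|²) Z`. -/
def DFv (α w' : ℝ) (Z : ℂ) (H : ℂ →L[ℝ] ℂ) (v : ℂ) : ℂ := α • H v + (2 * w' * dot Z (H v)) • Z

set_option maxHeartbeats 2000000 in
lemma frame (p : ℝ) (Z z : ℂ) (H : ℂ →L[ℝ] ℂ) (hs : (H 1).im = (H Complex.I).re) (hZ : 0 < ‖Z‖) :
    ∃ s τ γ c σ : ℝ, c ^ 2 + σ ^ 2 = ‖z‖ ^ 2 ∧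
      gt p Z H = ‖Z‖ ^ (p - 2) * γ ∧
      -cross (H 1) (H Complex.I) = τ ^ 2 - s * (γ - (p - 1) * s) ∧
      cross Z (H (Complex.I * z)) = ‖Z‖ * (τ * c + (γ - (p - 1) * s) * σ) ∧
      (∀ α w', ‖DFv α w' Z H 1‖ ^ 2 + ‖DFv α w' Z H Complex.I‖ ^ 2 =
        (α + 2 * ‖Z‖ ^ 2 * w') ^ 2 * (s ^ 2 + τ ^ 2) + α ^ 2 * (τ ^ 2 + (γ - (p - 1) * s) ^ 2)) ∧
      (∀ α w', ‖DFv α w' Z H (Complex.I * z)‖ ^ 2 =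
        (α + 2 * ‖Z‖ ^ 2 * w') ^ 2 * (s * c + τ * σ) ^ 2 + α ^ 2 * (τ * c + (γ - (p - 1) * s) * σ) ^ 2) ∧
      (∀ α w', cross (α • Z) (DFv α w' Z H (Complex.I * z)) = α ^ 2 * cross Z (H (Complex.I * z))) ∧
      (dot Z (Complex.I * z)) ^ 2 = ‖Z‖ ^ 2 * c ^ 2 := by
  set ρ := ‖Z‖ with hρ
  obtain ⟨n1, hn1⟩ : ∃ n1, Z.re = ρ * n1 := ⟨Z.re / ρ, by field_simp⟩
  obtain ⟨n2, hn2⟩ : ∃ n2, Z.im = ρ * n2 := ⟨Z.im / ρ, by field_simp⟩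
  have hn : n1 ^ 2 + n2 ^ 2 = 1 := by
    have := norm_sq_eq Z
    rw [← hρ, hn1, hn2] at this
    have h3 : ρ ^ 2 * (n1 ^ 2 + n2 ^ 2 - 1) = 0 := by linarith
    rcases mul_eq_zero.1 h3 with h | h
    · exact absurd h (by positivity)
    · linarith
  set a := (H 1).re with ha
  set b := (H Complex.I).re with hb
  set d := (H Complex.I).im with hd
  set x := z.re with hx
  set y := z.im with hy
  have hvre : ∀ v, (H v).re = v.re * a + v.im * b := by
    intro v; rw [H_apply H v]; simp [ha, hb]
  have hvim : ∀ v, (H v).im = v.re * b + v.im * d := by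
    intro v; rw [H_apply H v]; simp [hd, hs]
  have hIre : (Complex.I * z).re = -y := by simp [hy]
  have hIim : (Complex.I * z).im = x := by simp [hx]
  have h2 : n2 ^ 2 = 1 - n1 ^ 2 := by linarith
  have e3 : n2 ^ 3 = n2 * (1 - n1 ^ 2) := by rw [← h2]; ring
  have e4 : n2 ^ 4 = (1 - n1 ^ 2) ^ 2 := by rw [← h2]; ring
  have e5 : n2 ^ 5 = n2 * (1 - n1 ^ 2) ^ 2 := by rw [← h2]; ring
  have e6 : n2 ^ 6 = (1 - n1 ^ 2) ^ 3 := by rw [← h2]; ring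
  have key : ∀ α w' v, ‖DFv α w' Z H v‖ ^ 2 =
      (α + 2 * ρ ^ 2 * w') ^ 2 * (n1 * (H v).re + n2 * (H v).im) ^ 2 + α ^ 2 * (-n2 * (H v).re + n1 * (H v).im) ^ 2 := by
    intro α w' v
    rw [norm_sq_eq]
    simp only [DFv, dot, Complex.add_re, Complex.add_im, Complex.smul_re, Complex.smul_im, smul_eq_mul, hn1, hn2]
    generalize (H v).re = X
    generalize (H v).im = Y
    have : X ^ 2 = X ^ 2 * (n1 ^ 2 + n2 ^ 2) := by rw [hn, mul_one]
    have : α ^ 2 * (X ^ 2 + Y ^ 2) = α ^ 2 * (X ^ 2 + Y ^ 2) * (n1 ^ 2 + n2 ^ 2) := by rw [hn, mul_one]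
    have h8 : (2 * w' * (ρ * n1 * X + ρ * n2 * Y) * ρ) ^ 2 * (n1 ^ 2 + n2 ^ 2) =
       (2 * w' * (ρ * n1 * X + ρ * n2 * Y) * ρ) ^ 2 := by rw [hn, mul_one]
    linear_combination this + h8
  refine ⟨a * n1 ^ 2 + 2 * b * n1 * n2 + d * n2 ^ 2, -n2 * (a * n1 + b * n2) + n1 * (b * n1 + d * n2),
    (p - 1) * (a * n1 ^ 2 + 2 * b * n1 * n2 + d * n2 ^ 2) + (a * n2 ^ 2 - 2 * b * n1 * n2 + d * n1 ^ 2),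
    -n1 * y + n2 * x, n2 * y + n1 * x, ?_, ?_, ?_, ?_, ?_, ?_, ?_, ?_⟩
  · rw [norm_sq_eq]; linear_combination (x ^ 2 + y ^ 2) * hn
  · unfold gt
    rw [← hρ]
    congr 1
    rw [dot, hvre Z, hvim Z, hn1, hn2, ← ha, ← hd]
    have e : (ρ * n1 * (ρ * n1 * a + ρ * n2 * b) + ρ * n2 * (ρ * n1 * b + ρ * n2 * d)) / ρ ^ 2 = n1 * (n1 * a + n2 * b) + n2 * (n1 * b + n2 * d) := by field_simp
    rw [e]
    linear_combination (-(a + d)) * hn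
  · simp only [cross]
    rw [hs]
    linear_combination (-(b ^ 2 - a * d)) * ((n1 ^ 2 + n2 ^ 2) + 1) * hn
  · simp only [cross]
    rw [hvre, hvim, hIre, hIim, hn1, hn2]
    linear_combination (-(ρ * (n1 * (-y * b + x * d) - n2 * (-y * a + x * b)))) * hn
  · intro α w'
    rw [key, key]
    have t1 : (H 1).im = b := hs
    rw [t1, ← ha, ← hb, ← hd]
    linear_combination (-((α + 2 * ρ ^ 2 * w') ^ 2 * ((n1 * a + n2 * b) ^ 2 + (n1 * b + n2 * d) ^ 2) +
      α ^ 2 * ((-n2 * a + n1 * b) ^ 2 + (-n2 * b + n1 * d) ^ 2))) * hn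
  · intro α w'
    rw [key, hvre, hvim, hIre, hIim]
    have A1 : (a * n1 ^ 2 + 2 * b * n1 * n2 + d * n2 ^ 2) * (-n1 * y + n2 * x) +
        (-n2 * (a * n1 + b * n2) + n1 * (b * n1 + d * n2)) * (n2 * y + n1 * x) =
        n1 * (-y * a + x * b) + n2 * (-y * b + x * d) := by
      linear_combination (n1 * (-y * a + x * b) + n2 * (-y * b + x * d)) * hn
    have A2 : (-n2 * (a * n1 + b * n2) + n1 * (b * n1 + d * n2)) * (-n1 * y + n2 * x) +
        ((p - 1) * (a * n1 ^ 2 + 2 * b * n1 * n2 + d * n2 ^ 2) + (a * n2 ^ 2 - 2 * b * n1 * n2 + d * n1 ^ 2) -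
          (p - 1) * (a * n1 ^ 2 + 2 * b * n1 * n2 + d * n2 ^ 2)) * (n2 * y + n1 * x) =
        -n2 * (-y * a + x * b) + n1 * (-y * b + x * d) := by
      linear_combination (-n2 * (-y * a + x * b) + n1 * (-y * b + x * d)) * hn
    rw [A1, A2]
  · intro α w'
    simp only [cross, DFv, Complex.add_re, Complex.add_im, Complex.smul_re, Complex.smul_im, smul_eq_mul]
    ring
  · rw [dot, hIre, hIim, hn1, hn2]; ring

lemma cosSq_smul (α : ℝ) (hα : α ≠ 0) (Z T : ℂ) : cosSq (α • Z) T = cosSq Z T := by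
  unfold cosSq
  have : dot (α • Z) T = α * dot Z T := by simp [dot]; ring
  rw [this, norm_smul, mul_pow, mul_pow, Real.norm_eq_abs, sq_abs]
  exact mul_div_mul_left _ _ (by positivity)

lemma cosSq_unit (F z : ℂ) : cosSq F (Complex.I * (z / ‖z‖)) ≤ 1 := by
  by_cases hz : z = 0
  · simp [hz, cosSq, dot]
  · apply cosSq_le_one
    simp [hz]

lemma cosSq_c (Z z : ℂ) (c : ℝ) (hZ : 0 < ‖Z‖) (h : (dot Z (Complex.I * z)) ^ 2 = ‖Z‖ ^ 2 * c ^ 2)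
   (hz : z ≠ 0) : cosSq Z (Complex.I * (z / ‖z‖)) * ‖z‖ ^ 2 = c ^ 2 := by
  have hz' : 0 < ‖z‖ := norm_pos_iff.2 hz
  have : dot Z (Complex.I * (z / ‖z‖)) = dot Z (Complex.I * z) / ‖z‖ := by
    have : (Complex.I * (z / ‖z‖)) = (‖z‖⁻¹ : ℝ) • (Complex.I * z) := by
      rw [Complex.real_smul]; push_cast; ring
    rw [this]; simp only [dot, Complex.smul_re, Complex.smul_im, smul_eq_mul]; ring
  unfold cosSq
  rw [this, div_pow, h]
  field_simp

end PLap

namespace PLap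

/-- left side of the pointwise inequality -/
def LHS (b t β e m κ c0 : ℝ) (Z z : ℂ) (H : ℂ →L[ℝ] ℂ) : ℝ :=
  c0 * (wt β e z * (‖DFv (wf b t (‖Z‖ ^ 2)) (deriv (wf b t) (‖Z‖ ^ 2)) Z H 1‖ ^ 2 +
      ‖DFv (wf b t (‖Z‖ ^ 2)) (deriv (wf b t) (‖Z‖ ^ 2)) Z H Complex.I‖ ^ 2)) +
    wp1 β e (‖z‖ ^ 2) * (κ * (‖DFv (wf b t (‖Z‖ ^ 2)) (deriv (wf b t) (‖Z‖ ^ 2)) Z H (Complex.I * z)‖ ^ 2 *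
      (1 + m * cosSq (wf b t (‖Z‖ ^ 2) • Z) (Complex.I * (z / ‖z‖)))) +
      cross (wf b t (‖Z‖ ^ 2) • Z) (DFv (wf b t (‖Z‖ ^ 2)) (deriv (wf b t) (‖Z‖ ^ 2)) Z H (Complex.I * z)))

/-- integrand of the identity with weight `M`, `l` -/
def Idn (β e M l : ℝ) (Z z : ℂ) (H : ℂ →L[ℝ] ℂ) : ℝ :=
  2 * wt β e z * l * (-cross (H 1) (H Complex.I)) +
    (wp1 β e (‖z‖ ^ 2) + wp2 β e (‖z‖ ^ 2)) * M * cross Z (H (Complex.I * z))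

lemma fin_aux {X Y U V W Λ C1 E1 C Kk E p1 p2 : ℝ} (h : X + Y ≤ U + p2 * V + Λ * W + C1 * E1)
    (hE : E1 ≤ Kk * E) (h1 : 0 ≤ C1) (hC : C1 ≤ C) (hKE : 0 ≤ Kk * E) :
    X + Y + p1 * V ≤ U + (p1 + p2) * V + Λ * W + C * Kk * E := by
  have z1 := mul_le_mul_of_nonneg_left hE h1
  have z2 := mul_le_mul_of_nonneg_right hC hKE
  nlinarith

lemma ee_aux {A Kg u v Y : ℝ} (hA : 0 ≤ A) (hK : 0 ≤ Kg) (hu : 0 ≤ u) (hv : 0 ≤ v) (hY : Y ≤ Kg * v) :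
    1 + A * u + Y ≤ (1 + A + Kg) * (1 + u + v) := by
  have e1 := mul_nonneg hA hu
  have e2 := mul_nonneg hA hv
  have e3 := mul_nonneg hK hu
  nlinarith

lemma sq_aux3 {c s : ℝ} (h : c ^ 2 + s ^ 2 = 0 ^ 2) : c ^ 2 = 0 := by nlinarith [sq_nonneg c, sq_nonneg s]
lemma sq_aux4 {r t : ℝ} (ht : 0 < t) (h : t / 4 < r) : t ^ 2 / 16 < r ^ 2 := by nlinarith
lemma sq_aux5 {r t : ℝ} (h0 : 0 ≤ r) (h : r ≤ t / 4) : r ^ 2 ≤ t ^ 2 / 16 := by nlinarith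
lemma sq_aux1 {r t : ℝ} (ht : 0 < t) (h : t < r) : t ^ 2 ≤ r ^ 2 := by nlinarith
lemma sq_aux2 {q t : ℝ} (ht : 0 < t) (h : t ^ 2 ≤ q) : t ^ 2 / 4 < q := by nlinarith [pow_pos ht 2]

set_option maxHeartbeats 4000000 in
lemma pw_all {p b K κ m β L : ℝ} (hp : 2 < p) (hb : 1 ≤ b) (hbp : b ≤ p - 1) (hK : 0 < K) (hκ : 0 ≤ κ)
    (hm : 0 ≤ m) (hβ : 0 ≤ β) (hβ1 : β ≤ 1) (hS : Struct (p - 1) b K m) (hlt : β * κ * K < 1) (hL : 0 < L) :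
    ∃ c0, 0 < c0 ∧ ∃ Λ, 0 ≤ Λ ∧ ∃ C, 0 ≤ C ∧ ∀ (t e G : ℝ) (Z z : ℂ) (H : ℂ →L[ℝ] ℂ), 0 < t → 0 < e → e ≤ 1 →
      0 ≤ G → ‖Z‖ ≤ L → (H 1).im = (H Complex.I).re → (t / 4 < ‖Z‖ → ‖z‖ < 1 → gt p Z H ^ 2 ≤ G) →
      LHS b t β e m κ c0 Z z H ≤
        Idn β e (wf b t (‖Z‖ ^ 2) ^ 2) (wf b t (‖Z‖ ^ 2) * wa b t (‖Z‖ ^ 2)) Z z H +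
        Λ * Idn β e (mlow b t (‖Z‖ ^ 2)) (llow b t (‖Z‖ ^ 2)) Z z H +
        C * (1 + (t ^ (b - 1)) ^ 2 * (e ^ 2)⁻¹ + wt β e z * G * t ^ (2 * (b - (p - 1)))) := by
  obtain ⟨c0, hc0, hhigh⟩ := pw_high (k1 := p - 1) (by linarith) (by linarith : 0 < b) hK hκ hm hβ hS hlt
  obtain ⟨N, hN0, hN⟩ := zt_deriv_bdd
  set M := 64 * (b + 2 * N) ^ 2 + (L * (L ^ 2) ^ ((b - 1) / 2)) ^ 2 with hM
  have hbN : 1 ≤ b + 2 * N := by linarith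
  have hM64 : 64 ≤ M := by
    have : 1 ≤ (b + 2 * N) ^ 2 := by nlinarith
    nlinarith [sq_nonneg (L * (L ^ 2) ^ ((b - 1) / 2))]
  have hM64' : 64 * (b + 2 * N) ^ 2 ≤ M := by
    nlinarith [sq_nonneg (L * (L ^ 2) ^ ((b - 1) / 2))]
  have hML : (L * (L ^ 2) ^ ((b - 1) / 2)) ^ 2 ≤ M := by
    nlinarith [sq_nonneg (b + 2 * N)]
  have hM0 : 0 ≤ M := by linarith
  obtain ⟨Λ, hΛ, C1, hC1, hmid⟩ := pw_mid (k1 := p - 1) (κ := κ) (m := m) (β := β) (M := M) (c0 := c0)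
    (by linarith) hκ hm hβ hM0 hc0.le
  obtain ⟨C2, hC2, hhi⟩ := hhigh M Λ hM0 hΛ
  set Kg := 2 * (16:ℝ) ^ (p - 1) + 4 ^ (p - 1 - b) with hKg
  have hKg0 : 0 ≤ Kg := by positivity
  have hC : 0 ≤ C1 + C2 := by positivity
  refine ⟨c0, hc0, Λ, hΛ, (C1 + C2) * (1 + 320 * L ^ 2 + Kg), by positivity, ?_⟩
  intro t e G Z z H ht he he1 hG hZL hs hg
  have hφ := wt_nonneg (β := β) he z
  have hp1 := wp1_nonneg hβ he (sq_nonneg ‖z‖)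
  have hT : 0 < t ^ (2 * (b - (p - 1))) := rpow_pos_of_pos ht _
  have hE0 : 0 ≤ (C1 + C2) * (1 + 320 * L ^ 2 + Kg) *
    (1 + (t ^ (b - 1)) ^ 2 * (e ^ 2)⁻¹ + wt β e z * G * t ^ (2 * (b - (p - 1)))) := by positivity
  rcases le_or_gt ‖Z‖ (t / 4) with hlow | hlow
  · have hq : ‖Z‖ ^ 2 ≤ t ^ 2 / 16 := sq_aux5 (norm_nonneg Z) hlow
    have hq4 : ‖Z‖ ^ 2 ≤ t ^ 2 / 4 := hq.trans (by linarith [sq_nonneg t])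
    rw [LHS, Idn, Idn, wf_zero ht hq4, wf_deriv_zero ht hq4, mlow_zero hq, llow_zero hq]
    have : ∀ v, DFv 0 0 Z H v = 0 := by intro v; simp [DFv]
    simp only [this]
    simp [cross]
    exact hE0
  have hZ0 : 0 < ‖Z‖ := lt_trans (by positivity) hlow
  obtain ⟨s, τ, γ, c, σ, hcs, hgt, hdet, hcr, hHS, hI, hF, hdot⟩ := frame p Z z H hs hZ0
  set ρ := ‖Z‖ with hρ
  set q := ρ ^ 2 with hq
  have hq0 : 0 < q := by positivity
  have hq16 : t ^ 2 / 16 < q := sq_aux4 ht hlow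
  have hqL : q ≤ L ^ 2 := pow_le_pow_left₀ hZ0.le hZL 2
  set φ := wt β e z with hφd
  set p1 := wp1 β e (‖z‖ ^ 2) with hp1d
  set p2 := wp2 β e (‖z‖ ^ 2) with hp2d
  set α := wf b t q with hα
  have hα' : α + 2 * q * deriv (wf b t) q = wa b t q := rfl
  set α' := wa b t q with hα'd
  set l := llow b t q with hl
  set μ := mlow b t q with hμ
  have hα0 : 0 ≤ α := wf_nonneg hq0.le
  have hα'0 : 0 ≤ α' := wa_nonneg (by linarith) ht hq0
  have hl0 : 0 ≤ l := llow_nonneg ht hq0.le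
  set ω := cosSq (α • Z) (Complex.I * (z / ‖z‖)) with hω
  have hω0 : 0 ≤ ω := cosSq_nonneg _ _
  have hω1 : ω ≤ 1 := cosSq_unit _ _
  set Bt := 320 * L ^ 2 * ((t ^ (b - 1)) ^ 2 * (e ^ 2)⁻¹) with hBt
  have hB0 : 0 ≤ Bt := by positivity
  have h1 : p1 * (c ^ 2 + σ ^ 2) ≤ 2 * β * φ := by rw [hcs]; exact wp1_bound hβ he z
  have h2 : p2 ^ 2 * (c ^ 2 + σ ^ 2) ≤ 16 * φ := by rw [hcs]; exact wp2_bound hβ hβ1 he z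
  have h3 : ((p1 + p2) * μ * ρ) ^ 2 * (c ^ 2 + σ ^ 2) ≤ Bt * (φ * l) := by
    rw [hcs]
    have a1 := wp_bound hβ hβ1 he he1 z
    have a2 := mlow_sq (b := b) ht hq0 hqL
    have : ((p1 + p2) * μ * ρ) ^ 2 * ‖z‖ ^ 2 = ((p1 + p2) ^ 2 * ‖z‖ ^ 2) * (μ ^ 2 * q) := by rw [hq]; ring
    rw [this]
    calc _ ≤ (40 * (e ^ 2)⁻¹ * φ) * (8 * L ^ 2 * (t ^ (b - 1)) ^ 2 * l) := by
          apply mul_le_mul a1 a2 (by positivity) (by positivity)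
      _ = _ := by rw [hBt]; ring
  have h4 : α ^ 2 * ρ ^ 2 ≤ M := by
    refine le_trans ?_ hML
    have := wf_le (t := t) hb hq0.le hqL
    calc α ^ 2 * ρ ^ 2 = (ρ * α) ^ 2 := by ring
      _ ≤ _ := by
        apply pow_le_pow_left₀ (by positivity)
        apply mul_le_mul hZL this hα0 hL.le
  -- gamma bounds
  have hγ : φ * γ ^ 2 ≤ φ * (G * q ^ (2 - p)) := by
    by_cases hz1 : ‖z‖ < 1
    · apply mul_le_mul_of_nonneg_left _ hφ
      have a1 := hg hlow hz1
      rw [hgt, mul_pow] at a1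
      have a2 : (ρ ^ (p - 2)) ^ 2 * q ^ (2 - p) = 1 := by
        rw [hq, ← rpow_natCast ρ 2, ← rpow_mul hZ0.le, ← rpow_natCast, ← rpow_mul hZ0.le, ← rpow_add hZ0]
        rw [show (p - 2) * ((2:ℕ):ℝ) + ((2:ℕ):ℝ) * (2 - p) = 0 by ring, rpow_zero]
      have a3 : 0 < q ^ (2 - p) := rpow_pos_of_pos hq0 _
      calc γ ^ 2 = (ρ ^ (p - 2)) ^ 2 * q ^ (2 - p) * γ ^ 2 := by rw [a2, one_mul]
        _ = (ρ ^ (p - 2)) ^ 2 * γ ^ 2 * q ^ (2 - p) := by ring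
        _ ≤ _ := mul_le_mul_of_nonneg_right a1 a3.le
    · rw [hφd, wt_zero (not_lt.1 hz1)]; simp
  have hTg : 0 ≤ φ * G * t ^ (2 * (b - (p - 1))) := by positivity
  have h5 : φ * l * γ ^ 2 ≤ 2 * 16 ^ (p - 1) * (φ * G * t ^ (2 * (b - (p - 1)))) := by
    have a1 := llow_gam (b := b) (p := p) (by linarith) ht hq16
    calc φ * l * γ ^ 2 = l * (φ * γ ^ 2) := by ring
      _ ≤ l * (φ * (G * q ^ (2 - p))) := mul_le_mul_of_nonneg_left hγ hl0
      _ = φ * G * (l * q ^ (2 - p)) := by ring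
      _ ≤ φ * G * (2 * 16 ^ (p - 1) * t ^ (2 * (b - (p - 1)))) := mul_le_mul_of_nonneg_left a1 (by positivity)
      _ = _ := by ring
  have h5' : φ * l * γ ^ 2 ≤ Kg * (φ * G * t ^ (2 * (b - (p - 1)))) := by
    refine h5.trans (mul_le_mul_of_nonneg_right ?_ hTg)
    have : 0 < (4:ℝ) ^ (p - 1 - b) := by positivity
    linarith
  have hLHS : LHS b t β e m κ c0 Z z H = c0 * (φ * (α' ^ 2 * (s ^ 2 + τ ^ 2) + α ^ 2 * (τ ^ 2 + (γ - (p - 1) * s) ^ 2)))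
      + κ * p1 * (α' ^ 2 * (s * c + τ * σ) ^ 2 + α ^ 2 * (τ * c + (γ - (p - 1) * s) * σ) ^ 2) * (1 + m * ω)
      + p1 * (α ^ 2 * ρ * (τ * c + (γ - (p - 1) * s) * σ)) := by
    rw [LHS, ← hρ, ← hq, ← hα, ← hω, hHS, hI, hF, hcr, hα']
    ring
  have hI1 : Idn β e (α ^ 2) (α * α') Z z H = 2 * φ * (α * α') * (τ ^ 2 - s * (γ - (p - 1) * s))
      + (p1 + p2) * (α ^ 2 * ρ * (τ * c + (γ - (p - 1) * s) * σ)) := by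
    rw [Idn, hdet, hcr]; ring
  have hI2 : Idn β e μ l Z z H = 2 * φ * l * (τ ^ 2 - s * (γ - (p - 1) * s))
      + ((p1 + p2) * μ * ρ) * (τ * c + (γ - (p - 1) * s) * σ) := by
    rw [Idn, hdet, hcr]; ring
  rw [hLHS, hI1, hI2]
  have hEE : ∀ Y, Y ≤ Kg * (φ * G * t ^ (2 * (b - (p - 1)))) → 1 + Bt + Y ≤ (1 + 320 * L ^ 2 + Kg) *
    (1 + (t ^ (b - 1)) ^ 2 * (e ^ 2)⁻¹ + φ * G * t ^ (2 * (b - (p - 1)))) := by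
    intro Y hY
    exact ee_aux (by positivity) hKg0 (by positivity) hTg hY
  have hE1 : 0 ≤ (1 + 320 * L ^ 2 + Kg) * (1 + (t ^ (b - 1)) ^ 2 * (e ^ 2)⁻¹ + φ * G * t ^ (2 * (b - (p - 1)))) := by positivity
  rcases le_or_gt ρ t with hmt | hmt
  · have hqt : q ≤ t ^ 2 := pow_le_pow_left₀ hZ0.le hmt 2
    have hαl : α ^ 2 ≤ M * l ∧ α' ^ 2 ≤ M * l := by
      rcases le_or_gt q (t ^ 2 / 4) with h | h
      · rw [hα, hα'd, wf_zero ht h, wa_zero ht h]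
        have : 0 ≤ M * l := by positivity
        simp [this]
      · have b1 := llow_lower (b := b) ht h.le hqt
        have b2 := wf_mid hb ht hq0.le hqt
        have b3 := wa_mid hN hb ht hq0 hqt
        have tb : 0 ≤ t ^ (b - 1) := rpow_nonneg ht.le _
        constructor
        · calc α ^ 2 ≤ (t ^ (b - 1)) ^ 2 := pow_le_pow_left₀ hα0 b2 2
            _ ≤ 64 * l := b1
            _ ≤ M * l := mul_le_mul_of_nonneg_right hM64 hl0
        · calc α' ^ 2 ≤ (t ^ (b - 1) * (b + 2 * N)) ^ 2 := pow_le_pow_left₀ hα'0 b3 2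
            _ = (b + 2 * N) ^ 2 * (t ^ (b - 1)) ^ 2 := by ring
            _ ≤ (b + 2 * N) ^ 2 * (64 * l) := mul_le_mul_of_nonneg_left b1 (sq_nonneg _)
            _ = 64 * (b + 2 * N) ^ 2 * l := by ring
            _ ≤ M * l := mul_le_mul_of_nonneg_right hM64' hl0
    have := hmid s τ γ c σ ω φ p1 p2 α α' ρ l ((p1 + p2) * μ * ρ) Bt hφ hl0 hB0 hp1 hα0 hα'0 hω0 hω1 h1 h2 h3
      hαl.1 hαl.2 h4
    exact fin_aux this (hEE _ h5') hC1 (le_add_of_nonneg_right hC2) hE1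
  · have hqt : t ^ 2 ≤ q := sq_aux1 ht hmt
    have hbα : α' = b * α := wa_high ht hqt
    have hαp : 0 < α := wf_pos ht (sq_aux2 ht hqt)
    have hωc : ω * (c ^ 2 + σ ^ 2) = c ^ 2 := by
      rw [hcs]
      by_cases hz : z = 0
      · rw [hz, norm_zero] at hcs
        have : c ^ 2 = 0 := sq_aux3 hcs
        rw [this, hz]; simp
      · rw [hω, cosSq_smul α hαp.ne']
        exact cosSq_c Z z c hZ0 hdot hz
    have h6 : φ * α ^ 2 * γ ^ 2 ≤ 4 ^ (p - 1 - b) * (φ * G * t ^ (2 * (b - (p - 1)))) := by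
      have a1 := wf_gam hbp ht (sq_aux2 ht hqt).le
      calc φ * α ^ 2 * γ ^ 2 = α ^ 2 * (φ * γ ^ 2) := by ring
        _ ≤ α ^ 2 * (φ * (G * q ^ (2 - p))) := mul_le_mul_of_nonneg_left hγ (sq_nonneg _)
        _ = φ * G * (α ^ 2 * q ^ (2 - p)) := by ring
        _ ≤ φ * G * (4 ^ (p - 1 - b) * t ^ (2 * (b - (p - 1)))) := mul_le_mul_of_nonneg_left a1 (by positivity)
        _ = _ := by ring
    have h7 : φ * l * γ ^ 2 + φ * α ^ 2 * γ ^ 2 ≤ Kg * (φ * G * t ^ (2 * (b - (p - 1)))) := by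
      rw [hKg, add_mul]; linarith
    have := hhi s τ γ c σ ω φ p1 p2 α ρ l ((p1 + p2) * μ * ρ) Bt hφ hl0 hB0 hp1 hα0 hω0 hω1 hωc h1 h2 h3 h4
    rw [← hbα] at this
    rw [show 1 + Bt + φ * l * γ ^ 2 + φ * α ^ 2 * γ ^ 2 = 1 + Bt + (φ * l * γ ^ 2 + φ * α ^ 2 * γ ^ 2) from add_assoc _ _ _] at this
    exact fin_aux this (hEE _ h7) hC2 (le_add_of_nonneg_left hC1) hE1

end PLap

namespace PLap

/-- the nonlinear map -/
def Fm (b t : ℝ) (Z : ℂ) : ℂ := wf b t (‖Z‖ ^ 2) • Z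

lemma Fm_contDiff {b t : ℝ} (ht : 0 < t) {n : WithTop ℕ∞} (hn : n ≤ 2) {Z : ℂ → ℂ} (hZ : ContDiff ℝ n Z) :
    ContDiff ℝ n fun z => Fm b t (Z z) :=
  ContDiff.smul (((wf_contDiff ht).of_le hn).comp (contDiff_normSq hZ)) hZ

lemma Fm_fderiv {b t : ℝ} (ht : 0 < t) {Z : ℂ → ℂ} (hZ : ContDiff ℝ 1 Z) (z v : ℂ) :
    fderiv ℝ (fun z => Fm b t (Z z)) z v =
      DFv (wf b t (‖Z z‖ ^ 2)) (deriv (wf b t) (‖Z z‖ ^ 2)) (Z z) (fderiv ℝ Z z) v := by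
  have hZd : HasFDerivAt Z (fderiv ℝ Z z) z := ((hZ.differentiable (by norm_num)) z).hasFDerivAt
  obtain ⟨L, hL, hLv⟩ := normSq_hasFDerivAt hZd
  have h2 : HasDerivAt (wf b t) (deriv (wf b t) (‖Z z‖ ^ 2)) (‖Z z‖ ^ 2) :=
    (((wf_contDiff ht).differentiable (by norm_num)) _).hasDerivAt
  have h3 := (h2.comp_hasFDerivAt z hL).smul hZd
  have h4 : fderiv ℝ (fun z => Fm b t (Z z)) z = _ := h3.fderiv
  rw [h4]
  simp [DFv, hLv]
  left; ring

lemma wp1_cont {β e : ℝ} (he : 0 < e) : Continuous fun z : ℂ => wp1 β e (‖z‖ ^ 2) := by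
  unfold wp1
  have h1 : Continuous fun z : ℂ => (‖z‖ ^ 2 + e) ^ (-β - 1) :=
    Continuous.rpow_const (by fun_prop) fun z => Or.inl (by positivity)
  have h2 : Continuous fun z : ℂ => posq (1 - ‖z‖ ^ 2) := posq_contDiff.continuous.comp (by fun_prop)
  fun_prop

lemma wp2_cont {β e : ℝ} (he : 0 < e) : Continuous fun z : ℂ => wp2 β e (‖z‖ ^ 2) := by
  unfold wp2
  have h1 : Continuous fun z : ℂ => (‖z‖ ^ 2 + e) ^ (-β) :=
    Continuous.rpow_const (by fun_prop) fun z => Or.inl (by positivity)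
  fun_prop

lemma wp1_zero {β e : ℝ} {z : ℂ} (h : 1 ≤ ‖z‖) : wp1 β e (‖z‖ ^ 2) = 0 := by
  unfold wp1; rw [posq_of_nonpos (by nlinarith)]; simp
lemma wp2_zero {β e : ℝ} {z : ℂ} (h : 1 ≤ ‖z‖) : wp2 β e (‖z‖ ^ 2) = 0 := by
  unfold wp2; rw [max_eq_right (by nlinarith)]; simp

lemma fderiv_cont {Z : ℂ → ℂ} (hZ : ContDiff ℝ 1 Z) : Continuous (fderiv ℝ Z) :=
  hZ.continuous_fderiv (by norm_num)

lemma idn_cont {β e : ℝ} (he : 0 < e) (M l : ℝ → ℝ) (hM : Continuous M) (hl : Continuous l) {Z : ℂ → ℂ}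
    (hZ : ContDiff ℝ 1 Z) :
    Continuous fun z => Idn β e (M (‖Z z‖ ^ 2)) (l (‖Z z‖ ^ 2)) (Z z) z (fderiv ℝ Z z) := by
  unfold Idn
  have h0 := hZ.continuous
  have h1 := (wt_contDiff (β := β) he).continuous
  have h2 := wp1_cont (β := β) he
  have h3 := wp2_cont (β := β) he
  have h4 := fderiv_cont hZ
  fun_prop

lemma idn_zero {β e : ℝ} (he : 0 < e) (M l : ℝ → ℝ) (hM : ContDiff ℝ 1 M)
    (hl : ∀ q, 0 ≤ q → M q + q * deriv M q = l q) {Z : ℂ → ℂ} (hZ : ContDiff ℝ 2 Z) :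
    ∫ z, Idn β e (M (‖Z z‖ ^ 2)) (l (‖Z z‖ ^ 2)) (Z z) z (fderiv ℝ Z z) = 0 := by
  rw [← identity (wt β e) (wt_contDiff he) wt_compact M hM Z hZ]
  congr 1
  ext z
  rw [hl _ (sq_nonneg _), Idn, wt_fderiv he, wt_fderiv he, H_apply _ (Complex.I * z)]
  simp only [cross, dot, Complex.add_re, Complex.add_im, Complex.smul_re, Complex.smul_im, smul_eq_mul,
    Complex.mul_re, Complex.mul_im, Complex.I_re, Complex.I_im, Complex.one_re, Complex.one_im]
  ring

lemma cosSq_meas {F : ℂ → ℂ} (hF : Continuous F) :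
    Measurable fun z => cosSq (F z) (Complex.I * (z / ‖z‖)) := by
  unfold cosSq dot
  have h1 := hF.measurable
  have h2 : Measurable fun z : ℂ => Complex.I * (z / (‖z‖ : ℂ)) := by fun_prop
  have := Complex.measurable_re.comp h1
  have := Complex.measurable_im.comp h1
  have := Complex.measurable_re.comp h2
  have := Complex.measurable_im.comp h2
  fun_prop

lemma circD_integrableOn {β e m κ : ℝ} (he : 0 < e) {F : ℂ → ℂ} (hF : ContDiff ℝ 1 F) :
    IntegrableOn (circD m κ (fun r => wp1 β e (r ^ 2)) F) (closedBall 0 1) := by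
  have h0 := hF.continuous
  have h4 := fderiv_cont hF
  have h2 := wp1_cont (β := β) he
  have e1 : circD m κ (fun r => wp1 β e (r ^ 2)) F = fun z =>
    (wp1 β e (‖z‖ ^ 2) * (κ * ‖fderiv ℝ F z (Complex.I * z)‖ ^ 2 + cross (F z) (fderiv ℝ F z (Complex.I * z))))
    + cosSq (F z) (Complex.I * (z / ‖z‖)) * (wp1 β e (‖z‖ ^ 2) * κ * m * ‖fderiv ℝ F z (Complex.I * z)‖ ^ 2) := by
    ext z; unfold circD; ring
  rw [e1]
  apply IntegrableOn.add
  · exact (by fun_prop : Continuous fun z => wp1 β e (‖z‖ ^ 2) * (κ * ‖fderiv ℝ F z (Complex.I * z)‖ ^ 2 +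
      cross (F z) (fderiv ℝ F z (Complex.I * z)))).continuousOn.integrableOn_compact (isCompact_closedBall _ _)
  · refine Integrable.bdd_mul (c := 1) ?_ (cosSq_meas h0).aestronglyMeasurable ?_
    · exact (by fun_prop : Continuous fun z => wp1 β e (‖z‖ ^ 2) * κ * m * ‖fderiv ℝ F z (Complex.I * z)‖ ^ 2).continuousOn.integrableOn_compact (isCompact_closedBall _ _)
    · refine Filter.Eventually.of_forall fun z => ?_
      rw [Real.norm_eq_abs, abs_of_nonneg (cosSq_nonneg _ _)]
      exact cosSq_unit _ _

lemma setInt_closedBall {f : ℂ → ℝ} (h : ∀ z, 1 ≤ ‖z‖ → f z = 0) : ∫ z in closedBall 0 1, f z = ∫ z, f z := by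
  apply setIntegral_eq_integral_of_forall_compl_eq_zero
  intro z hz
  apply h
  rw [mem_closedBall, dist_zero_right, not_le] at hz
  exact hz.le

/-- Energy of `F` -/
def En (β e : ℝ) (F : ℂ → ℂ) : ℝ := ∫ z, wt β e z * (‖fderiv ℝ F z 1‖ ^ 2 + ‖fderiv ℝ F z Complex.I‖ ^ 2)

set_option maxHeartbeats 1000000 in
lemma smooth_master {p b K κ m β L : ℝ} (hp : 2 < p) (hb : 1 ≤ b) (hbp : b ≤ p - 1) (hK : 0 < K) (hκ : 0 ≤ κ)
    (hm : 0 ≤ m) (hβ : 0 ≤ β) (hβ1 : β ≤ 1) (hS : Struct (p - 1) b K m) (hlt : β * κ * K < 1) (hL : 0 < L)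
    (hC : CircleIneq m κ) :
    ∃ C, 0 ≤ C ∧ ∀ (t e : ℝ) (Z : ℂ → ℂ) (G : ℂ → ℝ), 0 < t → 0 < e → e ≤ 1 → ContDiff ℝ 2 Z →
      Continuous G → (∀ z, 0 ≤ G z) → (∀ z, ‖z‖ ≤ 1 → ‖Z z‖ ≤ L) →
      (∀ z, (fderiv ℝ Z z 1).im = (fderiv ℝ Z z Complex.I).re) →
      (∀ z, t / 4 < ‖Z z‖ → ‖z‖ < 1 → gt p (Z z) (fderiv ℝ Z z) ^ 2 ≤ G z) →
      En β e (fun z => Fm b t (Z z)) ≤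
        C * (1 + (t ^ (b - 1)) ^ 2 * (e ^ 2)⁻¹ + t ^ (2 * (b - (p - 1))) * ∫ z, wt β e z * G z) := by
  obtain ⟨c0, hc0, Λ, hΛ, C, hC0, hpw⟩ := pw_all hp hb hbp hK hκ hm hβ hβ1 hS hlt hL
  set V := (volume (closedBall (0:ℂ) 1)).toReal with hV
  have hV0 : 0 ≤ V := ENNReal.toReal_nonneg
  refine ⟨c0⁻¹ * (C * (V + 1)), by positivity, ?_⟩
  intro t e Z G ht he he1 hZ hG hG0 hZL hs hg
  have hZ1 : ContDiff ℝ 1 Z := hZ.of_le (by norm_num)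
  have hF : ContDiff ℝ 1 fun z => Fm b t (Z z) := Fm_contDiff ht (by norm_num) hZ1
  set F : ℂ → ℂ := fun z => Fm b t (Z z) with hFd
  set h : ℝ → ℝ := fun r => wp1 β e (r ^ 2) with hh
  have hwt := (wt_contDiff (β := β) he).continuous
  have hFc := fderiv_cont hF
  -- the four integrals
  set S := closedBall (0:ℂ) 1 with hSd
  have hSc : IsCompact S := isCompact_closedBall _ _
  set X : ℂ → ℝ := fun z => wt β e z * (‖fderiv ℝ F z 1‖ ^ 2 + ‖fderiv ℝ F z Complex.I‖ ^ 2) with hX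
  have iX : IntegrableOn X S :=
    (by fun_prop : Continuous X).continuousOn.integrableOn_compact hSc
  have iD : IntegrableOn (circD m κ h F) S := circD_integrableOn he hF
  set I1 : ℂ → ℝ := fun z => Idn β e (wf b t (‖Z z‖ ^ 2) ^ 2) (wf b t (‖Z z‖ ^ 2) * wa b t (‖Z z‖ ^ 2)) (Z z) z (fderiv ℝ Z z) with hI1
  set I2 : ℂ → ℝ := fun z => Idn β e (mlow b t (‖Z z‖ ^ 2)) (llow b t (‖Z z‖ ^ 2)) (Z z) z (fderiv ℝ Z z) with hI2
  have hwc := (wf_contDiff (b := b) ht).continuous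
  have hwdc := (wf_contDiff (b := b) ht).continuous_deriv (by norm_num)
  have hm1 := mlow_contDiff (b := b) ht
  have hI1e : I1 = fun z => Idn β e ((fun q => wf b t q ^ 2) (‖Z z‖ ^ 2)) ((fun q => wf b t q * wa b t q) (‖Z z‖ ^ 2)) (Z z) z (fderiv ℝ Z z) := rfl
  have hI2e : I2 = fun z => Idn β e (mlow b t (‖Z z‖ ^ 2)) ((fun q => mlow b t q + q * deriv (mlow b t) q) (‖Z z‖ ^ 2)) (Z z) z (fderiv ℝ Z z) := by
    rw [hI2]; ext z; simp only [mlow_l ht (sq_nonneg ‖Z z‖)]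
  have cI1 : Continuous I1 := by
    rw [hI1e]
    refine idn_cont he (fun q => wf b t q ^ 2) (fun q => wf b t q * wa b t q) (by fun_prop) ?_ hZ1
    unfold wa; fun_prop
  have cI2 : Continuous I2 := by
    rw [hI2e]
    have := hm1.continuous
    have := hm1.continuous_deriv (by norm_num)
    exact idn_cont he (mlow b t) (fun q => mlow b t q + q * deriv (mlow b t) q) hm1.continuous (by fun_prop) hZ1
  have vI : ∀ M l Z z H, 1 ≤ ‖z‖ → Idn β e M l Z z H = 0 := by
    intro M l Z z H hz
    rw [Idn, wt_zero hz, wp1_zero hz, wp2_zero hz]; simp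
  have zI1 : ∫ z in S, I1 z = 0 := by
    rw [setInt_closedBall (f := I1) (fun z hz => vI _ _ _ _ _ hz), hI1e]
    refine idn_zero he (fun q => wf b t q ^ 2) (fun q => wf b t q * wa b t q) ?_ ?_ hZ
    · exact ((wf_contDiff ht).of_le (by norm_num)).pow 2
    · intro q _
      have hd : HasDerivAt (wf b t) (deriv (wf b t) q) q :=
        (((wf_contDiff ht).differentiable (by norm_num)) _).hasDerivAt
      have : deriv (fun q => wf b t q ^ 2) q = _ := (hd.pow 2).deriv
      rw [this, wa]; push_cast; ring
  have zI2 : ∫ z in S, I2 z = 0 := by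
    rw [setInt_closedBall (f := I2) (fun z hz => vI _ _ _ _ _ hz), hI2e]
    exact idn_zero he (mlow b t) (fun q => mlow b t q + q * deriv (mlow b t) q) hm1 (fun q _ => rfl) hZ
  have zD : 0 ≤ ∫ z in S, circD m κ h F z := by
    rw [setInt_closedBall]
    · exact circle_plane hC h (fun r _ => wp1_nonneg hβ he (sq_nonneg r)) F hF
    · intro z hz
      simp only [circD, hh, wp1_zero hz, zero_mul]
  have zX : ∫ z in S, X z = En β e F := by
    rw [setInt_closedBall]
    · rfl
    · intro z hz; simp only [hX, wt_zero hz, zero_mul]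
  have zG : ∫ z in S, wt β e z * G z = ∫ z, wt β e z * G z :=
    setInt_closedBall fun z hz => by rw [wt_zero hz, zero_mul]
  have iG : IntegrableOn (fun z => wt β e z * G z) S :=
    (by fun_prop : Continuous fun z => wt β e z * G z).continuousOn.integrableOn_compact hSc
  have iI1 : IntegrableOn I1 S := cI1.continuousOn.integrableOn_compact hSc
  have iI2 : IntegrableOn I2 S := cI2.continuousOn.integrableOn_compact hSc
  set A := 1 + (t ^ (b - 1)) ^ 2 * (e ^ 2)⁻¹ with hA
  set T := t ^ (2 * (b - (p - 1))) with hT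
  have hT0 : 0 ≤ T := rpow_nonneg ht.le _
  have hA0 : 0 ≤ A := by positivity
  have ic : IntegrableOn (fun _ : ℂ => C * A) S := by
    exact continuousOn_const.integrableOn_compact hSc
  have iL : IntegrableOn (fun z => c0 * X z + circD m κ h F z) S := (iX.const_mul c0).add iD
  have i12 : IntegrableOn (fun z => I1 z + Λ * I2 z) S := iI1.add (iI2.const_mul Λ)
  have icG : IntegrableOn (fun z => C * A + C * T * (wt β e z * G z)) S := ic.add (iG.const_mul _)
  have mono : ∫ z in S, (c0 * X z + circD m κ h F z) ≤
      ∫ z in S, ((I1 z + Λ * I2 z) + (C * A + C * T * (wt β e z * G z))) := by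
    refine setIntegral_mono_on iL (i12.add icG) measurableSet_closedBall ?_
    intro z hz
    rw [hSd, mem_closedBall, dist_zero_right] at hz
    have := hpw t e (G z) (Z z) z (fderiv ℝ Z z) ht he he1 (hG0 z) (hZL z hz) (hs z) (hg z)
    rw [LHS] at this
    have e1 : ∀ v, fderiv ℝ F z v = _ := Fm_fderiv ht hZ1 z
    simp only [hX, circD, hh, e1]
    rw [show F z = wf b t (‖Z z‖ ^ 2) • Z z from rfl]
    refine this.trans (le_of_eq ?_)
    ring
  rw [integral_add (iX.const_mul c0) iD, integral_add i12 icG, integral_add iI1 (iI2.const_mul Λ),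
    integral_add ic (iG.const_mul _), integral_const_mul c0, integral_const_mul Λ, integral_const_mul (C * T), zI1, zI2, zX, zG,
    setIntegral_const, smul_eq_mul] at mono
  rw [show volume.real S = V from rfl] at mono
  set J := ∫ z, wt β e z * G z with hJ
  have hJ0 : 0 ≤ J := integral_nonneg fun z => mul_nonneg (wt_nonneg he z) (hG0 z)
  have f1 : c0 * En β e F ≤ C * (V + 1) * (A + T * J) := by
    have u1 : 0 ≤ C * A := by positivity
    have u2 : 0 ≤ C * V * (T * J) := by positivity
    nlinarith
  rw [mul_assoc, ← div_eq_inv_mul, le_div_iff₀ hc0]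
  linarith

end PLap

namespace PLap

lemma int_rpow_le {β a r : ℝ} (hβ : 0 < β) (ha : 0 < a) (har : a ≤ r) :
    ∫ s in a..r, s ^ (2 * β - 1) ≤ r ^ (2 * β) / (2 * β) := by
  rw [integral_rpow (Or.inl (by linarith))]
  rw [show 2 * β - 1 + 1 = 2 * β by ring]
  have : 0 ≤ a ^ (2 * β) := rpow_nonneg ha.le _
  gcongr; linarith

lemma wt_lower {β r1 s : ℝ} (hβ : 0 < β) (hβ1 : β ≤ 1) (h1 : 0 < r1) (h2 : r1 ≤ s) (h3 : s ≤ 1 / 2)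
    {z : ℂ} (hz : ‖z‖ = s) : s ^ (-(2 * β)) ≤ 4 * wt β (r1 ^ 2) z := by
  have hs : 0 < s := h1.trans_le h2
  unfold wt
  rw [hz, posq_of_nonneg (by nlinarith)]
  have e1 : (s ^ 2 + r1 ^ 2) ≤ 2 * s ^ 2 := by nlinarith
  have e2 : (2 * s ^ 2) ^ (-β) ≤ (s ^ 2 + r1 ^ 2) ^ (-β) :=
    rpow_le_rpow_of_nonpos (by positivity) e1 (by linarith)
  rw [mul_rpow (by norm_num) (by positivity)] at e2
  have e3 : (s ^ 2) ^ (-β) = s ^ (-(2 * β)) := by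
    rw [← rpow_natCast, ← rpow_mul hs.le]; congr 1; push_cast; ring
  have e4 : (1 / 2 : ℝ) ≤ (2:ℝ) ^ (-β) := by
    have : (2:ℝ) ^ (-1 : ℝ) ≤ 2 ^ (-β) := rpow_le_rpow_of_exponent_le (by norm_num) (by linarith)
    rw [rpow_neg_one] at this; linarith
  rw [e3] at e2
  have e5 : 0 < s ^ (-(2 * β)) := rpow_pos_of_pos hs _
  have e60 : s ^ 2 ≤ 1 / 4 := by nlinarith
  have e6 : (9 / 16 : ℝ) ≤ (1 - s ^ 2) ^ 2 := by nlinarith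
  have e7 : 1 / 2 * s ^ (-(2 * β)) ≤ (s ^ 2 + r1 ^ 2) ^ (-β) := by nlinarith
  have e8 : 1 / 2 * s ^ (-(2 * β)) * (9/16) ≤ (s ^ 2 + r1 ^ 2) ^ (-β) * (1 - s ^ 2) ^ 2 := by
    gcongr
  nlinarith

lemma clm_E (A : ℂ →L[ℝ] ℂ) (x : ℝ) : ‖A (E x)‖ ^ 2 ≤ ‖A 1‖ ^ 2 + ‖A Complex.I‖ ^ 2 := by
  rw [H_apply A (E x)]
  have h1 : ‖(E x).re • A 1 + (E x).im • A Complex.I‖ ≤ |(E x).re| * ‖A 1‖ + |(E x).im| * ‖A Complex.I‖ := by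
    refine (norm_add_le _ _).trans ?_
    simp [norm_smul]
  have h2 : |(E x).re| ^ 2 + |(E x).im| ^ 2 = 1 := by
    rw [sq_abs, sq_abs, E_re, E_im]; exact cos_sq_add_sin_sq x
  have h3 := pow_le_pow_left₀ (norm_nonneg _) h1 2
  refine h3.trans ?_
  nlinarith [sq_nonneg (|(E x).re| * ‖A Complex.I‖ - |(E x).im| * ‖A 1‖)]

lemma radial_pt {β : ℝ} (hβ : 0 < β) (hβ1 : β ≤ 1) {r1 r : ℝ} (h1 : 0 < r1) (h2 : r1 ≤ r)
    (h3 : r ≤ 1 / 2) {F : ℂ → ℂ} (hF : ContDiff ℝ 1 F) (x : ℝ) :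
    ‖F (r * E x) - F (r1 * E x)‖ ^ 2 ≤ (2 / β * r ^ (2 * β)) *
      ∫ s in r1..r, s * (wt β (r1 ^ 2) (s * E x) *
        (‖fderiv ℝ F (s * E x) 1‖ ^ 2 + ‖fderiv ℝ F (s * E x) Complex.I‖ ^ 2)) := by
  have hr : 0 < r := h1.trans_le h2
  have hFc := fderiv_cont hF
  have hD : Continuous (fderiv ℝ F) := hF.continuous_fderiv (by norm_num)
  have hcE : Continuous fun s : ℝ => fderiv ℝ F (s * E x) (E x) :=
    (hD.comp (by fun_prop)).clm_apply continuous_const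
  have hc1 : ∀ v : ℂ, Continuous fun s : ℝ => fderiv ℝ F (s * E x) v := fun v =>
    (hD.comp (by fun_prop)).clm_apply continuous_const
  have hwt : Continuous (wt β (r1 ^ 2)) := (wt_contDiff (by positivity)).continuous
  have e1 : ∫ s in r1..r, fderiv ℝ F (s * E x) (E x) = F (r * E x) - F (r1 * E x) :=
    intervalIntegral.integral_eq_sub_of_hasDerivAt (fun s _ => fderiv_radial F hF s x)
      (hcE.intervalIntegrable _ _)
  have e2 : ‖F (r * E x) - F (r1 * E x)‖ ≤ ∫ s in r1..r, ‖fderiv ℝ F (s * E x) (E x)‖ := by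
    rw [← e1]; exact intervalIntegral.norm_integral_le_integral_norm h2
  have hpow : ∀ c : ℝ, ContinuousOn (fun s : ℝ => s ^ c) (Set.uIcc r1 r) := by
    intro c s hs
    rw [Set.uIcc_of_le h2] at hs
    exact (continuousAt_rpow_const _ _ (Or.inl (h1.trans_le hs.1).ne')).continuousWithinAt
  have key := cs (volume.restrict (Set.Ioc r1 r)) (fun s : ℝ => s ^ (1 / 2 - β) * ‖fderiv ℝ F (s * E x) (E x)‖)
    (fun s => s ^ (β - 1 / 2))
    ((((hpow _).mul hcE.norm.continuousOn).pow 2).intervalIntegrable).1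
    (((hpow _).pow 2).intervalIntegrable).1
    ((((hpow _).mul hcE.norm.continuousOn).mul (hpow _)).intervalIntegrable).1
  rw [← intervalIntegral.integral_of_le h2, ← intervalIntegral.integral_of_le h2,
    ← intervalIntegral.integral_of_le h2] at key
  have c1 : ∫ s in r1..r, s ^ (1 / 2 - β) * ‖fderiv ℝ F (s * E x) (E x)‖ * s ^ (β - 1 / 2) =
      ∫ s in r1..r, ‖fderiv ℝ F (s * E x) (E x)‖ := by
    apply intervalIntegral.integral_congr
    intro s hs
    rw [Set.uIcc_of_le h2] at hs
    have hs0 : 0 < s := h1.trans_le hs.1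
    have : s ^ (1 / 2 - β) * s ^ (β - 1 / 2) = 1 := by
      rw [← rpow_add hs0]; simp
    simp only
    linear_combination ‖fderiv ℝ F (s * E x) (E x)‖ * this
  have c2 : ∫ s in r1..r, (s ^ (β - 1 / 2)) ^ 2 = ∫ s in r1..r, s ^ (2 * β - 1) := by
    apply intervalIntegral.integral_congr
    intro s hs
    rw [Set.uIcc_of_le h2] at hs
    have hs0 : 0 < s := h1.trans_le hs.1
    simp only
    rw [← rpow_natCast, ← rpow_mul hs0.le]; congr 1; push_cast; ring
  have c3 : ∫ s in r1..r, (s ^ (1 / 2 - β) * ‖fderiv ℝ F (s * E x) (E x)‖) ^ 2 ≤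
      4 * ∫ s in r1..r, s * (wt β (r1 ^ 2) (s * E x) *
        (‖fderiv ℝ F (s * E x) 1‖ ^ 2 + ‖fderiv ℝ F (s * E x) Complex.I‖ ^ 2)) := by
    rw [← intervalIntegral.integral_const_mul]
    apply intervalIntegral.integral_mono_on h2
    · exact ((((hpow _).mul hcE.norm.continuousOn).pow 2).intervalIntegrable)
    · apply Continuous.intervalIntegrable
      have := hc1 1
      have := hc1 Complex.I
      fun_prop
    · intro s hs
      have hs0 : 0 < s := h1.trans_le hs.1
      have hz : ‖(s : ℂ) * E x‖ = s := by simp [norm_E, abs_of_pos hs0]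
      have w := wt_lower hβ hβ1 h1 hs.1 (hs.2.trans h3) hz
      have a1 : (s ^ (1 / 2 - β)) ^ 2 = s * s ^ (-(2 * β)) := by
        rw [← rpow_natCast, ← rpow_mul hs0.le]
        nth_rewrite 2 [← rpow_one s]
        rw [← rpow_add hs0]; congr 1; push_cast; ring
      rw [mul_pow, a1]
      calc _ ≤ s * (4 * wt β (r1 ^ 2) (s * E x)) * (‖fderiv ℝ F (s * E x) 1‖ ^ 2 + ‖fderiv ℝ F (s * E x) Complex.I‖ ^ 2) := by
            gcongr
            · exact mul_nonneg hs0.le (mul_nonneg (by norm_num) (wt_nonneg (by positivity) _))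
            · exact clm_E _ x
        _ = _ := by ring
  rw [c1, c2] at key
  set T := ∫ s in r1..r, s * (wt β (r1 ^ 2) (s * E x) *
        (‖fderiv ℝ F (s * E x) 1‖ ^ 2 + ‖fderiv ℝ F (s * E x) Complex.I‖ ^ 2)) with hT
  have hp0 : 0 ≤ ∫ s in r1..r, s ^ (2 * β - 1) := by
    apply intervalIntegral.integral_nonneg h2
    intro s hs; exact rpow_nonneg (h1.le.trans hs.1) _
  have hT0 : 0 ≤ 4 * T := by
    refine le_trans ?_ c3
    apply intervalIntegral.integral_nonneg h2
    intro s hs; positivity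
  calc _ ≤ (∫ s in r1..r, ‖fderiv ℝ F (s * E x) (E x)‖) ^ 2 := by gcongr
    _ ≤ _ := key
    _ ≤ (4 * T) * (r ^ (2 * β) / (2 * β)) :=
      mul_le_mul c3 (int_rpow_le hβ h1 h2) hp0 hT0
    _ = _ := by field_simp; ring

lemma radial {β : ℝ} (hβ : 0 < β) (hβ1 : β ≤ 1) {r1 r : ℝ} (h1 : 0 < r1) (h2 : r1 ≤ r)
    (h3 : r ≤ 1 / 2) {F : ℂ → ℂ} (hF : ContDiff ℝ 1 F) :
    ∫ x in (-π)..π, ‖F (r * E x) - F (r1 * E x)‖ ^ 2 ≤ (2 / β * r ^ (2 * β)) * En β (r1 ^ 2) F := by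
  have hr : 0 < r := h1.trans_le h2
  have he : 0 < r1 ^ 2 := by positivity
  have hFc := hF.continuous
  have hD : Continuous (fderiv ℝ F) := hF.continuous_fderiv (by norm_num)
  have hd1 : ∀ v : ℂ, Continuous fun z => fderiv ℝ F z v := fun v => hD.clm_apply continuous_const
  have hwt : Continuous (wt β (r1 ^ 2)) := (wt_contDiff he).continuous
  have d1 := hd1 1
  have d2 := hd1 Complex.I
  have hgc : Continuous fun z => wt β (r1 ^ 2) z * (‖fderiv ℝ F z 1‖ ^ 2 + ‖fderiv ℝ F z Complex.I‖ ^ 2) := by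
    fun_prop
  have hgi : Integrable fun z => wt β (r1 ^ 2) z * (‖fderiv ℝ F z 1‖ ^ 2 + ‖fderiv ℝ F z Complex.I‖ ^ 2) :=
    hgc.integrable_of_hasCompactSupport (wt_compact.mul_right)
  have hg0 : ∀ z, 0 ≤ wt β (r1 ^ 2) z * (‖fderiv ℝ F z 1‖ ^ 2 + ‖fderiv ℝ F z Complex.I‖ ^ 2) :=
    fun z => mul_nonneg (wt_nonneg he z) (by positivity)
  have key := polar_annulus _ hgc hgi hg0 r1 r h1 h2
  have hb : 0 ≤ 2 / β * r ^ (2 * β) := by positivity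
  refine le_trans ?_ (mul_le_mul_of_nonneg_left key hb)
  rw [← intervalIntegral.integral_const_mul]
  have hcc : Continuous fun q : ℝ × ℝ => q.2 * (wt β (r1 ^ 2) (q.2 * E q.1) *
      (‖fderiv ℝ F (q.2 * E q.1) 1‖ ^ 2 + ‖fderiv ℝ F (q.2 * E q.1) Complex.I‖ ^ 2)) :=
    continuous_snd.mul (hgc.comp (by fun_prop))
  apply intervalIntegral.integral_mono_on (by linarith [pi_pos])
  · apply Continuous.intervalIntegrable; fun_prop
  · apply Continuous.intervalIntegrable
    exact continuous_const.mul
      (intervalIntegral.continuous_parametric_intervalIntegral_of_continuous' hcc r1 r)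
  · intro x _
    exact radial_pt hβ hβ1 h1 h2 h3 hF x

lemma wt_int {β : ℝ} (hβ : 0 ≤ β) (hβ1 : β < 1) :
    ∃ C, 0 ≤ C ∧ ∀ e, 0 < e → ∫ z, wt β e z ≤ C := by
  have hC : IntegrableOn (fun y : ℝ => y ^ (1 - 2 * β)) (Set.Ioc 0 1) :=
    (intervalIntegral.intervalIntegrable_rpow' (a := 0) (b := 1) (by linarith)).1
  refine ⟨2 * volume.real (ball (0:ℂ) 1) * ∫ y in Set.Ioc (0:ℝ) 1, y ^ (1 - 2 * β), ?_, ?_⟩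
  · refine mul_nonneg (by positivity) (setIntegral_nonneg measurableSet_Ioc fun y hy => rpow_nonneg hy.1.le _)
  intro e he
  have h := integral_fun_norm_addHaar (volume : Measure ℂ) (fun y : ℝ => (y ^ 2 + e) ^ (-β) * posq (1 - y ^ 2))
  have hd : Module.finrank ℝ ℂ = 2 := Complex.finrank_real_complex
  rw [hd] at h
  change ∫ z, wt β e z = _ at h
  rw [h]
  simp only [nsmul_eq_mul, smul_eq_mul, Nat.cast_ofNat]
  rw [mul_assoc]
  refine mul_le_mul_of_nonneg_left (mul_le_mul_of_nonneg_left ?_ measureReal_nonneg) (by norm_num)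
  · have hz : ∀ y ∈ Set.Ioi (0:ℝ), y ∉ Set.Ioc (0:ℝ) 1 →  y ^ (2 - 1) * ((y ^ 2 + e) ^ (-β) * posq (1 - y ^ 2)) = 0 := by
      intro y hy hn
      have : 1 < y := by
        by_contra hh; exact hn ⟨hy, not_lt.1 hh⟩
      rw [posq_of_nonpos (by nlinarith)]; simp
    have hsub : Set.Ioc (0:ℝ) 1 ⊆ Set.Ioi 0 := fun y hy => hy.1
    rw [setIntegral_eq_of_subset_of_forall_sdiff_eq_zero measurableSet_Ioi hsub (fun y hy => hz y hy.1 hy.2)]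
    have hcont : Continuous fun y : ℝ => y ^ (2 - 1) * ((y ^ 2 + e) ^ (-β) * posq (1 - y ^ 2)) := by
      refine (by fun_prop : Continuous fun y : ℝ => y ^ (2-1)).mul (Continuous.mul ?_ (posq_contDiff.continuous.comp (by fun_prop)))
      exact Continuous.rpow_const (by fun_prop) fun y => Or.inl (by positivity)
    apply setIntegral_mono_on (hcont.integrableOn_Ioc) hC measurableSet_Ioc
    intro y hy
    have hy0 := hy.1
    have a1 : (y ^ 2 + e) ^ (-β) ≤ (y ^ 2) ^ (-β) :=
      rpow_le_rpow_of_nonpos (by positivity) (by linarith) (by linarith)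
    have e3 : (y ^ 2) ^ (-β) = y ^ (-(2 * β)) := by
      rw [← rpow_natCast, ← rpow_mul hy0.le]; congr 1; push_cast; ring
    have a2 : posq (1 - y ^ 2) ≤ 1 := by
      have : y ^ 2 ≤ 1 := by nlinarith [hy.2]
      rw [posq_of_nonneg (by linarith)]
      nlinarith [sq_nonneg y]
    have a3 : y ^ (1 - 2 * β) = y * y ^ (-(2 * β)) := by
      rw [sub_eq_add_neg, rpow_add hy0, rpow_one]
    rw [a3, ← e3]
    have a4 := posq_nonneg (1 - y ^ 2)
    have a5 : 0 ≤ (y ^ 2) ^ (-β) := by positivity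
    calc _ ≤ y ^ (2 - 1) * ((y ^ 2) ^ (-β) * 1) := by gcongr
      _ = _ := by simp

lemma wt_le {β e : ℝ} (hβ : 0 ≤ β) (he : 0 < e) (z : ℂ) : wt β e z ≤ e ^ (-β) := by
  have a1 : (‖z‖ ^ 2 + e) ^ (-β) ≤ e ^ (-β) :=
    rpow_le_rpow_of_nonpos he (by nlinarith [sq_nonneg ‖z‖]) (by linarith)
  have a2 : posq (1 - ‖z‖ ^ 2) ≤ 1 := by
    unfold posq
    have h1 : max (1 - ‖z‖ ^ 2) 0 ≤ 1 := max_le (by nlinarith [sq_nonneg ‖z‖]) (by norm_num)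
    have h0 : 0 ≤ max (1 - ‖z‖ ^ 2) 0 := le_max_right _ _
    nlinarith
  unfold wt
  calc _ ≤ e ^ (-β) * 1 := by gcongr; exact posq_nonneg _
    _ = _ := mul_one _

end PLap

namespace PLap

/-- complex gradient -/
def cgrad (u : ℂ → ℝ) (z : ℂ) : ℂ := ⟨fderiv ℝ u z 1, fderiv ℝ u z Complex.I⟩
/-- the p-Laplace flux -/
def Aop (p : ℝ) (z : ℂ) : ℂ := (‖z‖ ^ (p - 2)) • z
/-- weak (approximate) solution -/
def Sol (p R δ : ℝ) (u : ℂ → ℝ) : Prop :=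
  ContDiff ℝ 1 u ∧ ∀ φ : ℂ → ℝ, ContDiff ℝ (⊤ : ℕ∞) φ → HasCompactSupport φ →
    tsupport φ ⊆ ball 0 R → |∫ z, dot (Aop p (cgrad u z)) (cgrad φ z)| ≤ δ * ∫ z, |φ z|

lemma fderiv_apply_dot (u : ℂ → ℝ) (z v : ℂ) : fderiv ℝ u z v = dot (cgrad u z) v := by
  have : v = v.re • (1:ℂ) + v.im • Complex.I := by simp [Complex.re_add_im]
  conv_lhs => rw [this]
  rw [map_add, map_smul, map_smul, dot, cgrad]; simp [mul_comm]

lemma cgrad_cont {u : ℂ → ℝ} (hu : ContDiff ℝ 1 u) : Continuous (cgrad u) := by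
  have h : ∀ v : ℂ, Continuous fun z => fderiv ℝ u z v := fun v =>
    (hu.continuous_fderiv (by norm_num)).clm_apply continuous_const
  have e : cgrad u = fun z => (fderiv ℝ u z 1 : ℂ) + (fderiv ℝ u z Complex.I : ℂ) * Complex.I := by
    ext z; apply Complex.ext <;> simp [cgrad]
  rw [e]
  have := h 1
  have := h Complex.I
  fun_prop

lemma norm_fderiv_le (u : ℂ → ℝ) (z : ℂ) : ‖fderiv ℝ u z‖ ≤ ‖cgrad u z‖ := by
  apply ContinuousLinearMap.opNorm_le_bound _ (norm_nonneg _)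
  intro v
  rw [fderiv_apply_dot, Real.norm_eq_abs]; exact abs_dot_le _ _

lemma norm_le_abs (a : ℂ) : ‖a‖ ≤ |a.re| + |a.im| := Complex.norm_le_abs_re_add_abs_im a

lemma norm_cgrad_le (u : ℂ → ℝ) (z : ℂ) : ‖cgrad u z‖ ≤ 2 * ‖fderiv ℝ u z‖ := by
  have h1 := (fderiv ℝ u z).le_opNorm 1
  have h2 := (fderiv ℝ u z).le_opNorm Complex.I
  simp at h1 h2
  have := norm_le_abs (cgrad u z)
  simp only [cgrad] at this ⊢
  linarith

lemma Aop_cont {p : ℝ} (hp : 2 < p) : Continuous (Aop p) := by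
  unfold Aop
  exact (continuous_norm.rpow_const fun z => Or.inr (by linarith)).smul continuous_id

lemma Aop_eq_Fm {p t : ℝ} (ht : 0 < t) {z : ℂ} (hz : t ≤ ‖z‖) : Aop p z = Fm (p - 1) t z := by
  unfold Aop Fm wf
  rw [zt_one (by rw [le_div_iff₀ (by positivity)]; nlinarith), sq_rpow_half (ht.trans_le hz)]
  rw [mul_one]; congr 2; ring

lemma Fm_id_contDiff {b t : ℝ} (ht : 0 < t) : ContDiff ℝ 2 (Fm b t) :=
  Fm_contDiff ht le_rfl contDiff_id

lemma trace_Fm {p t : ℝ} (ht : 0 < t) {z : ℂ} (hz : t ≤ ‖z‖) (H : ℂ →L[ℝ] ℂ) :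
    (fderiv ℝ (Fm (p - 1) t) z (H 1)).re + (fderiv ℝ (Fm (p - 1) t) z (H Complex.I)).im = gt p z H := by
  have hz0 : 0 < ‖z‖ := ht.trans_le hz
  have h := fun v => Fm_fderiv (b := p - 1) ht (contDiff_id (𝕜 := ℝ) (E := ℂ) (n := 1)) z v
  simp only [fderiv_id, id] at h
  have hw := wf_deriv (b := p - 1) ht (q := ‖z‖ ^ 2) (by positivity)
  have h1 : 1 ≤ ‖z‖ ^ 2 / t ^ 2 := by rw [le_div_iff₀ (by positivity)]; nlinarith
  have hwv : wf (p - 1) t (‖z‖ ^ 2) = ‖z‖ ^ (p - 2) := by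
    unfold wf
    rw [zt_one h1, sq_rpow_half hz0]; rw [mul_one]; congr 1; ring
  rw [zt_one h1, zt_deriv_zero' h1, sq_rpow_half hz0, hwv] at hw
  rw [show p - 1 - 1 = p - 2 by ring] at hw
  have hw2 : 2 * deriv (wf (p - 1) t) (‖z‖ ^ 2) = (p - 2) * ‖z‖ ^ (p - 2) / ‖z‖ ^ 2 := by
    field_simp
    linarith
  have e1 := H_apply H z
  rw [show (fderiv ℝ (Fm (p - 1) t) z (H 1)) = _ from h (H 1), show (fderiv ℝ (Fm (p - 1) t) z (H Complex.I)) = _ from h (H Complex.I), gt, DFv, DFv, hwv, hw2, e1]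
  simp only [ContinuousLinearMap.id_apply, dot, Complex.add_re, Complex.add_im, Complex.real_smul, Complex.mul_re, Complex.mul_im,
    Complex.ofReal_re, Complex.ofReal_im]
  field_simp
  ring

lemma mono_A {p : ℝ} (hp : 2 < p) (a b : ℂ) :
    (1 / 2) * ‖a‖ ^ (p - 2) * ‖b - a‖ ^ 2 ≤ dot (Aop p b - Aop p a) (b - a) := by
  have e : dot (Aop p b - Aop p a) (b - a) = 1 / 2 * (‖a‖ ^ (p - 2) + ‖b‖ ^ (p - 2)) * ‖b - a‖ ^ 2 +
      1 / 2 * ((‖b‖ ^ (p - 2) - ‖a‖ ^ (p - 2)) * (‖b‖ ^ 2 - ‖a‖ ^ 2)) := by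
    rw [norm_sq_eq (b - a)]
    have := norm_sq_eq a
    have := norm_sq_eq b
    simp only [dot, Aop, Complex.sub_re, Complex.sub_im, Complex.smul_re, Complex.smul_im, smul_eq_mul]
    rw [norm_sq_eq a, norm_sq_eq b]
    ring
  have h2 : 0 ≤ (‖b‖ ^ (p - 2) - ‖a‖ ^ (p - 2)) * (‖b‖ ^ 2 - ‖a‖ ^ 2) := by
    rcases le_total ‖a‖ ‖b‖ with h | h
    · exact mul_nonneg (sub_nonneg.2 (rpow_le_rpow (norm_nonneg _) h (by linarith)))
        (sub_nonneg.2 (pow_le_pow_left₀ (norm_nonneg _) h 2))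
    · exact mul_nonneg_of_nonpos_of_nonpos (sub_nonpos.2 (rpow_le_rpow (norm_nonneg _) h (by linarith)))
        (sub_nonpos.2 (pow_le_pow_left₀ (norm_nonneg _) h 2))
  rw [e]
  have h3 : 0 ≤ ‖b‖ ^ (p - 2) * ‖b - a‖ ^ 2 := by positivity
  nlinarith

/-- mollifier at scale ε -/
structure Mol (ε M : ℝ) (k : ℂ → ℝ) : Prop where
  smooth : ContDiff ℝ (⊤ : ℕ∞) k
  nonneg : ∀ y, 0 ≤ k y
  zero : ∀ y, ε ≤ ‖y‖ → k y = 0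
  int : ∫ y, k y = 1
  bound : ∀ y, ‖cgrad k y‖ ≤ M / ε ^ 3

lemma exists_mol : ∃ M, 0 ≤ M ∧ ∀ ε, 0 < ε → ∃ k, Mol ε M k := by
  let φ : ContDiffBump (0 : ℂ) := ⟨1/2, 1, by norm_num, by norm_num⟩
  set ρ : ℂ → ℝ := φ.normed volume with hρ
  have hs : ContDiff ℝ (⊤ : ℕ∞) ρ := φ.contDiff_normed
  have hc : HasCompactSupport ρ := φ.hasCompactSupport_normed
  have hs1 : ContDiff ℝ 1 ρ := hs.of_le (by exact_mod_cast le_top)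
  have hfc : Continuous (fderiv ℝ ρ) := hs1.continuous_fderiv (by norm_num)
  obtain ⟨M, hM⟩ := hfc.bounded_above_of_compact_support (hc.fderiv ℝ)
  have hM0 : 0 ≤ M := (norm_nonneg _).trans (hM 0)
  refine ⟨2 * M, by positivity, fun ε hε => ⟨fun y => (ε ^ 2)⁻¹ * ρ (ε⁻¹ • y), ?_, ?_, ?_, ?_, ?_⟩⟩
  · exact contDiff_const.mul (hs.comp (contDiff_const_smul _))
  · intro y; exact mul_nonneg (by positivity) (φ.nonneg_normed _)
  · intro y hy
    have : ρ (ε⁻¹ • y) = 0 := by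
      have hsup : Function.support ρ = ball 0 1 := φ.support_normed_eq
      rw [← Function.notMem_support, hsup, mem_ball, dist_zero_right, not_lt, norm_smul, norm_inv,
        Real.norm_of_nonneg hε.le, ← div_eq_inv_mul, le_div_iff₀ hε]
      linarith
    simp only [this, mul_zero]
  · rw [integral_const_mul, Measure.integral_comp_smul]
    rw [φ.integral_normed, Complex.finrank_real_complex, smul_eq_mul, mul_one, abs_of_pos (by positivity)]
    field_simp
  · intro y
    have hd : HasFDerivAt (fun y => (ε ^ 2)⁻¹ * ρ (ε⁻¹ • y))
        ((ε ^ 2)⁻¹ • (fderiv ℝ ρ (ε⁻¹ • y)).comp (ε⁻¹ • ContinuousLinearMap.id ℝ ℂ)) y := by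
      apply HasFDerivAt.const_mul
      exact ((hs1.differentiable (by norm_num)) _).hasFDerivAt.comp y ((hasFDerivAt_id y).const_smul ε⁻¹)
    refine (norm_cgrad_le _ _).trans ?_
    rw [hd.fderiv]
    have h1 : ‖(ε ^ 2)⁻¹ • (fderiv ℝ ρ (ε⁻¹ • y)).comp (ε⁻¹ • ContinuousLinearMap.id ℝ ℂ)‖ ≤ M / ε ^ 3 := by
      rw [norm_smul, ContinuousLinearMap.comp_smul, norm_smul, ContinuousLinearMap.comp_id, norm_inv, norm_inv,
        Real.norm_of_nonneg hε.le, Real.norm_of_nonneg (by positivity : (0:ℝ) ≤ ε ^ 2)]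
      have := hM (ε⁻¹ • y)
      calc _ ≤ (ε ^ 2)⁻¹ * (ε⁻¹ * M) := by gcongr
        _ = _ := by field_simp
    calc _ ≤ 2 * (M / ε ^ 3) := by gcongr
      _ = _ := by ring

lemma Mol.compact {ε M : ℝ} {k : ℂ → ℝ} (h : Mol ε M k) : HasCompactSupport k := by
  refine HasCompactSupport.of_support_subset_isCompact (isCompact_closedBall (0:ℂ) ε) ?_
  intro z hz
  rw [mem_closedBall, dist_zero_right]
  by_contra hh
  exact hz (h.zero z (not_le.1 hh).le)

lemma Mol.smooth1 {ε M : ℝ} {k : ℂ → ℝ} (h : Mol ε M k) : ContDiff ℝ 1 k :=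
  h.smooth.of_le (by exact_mod_cast le_top)

/-- convolution -/
def cv {V : Type*} [NormedAddCommGroup V] [NormedSpace ℝ V] (k : ℂ → ℝ) (g : ℂ → V) (x : ℂ) : V :=
  ∫ t, k t • g (x - t)

section
variable {V : Type*} [NormedAddCommGroup V] [NormedSpace ℝ V] [CompleteSpace V]

lemma cv_eq (k : ℂ → ℝ) (g : ℂ → V) : cv k g = convolution k g (ContinuousLinearMap.lsmul ℝ ℝ) volume := rfl

lemma cv_smooth {ε M : ℝ} {k : ℂ → ℝ} (h : Mol ε M k) {g : ℂ → V} (hg : Continuous g) :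
    ContDiff ℝ (⊤ : ℕ∞) (cv k g) :=
  h.compact.contDiff_convolution_left (ContinuousLinearMap.lsmul ℝ ℝ) h.smooth (hg.locallyIntegrable (μ := volume))

lemma cv_fderiv {ε M : ℝ} {k : ℂ → ℝ} (h : Mol ε M k) {g : ℂ → V} (hg : Continuous g) (x v : ℂ) :
    fderiv ℝ (cv k g) x v = ∫ t, fderiv ℝ k t v • g (x - t) := by
  have hd := h.compact.hasFDerivAt_convolution_left (ContinuousLinearMap.lsmul ℝ ℝ) h.smooth1
    (hg.locallyIntegrable (μ := volume)) x
  rw [cv_eq, hd.fderiv]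
  have hfc : Continuous (fderiv ℝ k) := h.smooth1.continuous_fderiv (by norm_num)
  rw [convolution]
  rw [ContinuousLinearMap.integral_apply]
  · rfl
  · exact ((h.compact.fderiv ℝ).convolutionExists_left _ hfc hg.locallyIntegrable x).integrable

lemma cv_close {ε M σ : ℝ} {k : ℂ → ℝ} (h : Mol ε M k) {g : ℂ → V} (hg : Continuous g) (x : ℂ)
    (hx : ∀ t, ‖t‖ ≤ ε → ‖g (x - t) - g x‖ ≤ σ) : ‖cv k g x - g x‖ ≤ σ := by
  have hk := h.smooth.continuous
  have hki : Integrable k := hk.integrable_of_hasCompactSupport h.compact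
  have e : cv k g x - g x = ∫ t, k t • (g (x - t) - g x) := by
    have : g x = ∫ t, k t • g x := by rw [integral_smul_const, h.int, one_smul]
    rw [cv]
    conv_lhs => rw [this]
    rw [← integral_sub]
    · congr 1; ext t; rw [smul_sub]
    · exact (hk.smul (by fun_prop)).integrable_of_hasCompactSupport h.compact.smul_right
    · exact (hk.smul (by fun_prop)).integrable_of_hasCompactSupport h.compact.smul_right
  rw [e]
  have : ‖∫ t, k t • (g (x - t) - g x)‖ ≤ ∫ t, k t * σ := by
    apply norm_integral_le_of_norm_le (hki.mul_const _)
    filter_upwards with t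
    rw [norm_smul, Real.norm_of_nonneg (h.nonneg t)]
    rcases le_total ε ‖t‖ with ht | ht
    · rw [h.zero t ht]; simp
    · exact mul_le_mul_of_nonneg_left (hx t ht) (h.nonneg t)
  rwa [integral_mul_const, h.int, one_mul] at this
end

end PLap

namespace PLap

lemma cv_cgrad {ε M : ℝ} {k : ℂ → ℝ} (h : Mol ε M k) {u : ℂ → ℝ} (hu : ContDiff ℝ 1 u) (x : ℂ) :
    cgrad (cv k u) x = cv k (cgrad u) x := by
  have hk := h.smooth.continuous
  have key : ∀ v : ℂ, fderiv ℝ (cv k u) x v = ∫ t, k t * fderiv ℝ u (x - t) v := by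
    intro v
    rw [cv_fderiv h hu.continuous]
    have hg : ContDiff ℝ 1 fun t => u (x - t) := hu.comp (by fun_prop)
    have := ibp k (fun t => u (x - t)) h.smooth1 h.compact hg v
    have e : ∀ t, fderiv ℝ (fun t => u (x - t)) t v = -fderiv ℝ u (x - t) v := by
      intro t
      have hd : HasFDerivAt (fun t => u (x - t)) ((fderiv ℝ u (x - t)).comp (-(ContinuousLinearMap.id ℝ ℂ))) t :=
        ((hu.differentiable (by norm_num)) _).hasFDerivAt.comp t ((hasFDerivAt_id t).const_sub x)
      rw [hd.fderiv]; simp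
    simp only [e, mul_neg, integral_neg, neg_inj] at this
    rw [this]; rfl
  have hi : Integrable fun t => k t • cgrad u (x - t) :=
    (hk.smul ((cgrad_cont hu).comp (by fun_prop))).integrable_of_hasCompactSupport h.compact.smul_right
  apply Complex.ext
  · have := Complex.reCLM.integral_comp_comm hi
    simp only [Complex.reCLM_apply, Complex.smul_re, smul_eq_mul] at this
    rw [cv, ← this]
    exact key 1
  · have := Complex.imCLM.integral_comp_comm hi
    simp only [Complex.imCLM_apply, Complex.smul_im, smul_eq_mul] at this
    rw [cv, ← this]
    exact key Complex.I

lemma int_ball {f : ℂ → ℝ} {R : ℝ} (h0 : ∀ z, R < ‖z‖ → f z = 0) :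
    ∫ z in closedBall 0 R, f z = ∫ z, f z := by
  apply setIntegral_eq_integral_of_forall_compl_eq_zero
  intro z hz
  apply h0
  rwa [mem_closedBall, dist_zero_right, not_le] at hz

lemma int_bound {f : ℂ → ℝ} {R c : ℝ} (h0 : ∀ z, R < ‖z‖ → f z = 0) (hc : ∀ z, ‖z‖ ≤ R → |f z| ≤ c) :
    |∫ z, f z| ≤ c * volume.real (closedBall (0:ℂ) R) := by
  rw [← int_ball h0, ← Real.norm_eq_abs]
  apply norm_setIntegral_le_of_norm_le_const (isCompact_closedBall _ _).measure_lt_top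
  intro z hz
  rw [mem_closedBall, dist_zero_right] at hz
  exact hc z hz

lemma compact_of_zero {V : Type*} [Zero V] {f : ℂ → V} {R : ℝ} (h0 : ∀ z, R < ‖z‖ → f z = 0) : HasCompactSupport f := by
  refine HasCompactSupport.of_support_subset_isCompact (isCompact_closedBall (0:ℂ) R) ?_
  intro z hz
  rw [mem_closedBall, dist_zero_right]
  by_contra hh
  exact hz (h0 z (not_le.1 hh))

lemma integrable_of_zero {V : Type*} [NormedAddCommGroup V] {f : ℂ → V} {R : ℝ} (hf : Continuous f) (h0 : ∀ z, R < ‖z‖ → f z = 0) :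
    Integrable f := hf.integrable_of_hasCompactSupport (compact_of_zero h0)

lemma tsupport_of_zero {V : Type*} [Zero V] {f : ℂ → V} {R : ℝ} (h0 : ∀ z, R < ‖z‖ → f z = 0) : tsupport f ⊆ closedBall 0 R := by
  apply closure_minimal _ isClosed_closedBall
  intro z hz
  rw [mem_closedBall, dist_zero_right]
  by_contra hh
  exact hz (h0 z (not_le.1 hh))

lemma cgrad_zero {g : ℂ → ℝ} {s : ℝ} (hs : ∀ z, s < ‖z‖ → g z = 0) {z : ℂ} (hz : s < ‖z‖) : cgrad g z = 0 := by
  have : g =ᶠ[nhds z] fun _ => 0 := by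
    filter_upwards [(isOpen_lt continuous_const continuous_norm).mem_nhds hz] with y hy
    exact hs y hy
  rw [cgrad, this.fderiv_eq]
  simp; rfl

lemma unif_cont {V : Type*} [NormedAddCommGroup V] {g : ℂ → V} (hg : Continuous g) (R σ : ℝ) (hσ : 0 < σ) :
    ∃ ε > 0, ∀ x t, ‖x‖ ≤ R → ‖t‖ ≤ ε → ‖g (x - t) - g x‖ ≤ σ := by
  have := (isCompact_closedBall (0:ℂ) (R + 1)).uniformContinuousOn_of_continuous hg.continuousOn
  rw [Metric.uniformContinuousOn_iff] at this
  obtain ⟨ε, hε, h⟩ := this σ hσ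
  refine ⟨min (ε / 2) 1, by positivity, fun x t hx ht => ?_⟩
  have h1 : ‖t‖ ≤ 1 := ht.trans (min_le_right _ _)
  have h2 : ‖t‖ < ε := by have := ht.trans (min_le_left _ _); linarith
  have := h (x - t) (by rw [mem_closedBall, dist_zero_right]; exact (norm_sub_le _ _).trans (by linarith)) x
    (by rw [mem_closedBall, dist_zero_right]; linarith) (by rw [dist_eq_norm]; simpa using h2)
  rw [dist_eq_norm] at this
  exact this.le

lemma test_C1 {p R δ s : ℝ} (hp : 2 < p) (hδ : 0 ≤ δ) {u : ℂ → ℝ} (hu : Sol p R δ u) (hsR : s < R) (hs0 : 0 ≤ s)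
    {g : ℂ → ℝ} (hg : ContDiff ℝ 1 g) (hgs : ∀ z, s < ‖z‖ → g z = 0) :
    |∫ z, dot (Aop p (cgrad u z)) (cgrad g z)| ≤ δ * ∫ z, |g z| := by
  set W := fun z => Aop p (cgrad u z) with hW
  change |∫ z, dot (W z) (cgrad g z)| ≤ _
  have hWc : Continuous W := (Aop_cont hp).comp (cgrad_cont hu.1)
  have hGc := cgrad_cont hg
  obtain ⟨N, hN⟩ := (isCompact_closedBall (0:ℂ) R).exists_bound_of_continuousOn hWc.continuousOn
  have hN0 : 0 ≤ N := (norm_nonneg _).trans (hN 0 (by simp; linarith))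
  set Vb := volume.real (closedBall (0:ℂ) R) with hVb
  have hV0 : 0 ≤ Vb := measureReal_nonneg
  obtain ⟨M, hM, hmol⟩ := exists_mol
  have hgR : ∀ z, R < ‖z‖ → g z = 0 := fun z hz => hgs z (hsR.trans hz)
  have hGR : ∀ z, R < ‖z‖ → cgrad g z = 0 := fun z hz => cgrad_zero hgR hz
  have claim : ∀ σ > 0, |∫ z, dot (W z) (cgrad g z)| ≤ δ * (∫ z, |g z|) + σ * (δ * Vb + N * Vb) := by
    intro σ hσ
    obtain ⟨ε1, hε1, h1⟩ := unif_cont hg.continuous R σ hσ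
    obtain ⟨ε2, hε2, h2⟩ := unif_cont hGc R σ hσ
    set ε := min (min ε1 ε2) ((R - s) / 2) with hε
    have hε0 : 0 < ε := by
      have : 0 < R - s := by linarith
      positivity
    have l1 : ε ≤ ε1 := (min_le_left _ _).trans (min_le_left _ _)
    have l2 : ε ≤ ε2 := (min_le_left _ _).trans (min_le_right _ _)
    have l3 : ε ≤ (R - s) / 2 := min_le_right _ _
    obtain ⟨k, hk⟩ := hmol ε hε0
    have z1 : ∀ z, s + ε < ‖z‖ → cv k g z = 0 := by
      intro z hz
      rw [cv, ← integral_zero ℂ ℝ]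
      congr 1; ext t
      rcases le_total ε ‖t‖ with h | h
      · rw [hk.zero t h]; simp
      · rw [hgs, smul_zero]
        have := norm_sub_norm_le z t
        linarith
    have zR : ∀ z, R < ‖z‖ → cv k g z = 0 := fun z hz => z1 z (by linarith)
    have zGR : ∀ z, R < ‖z‖ → cgrad (cv k g) z = 0 := fun z hz => cgrad_zero zR hz
    have hsm := cv_smooth hk hg.continuous
    have hsm1 : ContDiff ℝ 1 (cv k g) := hsm.of_le (by exact_mod_cast le_top)
    have hGc' := cgrad_cont hsm1
    have t1 : |∫ z, dot (W z) (cgrad (cv k g) z)| ≤ δ * ∫ z, |cv k g z| := hu.2 (cv k g) hsm (compact_of_zero z1) ((tsupport_of_zero z1).trans (closedBall_subset_ball (by linarith)))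
    have c1 : ∀ z, ‖z‖ ≤ R → ‖cv k g z - g z‖ ≤ σ := fun z hz => cv_close hk hg.continuous z fun t ht => h1 z t hz (ht.trans l1)
    have c2 : ∀ z, ‖z‖ ≤ R → ‖cgrad (cv k g) z - cgrad g z‖ ≤ σ := fun z hz => by
      rw [cv_cgrad hk hg]; exact cv_close hk hGc z fun t ht => h2 z t hz (ht.trans l2)
    have i1 : Integrable fun z => dot (W z) (cgrad g z) :=
      integrable_of_zero (R := R) (by fun_prop) (fun z hz => by rw [hGR z hz]; simp [dot])
    have i2 : Integrable fun z => dot (W z) (cgrad (cv k g) z) :=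
      integrable_of_zero (R := R) (by fun_prop) (fun z hz => by rw [zGR z hz]; simp [dot])
    have j1 : Integrable fun z => |g z| :=
      integrable_of_zero (R := R) hg.continuous.abs (fun z hz => by rw [hgR z hz]; simp)
    have j2 : Integrable fun z => |cv k g z| :=
      integrable_of_zero (R := R) hsm.continuous.abs (fun z hz => by rw [zR z hz]; simp)
    have d1 : |(∫ z, dot (W z) (cgrad (cv k g) z)) - ∫ z, dot (W z) (cgrad g z)| ≤ (N * σ) * Vb := by
      rw [← integral_sub i2 i1]
      apply int_bound
      · intro z hz; rw [hGR z hz, zGR z hz]; simp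
      · intro z hz
        have : dot (W z) (cgrad (cv k g) z) - dot (W z) (cgrad g z) = dot (W z) (cgrad (cv k g) z - cgrad g z) := by
          simp [dot]; ring
        rw [this]
        exact (abs_dot_le _ _).trans (mul_le_mul (hN z (by simpa using hz)) (c2 z hz) (norm_nonneg _) hN0)
    have d2 : |(∫ z, |cv k g z|) - (∫ z, |g z|)| ≤ σ * Vb := by
      rw [← integral_sub j2 j1]
      apply int_bound
      · intro z hz; rw [hgR z hz, zR z hz]; simp
      · intro z hz
        exact (abs_abs_sub_abs_le_abs_sub _ _).trans (c1 z hz)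
    rw [abs_le] at d1 d2 t1
    have d3 : δ * ∫ z, |cv k g z| ≤ δ * (∫ z, |g z|) + δ * (σ * Vb) := by
      rw [← mul_add]; exact mul_le_mul_of_nonneg_left (by linarith [d2.2]) hδ
    rw [abs_le]
    constructor
    · linarith [t1.1, d1.2]
    · linarith [t1.2, d1.1]
  by_contra hcon
  push Not at hcon
  set X := δ * Vb + N * Vb with hX
  have hX0 : 0 ≤ X := by positivity
  set Y := |∫ z, dot (W z) (cgrad g z)| - δ * ∫ z, |g z| with hY
  have hY0 : 0 < Y := by linarith
  have := claim (Y / (2 * (X + 1))) (by positivity)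
  have e : Y / (2 * (X + 1)) * X ≤ Y / 2 := by
    rw [div_mul_eq_mul_div, div_le_div_iff₀ (by positivity) (by positivity)]
    nlinarith
  linarith

lemma L1_shift {ψ : ℂ → ℝ} (hψ : ContDiff ℝ 1 ψ) {R : ℝ} (h0 : ∀ z, R < ‖z‖ → ψ z = 0) (h : ℂ) :
    ∫ z, |ψ (z - h) - ψ z| ≤ ‖h‖ * ∫ z, ‖cgrad ψ z‖ := by
  have hG := cgrad_cont hψ
  have hψc := hψ.continuous
  have hGi : Integrable fun z => ‖cgrad ψ z‖ :=
    integrable_of_zero hG.norm (R := R) fun z hz => by rw [cgrad_zero h0 hz]; simp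
  have pt : ∀ z, |ψ (z - h) - ψ z| ≤ ‖h‖ * ∫ s in (0:ℝ)..1, ‖cgrad ψ (z + -(s • h))‖ := by
    intro z
    have hd : ∀ s : ℝ, HasDerivAt (fun s : ℝ => ψ (z + -(s • h))) (fderiv ℝ ψ (z + -(s • h)) (-h)) s := by
      intro s
      have h2 : HasDerivAt (fun s : ℝ => z + -(s • h)) (-h) s := by
        have := (((hasDerivAt_id s).smul_const h).neg).const_add z
        simpa using this
      exact ((hψ.differentiable (by norm_num)) _).hasFDerivAt.comp_hasDerivAt s h2
    have hc : Continuous fun s : ℝ => fderiv ℝ ψ (z + -(s • h)) (-h) :=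
      ((hψ.continuous_fderiv (by norm_num)).comp (by fun_prop)).clm_apply continuous_const
    have e := intervalIntegral.integral_eq_sub_of_hasDerivAt (a := 0) (b := 1) (fun s _ => hd s) (hc.intervalIntegrable _ _)
    have e2 : ψ (z - h) - ψ z = ∫ s in (0:ℝ)..1, fderiv ℝ ψ (z + -(s • h)) (-h) := by
      rw [e]; simp [sub_eq_add_neg]
    rw [e2, ← intervalIntegral.integral_const_mul]
    refine (intervalIntegral.norm_integral_le_integral_norm (f := fun s : ℝ => fderiv ℝ ψ (z + -(s • h)) (-h)) zero_le_one).trans ?_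
    apply intervalIntegral.integral_mono_on zero_le_one (hc.norm.intervalIntegrable _ _)
    · apply Continuous.intervalIntegrable; fun_prop
    · intro s _
      rw [fderiv_apply_dot, Real.norm_eq_abs, mul_comm]
      refine (abs_dot_le _ _).trans (by rw [norm_neg])
  have hsw : Integrable (Function.uncurry fun (z : ℂ) (s : ℝ) => ‖cgrad ψ (z + -(s • h))‖)
      (volume.prod (volume.restrict (Set.Ioc (0:ℝ) 1))) := by
    rw [integrable_prod_iff']
    · constructor
      · filter_upwards with s
        exact hGi.comp_add_right (-(s • h))
      · have : (fun s : ℝ => ∫ z, ‖Function.uncurry (fun (z : ℂ) (s : ℝ) => ‖cgrad ψ (z + -(s • h))‖) (z, s)‖) =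
            fun _ => ∫ z, ‖cgrad ψ z‖ := by
          ext s
          simp only [Function.uncurry, norm_norm]
          exact integral_add_right_eq_self (fun z => ‖cgrad ψ z‖) (-(s • h))
        rw [this]
        exact integrable_const _
    · apply Continuous.aestronglyMeasurable
      unfold Function.uncurry
      fun_prop
  have hsw' := integral_integral_swap hsw
  have h_intg : ∫ z, ∫ s in (0:ℝ)..1, ‖cgrad ψ (z + -(s • h))‖ = ∫ z, ‖cgrad ψ z‖ := by
    simp only [intervalIntegral.integral_of_le zero_le_one]
    rw [hsw']
    have : ∀ s : ℝ, ∫ z, ‖cgrad ψ (z + -(s • h))‖ = ∫ z, ‖cgrad ψ z‖ := fun s =>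
      integral_add_right_eq_self (fun z => ‖cgrad ψ z‖) (-(s • h))
    simp only [this]
    simp
  rw [← h_intg, ← integral_const_mul]
  apply integral_mono
  · apply integrable_of_zero (R := R + ‖h‖) (by fun_prop)
    intro z hz
    have := norm_sub_norm_le z h
    rw [h0 z (by linarith [norm_nonneg h]), h0 (z - h) (by linarith)]; simp
  · have := hsw.integral_prod_left.const_mul ‖h‖
    simpa only [Function.uncurry, intervalIntegral.integral_of_le zero_le_one] using this
  · exact pt

end PLap

namespace PLap

lemma dot_comb (w x y : ℂ) (a b : ℝ) : dot w (a • x + b • y) = a * dot w x + b * dot w y := by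
  simp only [dot, Complex.add_re, Complex.add_im, Complex.smul_re, Complex.smul_im, smul_eq_mul]; ring

lemma cgrad_sub {f g : ℂ → ℝ} (hf : ContDiff ℝ 1 f) (hg : ContDiff ℝ 1 g) (z : ℂ) :
    cgrad (fun z => f z - g z) z = cgrad f z - cgrad g z := by
  unfold cgrad
  rw [fderiv_fun_sub (hf.differentiable (by norm_num) z) (hg.differentiable (by norm_num) z)]
  apply Complex.ext <;> simp

lemma cgrad_shift {f : ℂ → ℝ} (hf : ContDiff ℝ 1 f) (h z : ℂ) :
    cgrad (fun z => f (z + h)) z = cgrad f (z + h) := by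
  unfold cgrad
  rw [fderiv_comp_add_right]

lemma cgrad_mul {f g : ℂ → ℝ} (hf : ContDiff ℝ 1 f) (hg : ContDiff ℝ 1 g) (z : ℂ) :
    cgrad (fun z => f z * g z) z = (f z) • cgrad g z + (g z) • cgrad f z := by
  unfold cgrad
  rw [fderiv_fun_mul (hf.differentiable (by norm_num) z) (hg.differentiable (by norm_num) z)]
  apply Complex.ext <;> simp

lemma cgrad_sqmul {η v : ℂ → ℝ} (hη : ContDiff ℝ 1 η) (hv : ContDiff ℝ 1 v) (z : ℂ) :
    cgrad (fun z => η z ^ 2 * v z) z = (η z ^ 2) • cgrad v z + (2 * η z * v z) • cgrad η z := by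
  have e : (fun z => η z ^ 2) = fun z => η z * η z := by ext z; ring
  rw [cgrad_mul (hη.pow 2) hv]
  change _ + v z • cgrad (fun z => η z ^ 2) z = _
  rw [e, cgrad_mul hη hη]
  module

lemma lip_Fm {b t L : ℝ} (ht : 0 < t) (hL : 0 ≤ L) : ∃ Λ, 0 ≤ Λ ∧ ∀ a b' : ℂ, ‖a‖ ≤ L → ‖b'‖ ≤ L →
    ‖Fm b t a - Fm b t b'‖ ≤ Λ * ‖a - b'‖ := by
  have h2 := Fm_id_contDiff (b := b) ht
  have hfc : Continuous (fderiv ℝ (Fm b t)) := h2.continuous_fderiv (by norm_num)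
  obtain ⟨Λ, hΛ⟩ := (isCompact_closedBall (0:ℂ) L).exists_bound_of_continuousOn hfc.continuousOn
  refine ⟨Λ, (norm_nonneg _).trans (hΛ 0 (by simpa using hL)), fun a b' ha hb => ?_⟩
  exact (convex_closedBall (0:ℂ) L).norm_image_sub_le_of_norm_fderiv_le
    (fun x _ => h2.differentiable (by norm_num) x) (fun x hx => hΛ x hx) (by simpa using hb) (by simpa using ha)

lemma lip_u {u : ℂ → ℝ} (hu : ContDiff ℝ 1 u) {L R : ℝ} {x0 : ℂ} (hL : ∀ z ∈ closedBall x0 R, ‖cgrad u z‖ ≤ L) {a b : ℂ}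
    (ha : a ∈ closedBall x0 R) (hb : b ∈ closedBall x0 R) : |u a - u b| ≤ L * ‖a - b‖ :=
  (convex_closedBall x0 R).norm_image_sub_le_of_norm_fderiv_le
    (fun x _ => hu.differentiable (by norm_num) x)
    (fun x hx => (norm_fderiv_le u x).trans (hL x hx)) hb ha

lemma dq_alg {c δ h L Λ N e D : ℝ} (hc : 0 < c) (hδ : 0 ≤ δ) (hh : 0 ≤ h) (hL : 0 ≤ L)
    (hN : 0 ≤ N) (he : 0 ≤ e) (he1 : e ≤ 1) (hD : 0 ≤ D) :
    δ * h * (e ^ 2 * D + 2 * e * (L * h) * N) + 2 * e * (L * h) * (Λ * D) * N ≤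
      c / 2 * (e ^ 2 * D ^ 2) + (δ ^ 2 / c + 2 * δ * L * N + 4 * (L * Λ * N) ^ 2 / c) * h ^ 2 := by
  have a1 : δ * h * (e ^ 2 * D) ≤ δ * h * (e * D) := by
    have : e ^ 2 * D ≤ e * D := by
      have : 0 ≤ e * D * (1 - e) := mul_nonneg (by positivity) (by linarith)
      nlinarith
    gcongr
  have a2 : δ * h * (e * D) ≤ c / 4 * (e * D) ^ 2 + δ ^ 2 / c * h ^ 2 := by
    have : 0 ≤ (c / 2 * (e * D) - δ * h) ^ 2 / c := by positivity
    have e1 : (c / 2 * (e * D) - δ * h) ^ 2 / c = c / 4 * (e * D) ^ 2 + δ ^ 2 / c * h ^ 2 - δ * h * (e * D) := by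
      field_simp; ring
    linarith
  have a3 : 2 * e * (L * h) * (Λ * D) * N ≤ c / 4 * (e * D) ^ 2 + 4 * (L * Λ * N) ^ 2 / c * h ^ 2 := by
    have : 0 ≤ (c / 2 * (e * D) - 2 * (L * Λ * N) * h) ^ 2 / c := by positivity
    have e1 : (c / 2 * (e * D) - 2 * (L * Λ * N) * h) ^ 2 / c = c / 4 * (e * D) ^ 2 + 4 * (L * Λ * N) ^ 2 / c * h ^ 2
      - 2 * e * (L * h) * (Λ * D) * N := by
      field_simp; ring
    linarith
  have a4 : δ * h * (2 * e * (L * h) * N) ≤ 2 * δ * L * N * h ^ 2 := by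
    have : 0 ≤ 2 * δ * L * N * h ^ 2 * (1 - e) := mul_nonneg (by positivity) (by linarith)
    nlinarith
  nlinarith

set_option maxHeartbeats 2000000 in
lemma DQ {p δ τ : ℝ} (hp : 2 < p) (hδ : 0 ≤ δ) (hτ : 0 < τ) {u η : ℂ → ℝ} (hu : Sol p 2 δ u)
    (hη : ContDiff ℝ 1 η) (hη01 : ∀ z, 0 ≤ η z ∧ η z ≤ 1)
    (hsup : ∀ z, η z ≠ 0 → τ < ‖cgrad u z‖ ∧ ‖z‖ < 3 / 2) :
    ∃ h0 > 0, ∃ C, 0 ≤ C ∧ ∀ h : ℂ, ‖h‖ ≤ h0 →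
      ∫ x, η x ^ 2 * ‖cgrad u (x + h) - cgrad u x‖ ^ 2 ≤ C * ‖h‖ ^ 2 := by
  have hZc := cgrad_cont hu.1
  obtain ⟨L, hL⟩ := (isCompact_closedBall (0:ℂ) 3).exists_bound_of_continuousOn hZc.continuousOn
  have hL0 : 0 ≤ L := (norm_nonneg _).trans (hL 0 (by simp))
  have hηz : ∀ z, 3 / 2 < ‖z‖ → η z = 0 := fun z hz => by
    by_contra hh; have := (hsup z hh).2; linarith
  have hηc := hη.continuous
  have hηG := cgrad_cont hη
  obtain ⟨N, hN⟩ := hηG.bounded_above_of_compact_support (compact_of_zero (R := 3/2) fun z hz => cgrad_zero hηz hz)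
  have hN0 : 0 ≤ N := (norm_nonneg _).trans (hN 0)
  obtain ⟨Λ, hΛ0, hΛ⟩ := lip_Fm (b := p - 1) (half_pos hτ) hL0
  obtain ⟨ε, hε, hunif⟩ := unif_cont hZc 2 (τ / 2) (half_pos hτ)
  set c := 1 / 2 * τ ^ (p - 2) with hc
  have hc0 : 0 < c := by positivity
  set Vb := volume.real (closedBall (0:ℂ) 2) with hVb
  have hV0 : 0 ≤ Vb := measureReal_nonneg
  set C1 := δ ^ 2 / c + 2 * δ * L * N + 4 * (L * Λ * N) ^ 2 / c with hC1
  have hC10 : 0 ≤ C1 := by positivity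
  refine ⟨min ε (1 / 8), by positivity, 2 / c * (C1 * Vb), by positivity, ?_⟩
  intro h hh
  have hhε : ‖h‖ ≤ ε := hh.trans (min_le_left _ _)
  have hh8 : ‖h‖ ≤ 1 / 8 := hh.trans (min_le_right _ _)
  set Z := cgrad u with hZ
  set W := fun z => Aop p (Z z) with hW
  have hWc : Continuous W := (Aop_cont hp).comp hZc
  set v := fun z => u (z + h) - u z with hv
  have hush : ContDiff ℝ 1 fun z => u (z + h) := hu.1.comp (by fun_prop)
  have hvC : ContDiff ℝ 1 v := hush.sub hu.1
  have hvG : ∀ z, cgrad v z = Z (z + h) - Z z := fun z => by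
    rw [hv, cgrad_sub hush hu.1, cgrad_shift hu.1]
  set ψ := fun z => η z ^ 2 * v z with hψ
  have hψC : ContDiff ℝ 1 ψ := (hη.pow 2).mul hvC
  have hψG : ∀ z, cgrad ψ z = (η z ^ 2) • (Z (z + h) - Z z) + (2 * η z * v z) • cgrad η z := fun z => by
    rw [hψ, cgrad_sqmul hη hvC, hvG]
  have hψz : ∀ z, 3 / 2 < ‖z‖ → ψ z = 0 := fun z hz => by simp [hψ, hηz z hz]
  have hψGc := cgrad_cont hψC
  have hψGz : ∀ z, 3 / 2 < ‖z‖ → cgrad ψ z = 0 := fun z hz => cgrad_zero hψz hz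
  -- the test function
  have hψsh : ContDiff ℝ 1 fun z => ψ (z - h) := hψC.comp (by fun_prop)
  have hgz : ∀ z, 7 / 4 < ‖z‖ → (fun z => ψ (z - h) - ψ z) z = 0 := by
    intro z hz
    have := norm_sub_norm_le z h
    simp only
    rw [hψz z (by linarith), hψz (z - h) (by linarith), sub_zero]
  have T := test_C1 hp hδ hu (s := 7 / 4) (by norm_num) (by norm_num) (hψsh.sub hψC) hgz
  have hgG : ∀ z, cgrad (fun z => ψ (z - h) - ψ z) z = cgrad ψ (z - h) - cgrad ψ z := fun z => by
    rw [cgrad_sub hψsh hψC]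
    have := cgrad_shift hψC (-h) z
    simp only [← sub_eq_add_neg] at this
    rw [this]
  change |∫ z, dot (W z) (cgrad (fun z => ψ (z - h) - ψ z) z)| ≤ δ * ∫ z, |ψ (z - h) - ψ z| at T
  simp only [hgG] at T
  have i1 : Integrable fun z => dot (W z) (cgrad ψ (z - h)) := by
    apply integrable_of_zero (R := 7 / 4) (by fun_prop)
    intro z hz
    have := norm_sub_norm_le z h
    rw [hψGz (z - h) (by linarith)]; simp [dot]
  have i2 : Integrable fun z => dot (W z) (cgrad ψ z) := by
    apply integrable_of_zero (R := 3 / 2) (by fun_prop)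
    intro z hz; rw [hψGz z hz]; simp [dot]
  have i3 : Integrable fun z => dot (W (z + h)) (cgrad ψ z) := by
    apply integrable_of_zero (R := 3 / 2) (by fun_prop)
    intro z hz; rw [hψGz z hz]; simp [dot]
  have eq1 : ∫ z, dot (W z) (cgrad ψ (z - h) - cgrad ψ z) = ∫ z, dot (W (z + h) - W z) (cgrad ψ z) := by
    have e1 : ∀ z, dot (W z) (cgrad ψ (z - h) - cgrad ψ z) = dot (W z) (cgrad ψ (z - h)) - dot (W z) (cgrad ψ z) :=
      fun z => by simp [dot]; ring
    have e2 : ∀ z, dot (W (z + h) - W z) (cgrad ψ z) = dot (W (z + h)) (cgrad ψ z) - dot (W z) (cgrad ψ z) :=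
      fun z => by simp [dot]; ring
    simp only [e1, e2]
    rw [integral_sub i1 i2, integral_sub i3 i2]
    congr 1
    rw [← integral_add_right_eq_self (fun z => dot (W z) (cgrad ψ (z - h))) h]
    simp
  rw [eq1] at T
  have S := L1_shift hψC hψz h
  have T2 : ∫ z, dot (W (z + h) - W z) (cgrad ψ z) ≤ δ * ‖h‖ * ∫ z, ‖cgrad ψ z‖ := by
    refine (le_abs_self _).trans (T.trans ?_)
    rw [mul_assoc]; exact mul_le_mul_of_nonneg_left S hδ
  -- pointwise estimates
  set D := fun z => Z (z + h) - Z z with hD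
  have hDc : Continuous D := by fun_prop
  have hclose : ∀ z, ‖z‖ ≤ 2 → ‖D z‖ ≤ τ / 2 := fun z hz => by
    have := hunif z (-h) hz (by rwa [norm_neg])
    simpa [hD] using this
  have hvb : ∀ z, ‖z‖ ≤ 2 → |v z| ≤ L * ‖h‖ := fun z hz => by
    have := lip_u hu.1 hL (a := z + h) (b := z) (by
      rw [mem_closedBall, dist_zero_right]; exact (norm_add_le _ _).trans (by linarith)) (by
      rw [mem_closedBall, dist_zero_right]; linarith)
    simpa using this
  have hWl : ∀ z, η z ≠ 0 → ‖W (z + h) - W z‖ ≤ Λ * ‖D z‖ := fun z hz => by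
    obtain ⟨h1, h2⟩ := hsup z hz
    have h3 := hclose z (by linarith)
    have h4 : τ / 2 ≤ ‖Z (z + h)‖ := by
      have := norm_sub_norm_le (Z z) (Z (z + h))
      rw [norm_sub_rev] at this
      change _ ≤ ‖D z‖ at this
      linarith
    simp only [hW]
    rw [Aop_eq_Fm (half_pos hτ) h4, Aop_eq_Fm (half_pos hτ) (by linarith : τ / 2 ≤ ‖Z z‖)]
    apply hΛ
    · apply hL; rw [mem_closedBall, dist_zero_right]; exact (norm_add_le _ _).trans (by linarith)
    · apply hL; rw [mem_closedBall, dist_zero_right]; linarith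
  have hmono : ∀ z, c * (η z ^ 2 * ‖D z‖ ^ 2) ≤ dot (W (z + h) - W z) (cgrad ψ z) +
      2 * η z * (L * ‖h‖) * (Λ * ‖D z‖) * N := fun z => by
    by_cases hz : η z = 0
    · rw [hψG, hz]; simp [dot]
    · obtain ⟨h1, h2⟩ := hsup z hz
      have h3 := mono_A hp (Z z) (Z (z + h))
      have h4 : τ ^ (p - 2) ≤ ‖Z z‖ ^ (p - 2) := rpow_le_rpow hτ.le h1.le (by linarith)
      have h5 : c * ‖D z‖ ^ 2 ≤ dot (W (z + h) - W z) (D z) := by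
        refine le_trans ?_ h3
        rw [hc]; gcongr
      have h6 : dot (W (z + h) - W z) (cgrad ψ z) = η z ^ 2 * dot (W (z + h) - W z) (D z)
          + 2 * η z * (v z * dot (W (z + h) - W z) (cgrad η z)) := by
        rw [hψG, dot_comb]; ring
      have h7 : |v z * dot (W (z + h) - W z) (cgrad η z)| ≤ (L * ‖h‖) * ((Λ * ‖D z‖) * N) := by
        rw [abs_mul]
        apply mul_le_mul (hvb z (by linarith)) _ (abs_nonneg _) (by positivity)
        exact (abs_dot_le _ _).trans (mul_le_mul (hWl z hz) (hN z) (norm_nonneg _) (by positivity))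
      have h8 := (abs_le.1 h7).1
      have h9 := (hη01 z).1
      have h10 : η z ^ 2 * (c * ‖D z‖ ^ 2) ≤ η z ^ 2 * dot (W (z + h) - W z) (D z) :=
        mul_le_mul_of_nonneg_left h5 (sq_nonneg _)
      have h11 := mul_le_mul_of_nonneg_left h8 (by linarith : 0 ≤ 2 * η z)
      rw [h6]; linarith
  have hgb : ∀ z, ‖cgrad ψ z‖ ≤ η z ^ 2 * ‖D z‖ + 2 * η z * (L * ‖h‖) * N := fun z => by
    by_cases hz : η z = 0
    · rw [hψG, hz]; simp
    · obtain ⟨h1, h2⟩ := hsup z hz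
      have h9 := (hη01 z).1
      rw [hψG]
      refine (norm_add_le _ _).trans (add_le_add ?_ ?_)
      · rw [norm_smul, Real.norm_of_nonneg (sq_nonneg _)]
      · rw [norm_smul, Real.norm_eq_abs, abs_mul, abs_of_nonneg (by positivity : 0 ≤ 2 * η z)]
        have := hvb z (by linarith)
        have := hN z
        gcongr
  -- integrate
  have j1 : Integrable fun z => c * (η z ^ 2 * ‖D z‖ ^ 2) :=
    integrable_of_zero (R := 3 / 2) (by fun_prop) fun z hz => by rw [hηz z hz]; simp
  have j2 : Integrable fun z => dot (W (z + h) - W z) (cgrad ψ z) :=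
    integrable_of_zero (R := 3 / 2) (by fun_prop) fun z hz => by rw [hψGz z hz]; simp [dot]
  have j3 : Integrable fun z => 2 * η z * (L * ‖h‖) * (Λ * ‖D z‖) * N :=
    integrable_of_zero (R := 3 / 2) (by fun_prop) fun z hz => by rw [hηz z hz]; simp
  have j4 : Integrable fun z => ‖cgrad ψ z‖ :=
    integrable_of_zero (R := 3 / 2) (by fun_prop) fun z hz => by rw [hψGz z hz]; simp
  have j5 : Integrable fun z => η z ^ 2 * ‖D z‖ + 2 * η z * (L * ‖h‖) * N :=
    integrable_of_zero (R := 3 / 2) (by fun_prop) fun z hz => by rw [hηz z hz]; simp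
  have j6 : Integrable fun z => δ * ‖h‖ * (η z ^ 2 * ‖D z‖ + 2 * η z * (L * ‖h‖) * N) +
      2 * η z * (L * ‖h‖) * (Λ * ‖D z‖) * N := (j5.const_mul _).add j3
  have K1 : c * ∫ z, η z ^ 2 * ‖D z‖ ^ 2 ≤ (∫ z, dot (W (z + h) - W z) (cgrad ψ z)) +
      ∫ z, 2 * η z * (L * ‖h‖) * (Λ * ‖D z‖) * N := by
    rw [← integral_const_mul, ← integral_add j2 j3]
    exact integral_mono j1 (j2.add j3) hmono
  have K2 : ∫ z, ‖cgrad ψ z‖ ≤ ∫ z, (η z ^ 2 * ‖D z‖ + 2 * η z * (L * ‖h‖) * N) :=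
    integral_mono j4 j5 hgb
  have K3 : δ * ‖h‖ * (∫ z, (η z ^ 2 * ‖D z‖ + 2 * η z * (L * ‖h‖) * N)) +
      (∫ z, 2 * η z * (L * ‖h‖) * (Λ * ‖D z‖) * N) ≤ c / 2 * (∫ z, η z ^ 2 * ‖D z‖ ^ 2) + C1 * ‖h‖ ^ 2 * Vb := by
    rw [← integral_const_mul, ← integral_add (j5.const_mul _) j3]
    rw [← int_ball (R := 2) (f := fun z => δ * ‖h‖ * (η z ^ 2 * ‖D z‖ + 2 * η z * (L * ‖h‖) * N) +
      2 * η z * (L * ‖h‖) * (Λ * ‖D z‖) * N) (fun z hz => by rw [hηz z (by linarith)]; simp),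
      ← int_ball (R := 2) (f := fun z => η z ^ 2 * ‖D z‖ ^ 2) (fun z hz => by rw [hηz z (by linarith)]; simp)]
    have e : C1 * ‖h‖ ^ 2 * Vb = ∫ z in closedBall (0:ℂ) 2, C1 * ‖h‖ ^ 2 := by
      rw [setIntegral_const, smul_eq_mul, mul_comm]
    have fin : volume (closedBall (0:ℂ) 2) ≠ ⊤ := (isCompact_closedBall _ _).measure_lt_top.ne
    have j7 : IntegrableOn (fun z => c / 2 * (η z ^ 2 * ‖D z‖ ^ 2)) (closedBall (0:ℂ) 2) :=
      (by fun_prop : Continuous fun z => c / 2 * (η z ^ 2 * ‖D z‖ ^ 2)).continuousOn.integrableOn_compact (isCompact_closedBall _ _)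
    have j8 : IntegrableOn (fun _ : ℂ => C1 * ‖h‖ ^ 2) (closedBall (0:ℂ) 2) := integrableOn_const fin
    rw [e, ← integral_const_mul, ← integral_add j7 j8]
    apply integral_mono j6.integrableOn (j7.add j8)
    intro z
    exact dq_alg hc0 hδ (norm_nonneg h) hL0 hN0 (hη01 z).1 (hη01 z).2 (norm_nonneg _)
  have K4 : δ * ‖h‖ * (∫ z, ‖cgrad ψ z‖) ≤ δ * ‖h‖ * (∫ z, (η z ^ 2 * ‖D z‖ + 2 * η z * (L * ‖h‖) * N)) :=
    mul_le_mul_of_nonneg_left K2 (by positivity)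
  have K5 : c / 2 * ∫ z, η z ^ 2 * ‖D z‖ ^ 2 ≤ C1 * ‖h‖ ^ 2 * Vb := by linarith
  have K6 := mul_le_mul_of_nonneg_left K5 (by positivity : 0 ≤ 2 / c)
  have e7 : 2 / c * (c / 2 * ∫ z, η z ^ 2 * ‖D z‖ ^ 2) = ∫ z, η z ^ 2 * ‖D z‖ ^ 2 := by
    field_simp
  rw [e7] at K6
  refine K6.trans (le_of_eq (by ring))

end PLap

namespace PLap

lemma cgrad_cont_k {ε M : ℝ} {k : ℂ → ℝ} (h : Mol ε M k) : Continuous (cgrad k) := cgrad_cont h.smooth1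

lemma cgrad_k_zero {ε M : ℝ} {k : ℂ → ℝ} (h : Mol ε M k) {y : ℂ} (hy : ε < ‖y‖) : cgrad k y = 0 :=
  cgrad_zero (s := ε) (fun z hz => h.zero z hz.le) hy

lemma div_bound {p δ ε M : ℝ} {u k : ℂ → ℝ} (hp : 2 < p) (hu : Sol p 2 δ u) (h : Mol ε M k) (hε : ε ≤ 1 / 4)
    {x : ℂ} (hx : ‖x‖ < 3 / 2) : |∫ t, dot (cgrad k t) (Aop p (cgrad u (x - t)))| ≤ δ := by
  set φ : ℂ → ℝ := fun y => k (x - y) with hφ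
  have hs : ContDiff ℝ (⊤ : ℕ∞) φ := h.smooth.comp (contDiff_const.sub contDiff_id)
  have hz : ∀ y, 7 / 4 < ‖y‖ → φ y = 0 := fun y hy => h.zero _ (by
    have := norm_sub_norm_le y x
    rw [norm_sub_rev] at this
    linarith)
  have hG : ∀ y, cgrad φ y = - cgrad k (x - y) := fun y => by
    have hd : HasFDerivAt φ ((fderiv ℝ k (x - y)).comp (-ContinuousLinearMap.id ℝ ℂ)) y :=
      (h.smooth1.differentiable (by norm_num) _).hasFDerivAt.comp y ((hasFDerivAt_id y).const_sub x)
    unfold cgrad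
    rw [hd.fderiv]
    apply Complex.ext <;> simp
  have key := hu.2 φ hs (compact_of_zero hz) ((tsupport_of_zero hz).trans (closedBall_subset_ball (by norm_num)))
  have e1 : ∫ y, |φ y| = 1 := by
    have : ∀ y, |φ y| = k (x - y) := fun y => abs_of_nonneg (h.nonneg _)
    simp only [this]
    rw [integral_sub_left_eq_self k volume x]; exact h.int
  have e2 : ∫ z, dot (Aop p (cgrad u z)) (cgrad φ z) = - ∫ t, dot (cgrad k t) (Aop p (cgrad u (x - t))) := by
    rw [← integral_sub_left_eq_self _ volume x, ← integral_neg]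
    congr 1; ext t
    rw [hG]; simp [dot]; ring
  rw [e1, e2, abs_neg, mul_one] at key
  exact key

lemma int_cgrad_k {ε M : ℝ} {k : ℂ → ℝ} (h : Mol ε M k) (c : ℂ) : ∫ t, dot (cgrad k t) c = 0 := by
  have := ibp k (fun _ => 1) h.smooth1 h.compact contDiff_const c
  simp at this
  simpa only [fderiv_apply_dot] using this

lemma gt_repr {p ε M τ : ℝ} {k : ℂ → ℝ} (hp : 2 < p) (h : Mol ε M k) {Z : ℂ → ℂ} (hZ : Continuous Z) (hτ : 0 < τ) {x : ℂ}
    (hx : τ ≤ ‖cv k Z x‖) : gt p (cv k Z x) (fderiv ℝ (cv k Z) x) =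
      ∫ t, dot (cgrad k t) (fderiv ℝ (Fm (p - 1) τ) (cv k Z x) (Z (x - t))) := by
  rw [← trace_Fm hτ hx, cv_fderiv h hZ, cv_fderiv h hZ]
  have hfc : Continuous (fderiv ℝ k) := h.smooth1.continuous_fderiv (by norm_num)
  have hi : ∀ v, Integrable (fun t => fderiv ℝ k t v • Z (x - t)) := fun v => by
    refine Continuous.integrable_of_hasCompactSupport (by fun_prop) ?_
    exact (h.compact.fderiv_apply (𝕜 := ℝ) v).smul_right
  set D := fderiv ℝ (Fm (p - 1) τ) (cv k Z x)
  have hr : ∀ v, (D (∫ t, fderiv ℝ k t v • Z (x - t))).re = ∫ t, fderiv ℝ k t v * (D (Z (x - t))).re := fun v => by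
    have := (Complex.reCLM.comp D).integral_comp_comm (hi v)
    simp only [ContinuousLinearMap.comp_apply, Complex.reCLM_apply] at this
    rw [← this]
    congr 1; ext t; rw [map_smul, Complex.smul_re, smul_eq_mul]
  have hm : ∀ v, (D (∫ t, fderiv ℝ k t v • Z (x - t))).im = ∫ t, fderiv ℝ k t v * (D (Z (x - t))).im := fun v => by
    have := (Complex.imCLM.comp D).integral_comp_comm (hi v)
    simp only [ContinuousLinearMap.comp_apply, Complex.imCLM_apply] at this
    rw [← this]
    congr 1; ext t; rw [map_smul, Complex.smul_im, smul_eq_mul]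
  rw [hr, hm, ← integral_add]
  · rfl
  · refine Continuous.integrable_of_hasCompactSupport (by fun_prop) ?_
    exact (h.compact.fderiv_apply (𝕜 := ℝ) _).mul_right
  · refine Continuous.integrable_of_hasCompactSupport (by fun_prop) ?_
    exact (h.compact.fderiv_apply (𝕜 := ℝ) _).mul_right

lemma vol_ball {ε : ℝ} (hε : 0 ≤ ε) : volume.real (closedBall (0:ℂ) ε) = π * ε ^ 2 := by
  rw [measureReal_def, Complex.volume_closedBall]
  simp [hε]; ring

lemma commut {p δ ε M σ τ : ℝ} {u k : ℂ → ℝ} (hp : 2 < p) (hM : 0 ≤ M) (hε0 : 0 < ε) (hσ : 0 ≤ σ) (hu : Sol p 2 δ u) (h : Mol ε M k) (hε : ε ≤ 1 / 4)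
    (hτ : 0 < τ) {x : ℂ} (hx : ‖x‖ < 3 / 2) (hxτ : τ ≤ ‖cv k (cgrad u) x‖)
    (hc : ∀ t, ‖t‖ ≤ ε → ‖Aop p (cgrad u (x - t)) - Aop p (cgrad u x) -
      fderiv ℝ (Fm (p - 1) τ) (cv k (cgrad u) x) (cgrad u (x - t) - cgrad u x)‖ ≤ σ * ‖cgrad u (x - t) - cgrad u x‖) :
    gt p (cv k (cgrad u) x) (fderiv ℝ (cv k (cgrad u)) x) ^ 2 ≤
      2 * δ ^ 2 + 2 * π * M ^ 2 * σ ^ 2 / ε ^ 4 * ∫ t in closedBall (0:ℂ) ε, ‖cgrad u (x - t) - cgrad u x‖ ^ 2 := by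
  have hZ := cgrad_cont hu.1
  have hkc := cgrad_cont_k h
  have hA : Continuous (Aop p) := Aop_cont hp
  rw [gt_repr hp h hZ hτ hxτ]
  set D := fderiv ℝ (Fm (p - 1) τ) (cv k (cgrad u) x) with hD
  have hdiv := div_bound hp hu h hε hx
  set d := ∫ t, dot (cgrad k t) (Aop p (cgrad u (x - t))) with hd
  have hi : ∀ g : ℂ → ℂ, Continuous g → Integrable (fun t => dot (cgrad k t) (g t)) := fun g hg =>
    integrable_of_zero (R := ε) (by fun_prop) fun z hz => by rw [cgrad_k_zero h hz]; simp [dot]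
  have e1 : (∫ t, dot (cgrad k t) (D (cgrad u (x - t)))) - d =
      - ∫ t, dot (cgrad k t) (Aop p (cgrad u (x - t)) - Aop p (cgrad u x) - D (cgrad u (x - t) - cgrad u x)) := by
    have a1 := int_cgrad_k h (D (cgrad u x) - Aop p (cgrad u x))
    rw [hd, ← integral_sub (hi _ (by fun_prop)) (hi _ (by fun_prop)), ← integral_neg]
    rw [← sub_zero (∫ t, _), ← a1, ← integral_sub]
    · congr 1; ext t; simp [dot]; ring
    · exact (hi _ (by fun_prop)).sub (hi _ (by fun_prop))
    · exact hi _ (by fun_prop)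
  have hcont : Continuous fun t => ‖cgrad u (x - t) - cgrad u x‖ := by fun_prop
  have hIn : ∀ f : ℂ → ℝ, Continuous f → IntegrableOn f (closedBall (0:ℂ) ε) := fun f hf =>
    hf.continuousOn.integrableOn_compact (isCompact_closedBall _ _)
  have e2 : |∫ t, dot (cgrad k t) (Aop p (cgrad u (x - t)) - Aop p (cgrad u x) - D (cgrad u (x - t) - cgrad u x))| ≤
      (M / ε ^ 3 * σ) * ∫ t in closedBall (0:ℂ) ε, ‖cgrad u (x - t) - cgrad u x‖ := by
    rw [← int_ball (R := ε) (fun z hz => by rw [cgrad_k_zero h hz]; simp [dot]), ← integral_const_mul, ← Real.norm_eq_abs]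
    apply norm_integral_le_of_norm_le ((hIn _ hcont).const_mul _)
    filter_upwards [ae_restrict_mem measurableSet_closedBall] with t ht
    rw [mem_closedBall, dist_zero_right] at ht
    refine (abs_dot_le _ _).trans ?_
    rw [mul_assoc]
    exact mul_le_mul (h.bound t) (hc t ht) (norm_nonneg _) (by positivity)
  have e3 : (∫ t in closedBall (0:ℂ) ε, ‖cgrad u (x - t) - cgrad u x‖) ^ 2 ≤
      π * ε ^ 2 * ∫ t in closedBall (0:ℂ) ε, ‖cgrad u (x - t) - cgrad u x‖ ^ 2 := by
    have := cs (volume.restrict (closedBall (0:ℂ) ε)) (fun _ => (1:ℝ)) (fun t => ‖cgrad u (x - t) - cgrad u x‖)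
      (hIn _ (by fun_prop)) (hIn _ (by fun_prop)) (hIn _ (by fun_prop))
    simp only [one_mul, one_pow, integral_const, smul_eq_mul, mul_one, measureReal_restrict_apply_univ] at this
    rwa [vol_ball hε0.le] at this
  set J := ∫ t in closedBall (0:ℂ) ε, ‖cgrad u (x - t) - cgrad u x‖
  set J2 := ∫ t in closedBall (0:ℂ) ε, ‖cgrad u (x - t) - cgrad u x‖ ^ 2
  set q := ∫ t, dot (cgrad k t) (D (cgrad u (x - t)))
  have hJ : 0 ≤ J := integral_nonneg fun _ => norm_nonneg _
  rw [← abs_neg, ← e1] at e2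
  have e4 : (q - d) ^ 2 ≤ (M / ε ^ 3 * σ * J) ^ 2 := by
    rw [← sq_abs]; exact pow_le_pow_left₀ (abs_nonneg _) e2 2
  have e5 : d ^ 2 ≤ δ ^ 2 := by rw [← sq_abs]; exact pow_le_pow_left₀ (abs_nonneg _) hdiv 2
  have e6 : (M / ε ^ 3 * σ * J) ^ 2 ≤ (M / ε ^ 3 * σ) ^ 2 * (π * ε ^ 2 * J2) := by
    rw [mul_pow]; gcongr
  have e7 : (M / ε ^ 3 * σ) ^ 2 * (π * ε ^ 2 * J2) = π * M ^ 2 * σ ^ 2 / ε ^ 4 * J2 := by field_simp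
  have e8 : 2 * π * M ^ 2 * σ ^ 2 / ε ^ 4 * J2 = 2 * (π * M ^ 2 * σ ^ 2 / ε ^ 4 * J2) := by ring
  rw [e8]
  nlinarith [sq_nonneg (q - 2 * d)]

lemma taylor_unif {p τ L σ : ℝ} (hτ : 0 < τ) (hσ : 0 < σ) : ∃ ρ > 0, ∀ z0 z1 a : ℂ, ‖z0‖ ≤ L → ‖z1‖ ≤ L → ‖a‖ ≤ L →
    ‖z0 - z1‖ ≤ ρ → ‖a - z1‖ ≤ ρ → τ ≤ ‖z1‖ → τ ≤ ‖a‖ →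
    ‖Aop p a - Aop p z1 - fderiv ℝ (Fm (p - 1) τ) z0 (a - z1)‖ ≤ σ * ‖a - z1‖ := by
  have h2 := Fm_id_contDiff (b := p - 1) hτ
  have hfc : Continuous (fderiv ℝ (Fm (p - 1) τ)) := h2.continuous_fderiv (by norm_num)
  have hU := (isCompact_closedBall (0:ℂ) L).uniformContinuousOn_of_continuous hfc.continuousOn
  rw [Metric.uniformContinuousOn_iff_le] at hU
  obtain ⟨ρ, hρ, H⟩ := hU σ hσ
  refine ⟨ρ / 2, by positivity, fun z0 z1 a h0 h1 ha h01 ha1 hz1 haa => ?_⟩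
  rw [Aop_eq_Fm hτ hz1, Aop_eq_Fm hτ haa]
  refine ((convex_closedBall z1 (ρ/2)).inter (convex_closedBall (0:ℂ) L)).norm_image_sub_le_of_norm_fderiv_le' (𝕜 := ℝ)
    (fun x _ => h2.differentiable (by norm_num) x) (fun x hx => ?_) ⟨by simp; positivity, by simpa using h1⟩
      ⟨by simpa [dist_eq_norm] using ha1, by simpa using ha⟩
  rw [← dist_eq_norm]
  apply H _ hx.2 _ (by simpa using h0)
  calc dist x z0 ≤ dist x z1 + dist z1 z0 := dist_triangle _ _ _
    _ ≤ ρ / 2 + ρ / 2 := add_le_add hx.1 (by rwa [dist_comm, dist_eq_norm])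
    _ = ρ := by ring

lemma cgrad_symm {v : ℂ → ℝ} (hv : ContDiff ℝ 2 v) (z : ℂ) :
    (fderiv ℝ (cgrad v) z 1).im = (fderiv ℝ (cgrad v) z Complex.I).re := by
  have hs : IsSymmSndFDerivAt ℝ v z := hv.contDiffAt.isSymmSndFDerivAt (by simp)
  have hd : DifferentiableAt ℝ (fderiv ℝ v) z := (hv.fderiv_right (m := 1) (by norm_num)).differentiable (by norm_num) z
  have h1 : HasFDerivAt (fun z => (fderiv ℝ v z 1 : ℝ)) ((fderiv ℝ (fderiv ℝ v) z).flip 1) z := by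
    simpa using hd.hasFDerivAt.clm_apply (hasFDerivAt_const (1:ℂ) z)
  have h2 : HasFDerivAt (fun z => (fderiv ℝ v z Complex.I : ℝ)) ((fderiv ℝ (fderiv ℝ v) z).flip Complex.I) z := by
    simpa using hd.hasFDerivAt.clm_apply (hasFDerivAt_const (Complex.I:ℂ) z)
  have hdc : DifferentiableAt ℝ (cgrad v) z := by
    have : cgrad v = fun z => (fderiv ℝ v z 1 : ℝ) • (1:ℂ) + (fderiv ℝ v z Complex.I : ℝ) • Complex.I := by
      ext z
      apply Complex.ext <;> simp [cgrad]
    rw [this]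
    exact (h1.differentiableAt.smul_const _).add (h2.differentiableAt.smul_const _)
  have e1 : fderiv ℝ (fun z => (cgrad v z).im) z 1 = (fderiv ℝ (cgrad v) z 1).im := by
    have := (Complex.imCLM.hasFDerivAt (x := cgrad v z)).comp z hdc.hasFDerivAt
    rw [show fderiv ℝ (fun z => (cgrad v z).im) z = _ from this.fderiv]; rfl
  have e2 : fderiv ℝ (fun z => (cgrad v z).re) z Complex.I = (fderiv ℝ (cgrad v) z Complex.I).re := by
    have := (Complex.reCLM.hasFDerivAt (x := cgrad v z)).comp z hdc.hasFDerivAt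
    rw [show fderiv ℝ (fun z => (cgrad v z).re) z = _ from this.fderiv]; rfl
  rw [← e1, ← e2]
  change fderiv ℝ (fun z => (fderiv ℝ v z Complex.I : ℝ)) z 1 = fderiv ℝ (fun z => (fderiv ℝ v z 1 : ℝ)) z Complex.I
  rw [h1.fderiv, h2.fderiv]
  simpa using hs.eq 1 Complex.I

lemma swap_bound {ε C : ℝ} (hε : 0 < ε) (hC : 0 ≤ C) {η : ℂ → ℝ} {Z : ℂ → ℂ} (hη : Continuous η) (hZ : Continuous Z)
    (hηz : ∀ z, 3 / 2 < ‖z‖ → η z = 0)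
    (hDQ : ∀ h : ℂ, ‖h‖ ≤ ε → ∫ x, η x ^ 2 * ‖Z (x + h) - Z x‖ ^ 2 ≤ C * ‖h‖ ^ 2) :
    ∫ x, η x ^ 2 * (∫ t in closedBall (0:ℂ) ε, ‖Z (x - t) - Z x‖ ^ 2) ≤ C * π * ε ^ 4 := by
  have e0 : ∀ x, η x ^ 2 * (∫ t in closedBall (0:ℂ) ε, ‖Z (x - t) - Z x‖ ^ 2) =
      ∫ t in closedBall (0:ℂ) ε, η x ^ 2 * ‖Z (x - t) - Z x‖ ^ 2 := fun x => (integral_const_mul _ _).symm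
  simp only [e0]
  rw [← int_ball (R := 3/2) (fun z hz => by simp [hηz z hz])]
  rw [integral_integral_swap]
  · have hb : ∀ t ∈ closedBall (0:ℂ) ε, ∫ x in closedBall (0:ℂ) (3/2), η x ^ 2 * ‖Z (x - t) - Z x‖ ^ 2 ≤ C * ε ^ 2 := by
      intro t ht
      rw [mem_closedBall, dist_zero_right] at ht
      rw [int_ball (R := 3/2) (fun z hz => by simp [hηz z hz])]
      refine (hDQ (-t) (by simpa using ht)).trans ?_
      rw [norm_neg]; gcongr
    refine (le_abs_self _).trans ?_
    rw [← Real.norm_eq_abs]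
    refine (norm_setIntegral_le_of_norm_le_const (C := C * ε ^ 2) ?_ ?_).trans ?_
    · exact measure_closedBall_lt_top
    · intro t ht
      rw [Real.norm_of_nonneg (integral_nonneg fun x => by positivity)]
      exact hb t ht
    · rw [vol_ball hε.le]; exact le_of_eq (by ring)
  · rw [Measure.prod_restrict]
    refine ContinuousOn.integrableOn_compact ((isCompact_closedBall _ _).prod (isCompact_closedBall _ _)) ?_
    apply Continuous.continuousOn
    unfold Function.uncurry
    fun_prop

end PLap

namespace PLap

lemma two_le_top : (2 : WithTop ℕ∞) ≤ ((⊤ : ℕ∞) : WithTop ℕ∞) := by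
  have : ((2 : ℕ∞) : WithTop ℕ∞) ≤ ((⊤ : ℕ∞) : WithTop ℕ∞) := WithTop.coe_le_coe.2 le_top
  exact this

lemma exists_eta {t : ℝ} (ht : 0 < t) {Z : ℂ → ℂ} (hZ : Continuous Z) : ∃ η : ℂ → ℝ, ContDiff ℝ 1 η ∧
    (∀ z, 0 ≤ η z ∧ η z ≤ 1) ∧ (∀ z, η z ≠ 0 → t / 16 < ‖Z z‖ ∧ ‖z‖ < 3 / 2) ∧
    (∀ z, t / 8 ≤ ‖Z z‖ → ‖z‖ ≤ 1 → η z = 1) := by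
  have hs : IsClosed {z : ℂ | ‖Z z‖ ≤ t / 16 ∨ 3 / 2 ≤ ‖z‖} :=
    (isClosed_le hZ.norm continuous_const).union (isClosed_le continuous_const continuous_norm)
  have ht' : IsClosed {z : ℂ | t / 8 ≤ ‖Z z‖ ∧ ‖z‖ ≤ 1} :=
    (isClosed_le continuous_const hZ.norm).inter (isClosed_le continuous_norm continuous_const)
  have hd : Disjoint {z : ℂ | ‖Z z‖ ≤ t / 16 ∨ 3 / 2 ≤ ‖z‖} {z : ℂ | t / 8 ≤ ‖Z z‖ ∧ ‖z‖ ≤ 1} := by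
    rw [Set.disjoint_left]
    rintro z (h | h) ⟨h1, h2⟩ <;> linarith
  obtain ⟨f, hf, hr, h0, h1⟩ := exists_contMDiff_zero_iff_one_iff_of_isClosed (n := 1) (modelWithCornersSelf ℝ ℂ) hs ht' hd
  refine ⟨f, hf.contDiff, fun z => hr ⟨z, rfl⟩, fun z hz => ?_, fun z h2 h3 => (h1 z).1 ⟨h2, h3⟩⟩
  have := mt (h0 z).1 hz
  simpa [not_or] using this

set_option maxHeartbeats 1000000 in
lemma approx {p δ t σ : ℝ} {u : ℂ → ℝ} (hp : 2 < p) (hδ : 0 ≤ δ) (hu : Sol p 2 δ u) (ht : 0 < t) (hσ : 0 < σ) :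
    ∃ (Z : ℂ → ℂ) (G : ℂ → ℝ), ContDiff ℝ 2 Z ∧ Continuous G ∧ (∀ z, 0 ≤ G z) ∧
      (∀ z, ‖z‖ ≤ 1 → ‖Z z - cgrad u z‖ ≤ σ) ∧
      (∀ z, (fderiv ℝ Z z 1).im = (fderiv ℝ Z z Complex.I).re) ∧
      (∀ z, t / 4 < ‖Z z‖ → ‖z‖ < 1 → gt p (Z z) (fderiv ℝ Z z) ^ 2 ≤ G z) ∧
      ∀ β e, 0 ≤ β → 0 < e → ∫ z, wt β e z * G z ≤ 2 * δ ^ 2 * (∫ z, wt β e z) + e ^ (-β) * σ := by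
  have hZ := cgrad_cont hu.1
  obtain ⟨M, hM, hmol⟩ := exists_mol
  obtain ⟨η, hη, hη01, hη0, hη1⟩ := exists_eta ht hZ
  obtain ⟨h0, hh0, C, hC, hDQ⟩ := DQ hp hδ (by positivity : 0 < t / 16) hu hη hη01 hη0
  obtain ⟨L, hL⟩ := (isCompact_closedBall (0:ℂ) 2).exists_bound_of_continuousOn hZ.continuousOn
  have hηz : ∀ z, 3 / 2 < ‖z‖ → η z = 0 := fun z hz => by
    by_contra h; exact absurd (hη0 z h).2 (by linarith)
  set Q := 2 * π * M ^ 2 * (C * π) + 1 with hQ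
  have hQ0 : 0 < Q := by positivity
  set σ1 := √(σ / Q) with hσ1
  have hσ10 : 0 < σ1 := Real.sqrt_pos.2 (by positivity)
  have hσsq : σ1 ^ 2 = σ / Q := Real.sq_sqrt (by positivity)
  obtain ⟨ρ, hρ, hT⟩ := taylor_unif (p := p) (L := L + 1) (by positivity : 0 < t / 16) hσ10
  obtain ⟨ε1, hε1, hU⟩ := unif_cont hZ (3 / 2) (min (min σ 1) (min ρ (t / 16)))
    (lt_min (lt_min hσ one_pos) (lt_min hρ (by positivity)))
  set ε := min (min ε1 h0) (1 / 4) with hε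
  have hε0 : 0 < ε := lt_min (lt_min hε1 hh0) (by norm_num)
  have hεa : ε ≤ ε1 := (min_le_left _ _).trans (min_le_left _ _)
  have hεb : ε ≤ h0 := (min_le_left _ _).trans (min_le_right _ _)
  have hεc : ε ≤ 1 / 4 := min_le_right _ _
  obtain ⟨k, hk⟩ := hmol ε hε0
  have hU' : ∀ x s, ‖x‖ ≤ 3 / 2 → ‖s‖ ≤ ε → ‖cgrad u (x - s) - cgrad u x‖ ≤ σ ∧
      ‖cgrad u (x - s) - cgrad u x‖ ≤ 1 ∧ ‖cgrad u (x - s) - cgrad u x‖ ≤ ρ ∧ ‖cgrad u (x - s) - cgrad u x‖ ≤ t / 16 := by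
    intro x s hx hs
    have := hU x s hx (hs.trans hεa)
    simp only [le_min_iff] at this
    tauto
  have hcl : ∀ x, ‖x‖ ≤ 3 / 2 → ‖cv k (cgrad u) x - cgrad u x‖ ≤ σ ∧ ‖cv k (cgrad u) x - cgrad u x‖ ≤ 1 ∧
      ‖cv k (cgrad u) x - cgrad u x‖ ≤ ρ ∧ ‖cv k (cgrad u) x - cgrad u x‖ ≤ t / 16 := fun x hx =>
    ⟨cv_close hk hZ x fun s hs => (hU' x s hx hs).1, cv_close hk hZ x fun s hs => (hU' x s hx hs).2.1,
      cv_close hk hZ x fun s hs => (hU' x s hx hs).2.2.1, cv_close hk hZ x fun s hs => (hU' x s hx hs).2.2.2⟩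
  set c := 2 * π * M ^ 2 * σ1 ^ 2 / ε ^ 4 with hc
  have hc0 : 0 ≤ c := by positivity
  set I : ℂ → ℝ := fun x => ∫ s in closedBall (0:ℂ) ε, ‖cgrad u (x - s) - cgrad u x‖ ^ 2 with hI
  have hIc : Continuous I := by
    apply continuous_parametric_integral_of_continuous _ (isCompact_closedBall _ _)
    unfold Function.uncurry
    fun_prop
  have hI0 : ∀ x, 0 ≤ I x := fun x => integral_nonneg fun _ => by positivity
  have hηc := hη.continuous
  refine ⟨cv k (cgrad u), fun x => 2 * δ ^ 2 + c * (η x ^ 2 * I x), (cv_smooth hk hZ).of_le two_le_top, by fun_prop, ?_, ?_, ?_, ?_, ?_⟩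
  · intro z; have := hI0 z; positivity
  · intro z hz; exact (hcl z (by linarith)).1
  · have : cv k (cgrad u) = cgrad (cv k u) := by ext x; rw [cv_cgrad hk hu.1]
    rw [this]
    exact cgrad_symm ((cv_smooth hk hu.1.continuous).of_le two_le_top)
  · intro z hz hz1
    obtain ⟨b1, b2, b3, b4⟩ := hcl z (by linarith)
    have n1 : t / 8 ≤ ‖cgrad u z‖ := by
      have := norm_sub_norm_le (cv k (cgrad u) z) (cgrad u z); linarith
    beta_reduce
    rw [hη1 z n1 hz1.le, one_pow, one_mul]
    have hLz : ‖cgrad u z‖ ≤ L := hL z (by rw [mem_closedBall, dist_zero_right]; linarith)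
    refine commut hp hM hε0 hσ10.le hu hk hεc (by positivity : 0 < t / 16) (by linarith) (by linarith) fun s hs => ?_
    obtain ⟨d1, d2, d3, d4⟩ := hU' z s (by linarith) hs
    apply hT
    · have := norm_sub_norm_le (cv k (cgrad u) z) (cgrad u z); linarith
    · linarith
    · have := norm_sub_norm_le (cgrad u (z - s)) (cgrad u z); linarith
    · exact b3
    · exact d3
    · linarith
    · have := norm_sub_norm_le (cgrad u z) (cgrad u (z - s)); rw [norm_sub_rev] at this; linarith
  · intro β e hβ he
    have hwc := (wt_contDiff (β := β) he).continuous
    have i1 : Integrable fun z => wt β e z * (2 * δ ^ 2) := (hwc.integrable_of_hasCompactSupport wt_compact).mul_const _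
    have i2 : Integrable fun z => wt β e z * (c * (η z ^ 2 * I z)) :=
      Continuous.integrable_of_hasCompactSupport (by fun_prop) wt_compact.mul_right
    have i3 : Integrable fun z => η z ^ 2 * I z :=
      integrable_of_zero (R := 3 / 2) (by fun_prop) fun z hz => by simp [hηz z hz]
    have s1 : ∫ z, wt β e z * (2 * δ ^ 2 + c * (η z ^ 2 * I z)) =
        (∫ z, wt β e z * (2 * δ ^ 2)) + ∫ z, wt β e z * (c * (η z ^ 2 * I z)) := by
      rw [← integral_add i1 i2]; congr 1; ext z; ring
    have s2 : ∫ z, wt β e z * (c * (η z ^ 2 * I z)) ≤ e ^ (-β) * (c * ∫ z, η z ^ 2 * I z) := by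
      rw [← integral_const_mul, ← integral_const_mul]
      refine integral_mono i2 ((i3.const_mul _).const_mul _) fun z => ?_
      exact mul_le_mul_of_nonneg_right (wt_le hβ he z) (mul_nonneg hc0 (mul_nonneg (sq_nonneg _) (hI0 z)))
    have s3 : ∫ z, η z ^ 2 * I z ≤ C * π * ε ^ 4 :=
      swap_bound hε0 hC hηc hZ hηz fun h hh => hDQ h (hh.trans hεb)
    have s4 : c * (∫ z, η z ^ 2 * I z) ≤ σ := by
      calc _ ≤ c * (C * π * ε ^ 4) := by gcongr
        _ = (2 * π * M ^ 2 * (C * π)) * σ1 ^ 2 := by rw [hc]; field_simp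
        _ ≤ Q * (σ / Q) := by rw [hσsq, hQ]; gcongr; linarith
        _ = σ := by field_simp
    rw [s1, integral_mul_const]
    have := mul_le_mul_of_nonneg_left s4 (rpow_nonneg he.le (-β))
    linarith

set_option maxHeartbeats 1000000 in
lemma master {p b K κ m β L : ℝ} (hp : 2 < p) (hb : 1 ≤ b) (hbp : b ≤ p - 1) (hK : 0 < K) (hκ : 0 ≤ κ)
    (hm : 0 ≤ m) (hβ : 0 < β) (hβ1 : β < 1) (hS : Struct (p - 1) b K m) (hlt : β * κ * K < 1) (hL : 0 < L)
    (hC : CircleIneq m κ) :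
    ∃ C, 0 ≤ C ∧ ∀ (u : ℂ → ℝ) (δ r1 t r : ℝ), 0 ≤ δ → Sol p 2 δ u → (∀ z, ‖z‖ ≤ 1 → ‖cgrad u z‖ ≤ L) →
      0 < r1 → r1 ≤ r → r ≤ 1 / 2 → 0 < t →
      ∫ x in (-π)..π, ‖Fm b t (cgrad u (r * E x)) - Fm b t (cgrad u (r1 * E x))‖ ^ 2 ≤
        C * r ^ (2 * β) * (1 + (t ^ (b - 1)) ^ 2 * ((r1 ^ 2) ^ 2)⁻¹ + t ^ (2 * (b - (p - 1))) * δ ^ 2) := by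
  obtain ⟨C1, hC1, hsm⟩ := smooth_master hp hb hbp hK hκ hm hβ.le hβ1.le hS hlt (by positivity : 0 < L + 1) hC
  obtain ⟨C2, hC2, hwt⟩ := wt_int hβ.le hβ1
  refine ⟨2 * (2 / β * (C1 * (2 + 2 * C2))) + 1, by positivity, ?_⟩
  intro u δ r1 t r hδ hu huL hr1 hrr hr ht
  have hr0 : 0 < r := hr1.trans_le hrr
  have he : 0 < r1 ^ 2 := by positivity
  have he1 : r1 ^ 2 ≤ 1 := by nlinarith
  obtain ⟨Λ, hΛ0, hΛ⟩ := lip_Fm (b := b) ht (by positivity : 0 ≤ L + 1)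
  set A := t ^ (2 * (b - (p - 1))) with hA
  have hA0 : 0 < A := rpow_pos_of_pos ht _
  set X := (t ^ (b - 1)) ^ 2 * ((r1 ^ 2) ^ 2)⁻¹ with hX
  have hX0 : 0 ≤ X := by positivity
  set R := r ^ (2 * β) with hR
  have hR0 : 0 < R := rpow_pos_of_pos hr0 _
  set a := (r1 ^ 2) ^ (-β) with ha
  have ha0 : 0 < a := rpow_pos_of_pos he _
  obtain ⟨σ, hσ, hσ1, hσ2, hσ3⟩ : ∃ σ > 0, σ ≤ 1 ∧ A * (a * σ) ≤ 1 ∧ 16 * π * Λ ^ 2 * σ ≤ R := by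
    refine ⟨min 1 (min (1 / (A * a)) (R / (16 * π * Λ ^ 2 + 1))), by positivity, min_le_left _ _, ?_, ?_⟩
    · have : min 1 (min (1 / (A * a)) (R / (16 * π * Λ ^ 2 + 1))) ≤ 1 / (A * a) :=
        (min_le_right _ _).trans (min_le_left _ _)
      calc _ ≤ A * (a * (1 / (A * a))) := by gcongr
        _ = 1 := by field_simp
    · have : min 1 (min (1 / (A * a)) (R / (16 * π * Λ ^ 2 + 1))) ≤ R / (16 * π * Λ ^ 2 + 1) :=
        (min_le_right _ _).trans (min_le_right _ _)
      calc _ ≤ (16 * π * Λ ^ 2 + 1) * (R / (16 * π * Λ ^ 2 + 1)) := by gcongr; linarith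
        _ = R := by field_simp
  obtain ⟨Z, G, hZ, hG, hG0, hcl, hsy, hgt, h_intg⟩ := approx hp hδ hu ht hσ
  have hZL : ∀ z, ‖z‖ ≤ 1 → ‖Z z‖ ≤ L + 1 := fun z hz => by
    have := norm_sub_norm_le (Z z) (cgrad u z)
    have := hcl z hz
    have := huL z hz
    linarith
  have k1 := hsm t (r1 ^ 2) Z G ht he he1 hZ hG hG0 hZL hsy hgt
  have k2 := h_intg β (r1 ^ 2) hβ.le he
  have k3 := hwt (r1 ^ 2) he
  have hF : ContDiff ℝ 1 fun z => Fm b t (Z z) := Fm_contDiff ht (by norm_num) (hZ.of_le (by norm_num))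
  have k4 := radial hβ hβ1.le hr1 hrr hr hF
  change _ ≤ C1 * (1 + X + A * _) at k1
  have k5 : A * (∫ z, wt β (r1 ^ 2) z * G z) ≤ 2 * C2 * (A * δ ^ 2) + 1 := by
    have : 2 * δ ^ 2 * (∫ z, wt β (r1 ^ 2) z) ≤ 2 * δ ^ 2 * C2 := by gcongr
    calc A * (∫ z, wt β (r1 ^ 2) z * G z) ≤ A * (2 * δ ^ 2 * C2 + a * σ) := by
          apply mul_le_mul_of_nonneg_left _ hA0.le; linarith
      _ ≤ _ := by linarith
  set Y := 1 + X + A * δ ^ 2 with hY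
  have hAd : 0 ≤ A * δ ^ 2 := by positivity
  have hY1 : 1 ≤ Y := by linarith
  have k6 : En β (r1 ^ 2) (fun z => Fm b t (Z z)) ≤ C1 * (2 + 2 * C2) * Y := by
    refine k1.trans ?_
    rw [mul_assoc]
    apply mul_le_mul_of_nonneg_left _ hC1
    have q1 : 0 ≤ 2 * C2 * (1 + X) := by positivity
    have q2 : (2 + 2 * C2) * Y = 2 * Y + 2 * C2 * (1 + X) + 2 * C2 * (A * δ ^ 2) := by rw [hY]; ring
    rw [q2]; linarith
  have hFc : Continuous (Fm b t) := (Fm_id_contDiff ht).continuous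
  have hZc := hZ.continuous
  have hUc := cgrad_cont hu.1
  have hE := continuous_E
  have k7 : ∫ x in (-π)..π, ‖Fm b t (cgrad u (r * E x)) - Fm b t (cgrad u (r1 * E x))‖ ^ 2 ≤
      ∫ x in (-π)..π, (2 * ‖Fm b t (Z (r * E x)) - Fm b t (Z (r1 * E x))‖ ^ 2 + 8 * Λ ^ 2 * σ) := by
    apply intervalIntegral.integral_mono_on (by linarith [pi_pos])
    · exact Continuous.intervalIntegrable (by fun_prop) _ _
    · exact Continuous.intervalIntegrable (by fun_prop) _ _
    · intro x _
      have n : ∀ s : ℝ, 0 < s → s ≤ 1 / 2 → ‖Fm b t (cgrad u (s * E x)) - Fm b t (Z (s * E x))‖ ≤ Λ * σ := fun s hs hs1 => by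
        have hn : ‖(s:ℂ) * E x‖ ≤ 1 := by
          rw [norm_mul, norm_E, mul_one, Complex.norm_real, Real.norm_of_nonneg hs.le]; linarith
        refine (hΛ _ _ ((huL _ hn).trans (by linarith)) (hZL _ hn)).trans ?_
        rw [norm_sub_rev]
        exact mul_le_mul_of_nonneg_left (hcl _ hn) hΛ0
      have n1 := n r hr0 hr
      have n2 := n r1 hr1 (hrr.trans hr)
      set f := Fm b t (cgrad u (r * E x))
      set g := Fm b t (cgrad u (r1 * E x))
      set f' := Fm b t (Z (r * E x))
      set g' := Fm b t (Z (r1 * E x))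
      have n3 : ‖f - g‖ ≤ ‖f' - g'‖ + 2 * (Λ * σ) := by
        have : f - g = (f' - g') + (f - f') - (g - g') := by ring
        rw [this]
        refine (norm_sub_le _ _).trans ?_
        have := norm_add_le (f' - g') (f - f')
        linarith
      have n4 : ‖f - g‖ ^ 2 ≤ (‖f' - g'‖ + 2 * (Λ * σ)) ^ 2 := pow_le_pow_left₀ (norm_nonneg _) n3 2
      have n5 : Λ ^ 2 * σ ^ 2 ≤ Λ ^ 2 * σ := by
        apply mul_le_mul_of_nonneg_left _ (sq_nonneg _); nlinarith
      nlinarith [sq_nonneg (‖f' - g'‖ - 2 * (Λ * σ))]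
  have i1 : IntervalIntegrable (fun x => 2 * ‖Fm b t (Z (r * E x)) - Fm b t (Z (r1 * E x))‖ ^ 2) volume (-π) π :=
    Continuous.intervalIntegrable (by fun_prop) _ _
  rw [intervalIntegral.integral_add i1 (by simp), intervalIntegral.integral_const_mul, intervalIntegral.integral_const] at k7
  have k8 : (2 / β * R) * En β (r1 ^ 2) (fun z => Fm b t (Z z)) ≤ (2 / β * R) * (C1 * (2 + 2 * C2) * Y) := by
    gcongr
  have k9 : (π - -π) • (8 * Λ ^ 2 * σ) ≤ R := by
    rw [smul_eq_mul]; linarith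
  have k10 : R * 1 ≤ R * Y := by gcongr
  have e : (2 * (2 / β * (C1 * (2 + 2 * C2))) + 1) * R * Y = 2 * ((2 / β * R) * (C1 * (2 + 2 * C2) * Y)) + R * Y := by ring
  rw [e]
  linarith

end PLap

namespace PLap

lemma Sol.mono {p R R' δ δ' : ℝ} {u : ℂ → ℝ} (h : Sol p R δ u) (hR : R' ≤ R) (hδ : δ ≤ δ') : Sol p R' δ' u := by
  refine ⟨h.1, fun φ h1 h2 h3 => (h.2 φ h1 h2 (h3.trans (ball_subset_ball hR))).trans ?_⟩
  exact mul_le_mul_of_nonneg_right hδ (integral_nonneg fun _ => abs_nonneg _)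

/-- rescaled function -/
def resc (u : ℂ → ℝ) (x0 : ℂ) (l c Q : ℝ) : ℂ → ℝ := fun y => (u (x0 + l • y) - c) / Q

lemma resc_contDiff {u : ℂ → ℝ} (hu : ContDiff ℝ 1 u) (x0 : ℂ) (l c Q : ℝ) : ContDiff ℝ 1 (resc u x0 l c Q) := by
  unfold resc; fun_prop

lemma resc_hasFDerivAt {u : ℂ → ℝ} (hu : ContDiff ℝ 1 u) (x0 : ℂ) (l c Q : ℝ) (y : ℂ) :
    HasFDerivAt (resc u x0 l c Q) ((l / Q) • fderiv ℝ u (x0 + l • y)) y := by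
  have h1 : HasFDerivAt (fun y : ℂ => x0 + l • y) (l • ContinuousLinearMap.id ℝ ℂ) y :=
    ((hasFDerivAt_id y).const_smul l).const_add x0
  have h2 := ((hu.differentiable (by norm_num) _).hasFDerivAt.comp y h1).sub_const c
  have h3 := h2.const_mul Q⁻¹
  have e1 : resc u x0 l c Q = fun y => Q⁻¹ * ((u ∘ fun y => x0 + l • y) y - c) := by
    ext y; simp [resc, div_eq_inv_mul]
  have e2 : (l / Q) • fderiv ℝ u (x0 + l • y) =
      Q⁻¹ • (fderiv ℝ u (x0 + l • y)).comp (l • ContinuousLinearMap.id ℝ ℂ) := by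
    rw [ContinuousLinearMap.comp_smul, ContinuousLinearMap.comp_id, smul_smul]
    congr 1; rw [div_eq_inv_mul]
  rw [e1, e2]
  exact h3

lemma resc_cgrad {u : ℂ → ℝ} (hu : ContDiff ℝ 1 u) (x0 : ℂ) (l c Q : ℝ) (y : ℂ) :
    cgrad (resc u x0 l c Q) y = (l / Q) • cgrad u (x0 + l • y) := by
  unfold cgrad
  rw [(resc_hasFDerivAt hu x0 l c Q y).fderiv]
  apply Complex.ext <;> simp

lemma Aop_smul {p s : ℝ} (hs : 0 < s) (z : ℂ) : Aop p (s • z) = (s ^ (p - 1)) • Aop p z := by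
  unfold Aop
  rw [norm_smul, Real.norm_of_nonneg hs.le, mul_rpow hs.le (norm_nonneg _), smul_smul, smul_smul]
  congr 1
  rw [show p - 1 = (p - 2) + 1 by ring, rpow_add_one hs.ne']; ring

lemma int_resc (f : ℂ → ℝ) (x0 : ℂ) {l : ℝ} (hl : 0 < l) : ∫ y, f (x0 + l • y) = (l ^ 2)⁻¹ * ∫ x, f x := by
  rw [Measure.integral_comp_smul volume (fun y => f (x0 + y)) l, integral_add_left_eq_self f x0,
    Complex.finrank_real_complex, smul_eq_mul, abs_of_pos (by positivity)]

lemma Sol.rescale {p R R' δ l Q : ℝ} {u : ℂ → ℝ} (h : Sol p R δ u) {x0 : ℂ} (hl : 0 < l) (hQ : 0 < Q)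
    (hR : ‖x0‖ + l * R' ≤ R) (c : ℝ) : Sol p R' (δ * l ^ p / Q ^ (p - 1)) (resc u x0 l c Q) := by
  refine ⟨resc_contDiff h.1 _ _ _ _, fun φ h1 h2 h3 => ?_⟩
  set ψ : ℂ → ℝ := fun x => φ (l⁻¹ • (x - x0)) with hψ
  have hφ1 : ContDiff ℝ 1 φ := h1.of_le (by exact_mod_cast le_top)
  have hψs : ContDiff ℝ (⊤ : ℕ∞) ψ := h1.comp ((contDiff_id.sub contDiff_const).const_smul _)
  have hψ1 : ContDiff ℝ 1 ψ := hψs.of_le (by exact_mod_cast le_top)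
  have hinv : ∀ y : ℂ, l⁻¹ • (x0 + l • y - x0) = y := fun y => by
    rw [add_sub_cancel_left, smul_smul, inv_mul_cancel₀ hl.ne', one_smul]
  have hinv2 : ∀ x : ℂ, x0 + l • (l⁻¹ • (x - x0)) = x := fun x => by
    rw [smul_smul, mul_inv_cancel₀ hl.ne', one_smul, add_sub_cancel]
  have hcomp : φ = resc ψ x0 l 0 1 := by
    ext y; simp only [resc, hψ, hinv, sub_zero, div_one]
  have hG : ∀ y, cgrad φ y = l • cgrad ψ (x0 + l • y) := fun y => by
    conv_lhs => rw [hcomp]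
    rw [resc_cgrad hψ1, div_one]
  have hsupp : tsupport ψ ⊆ (fun y => x0 + l • y) '' tsupport φ := by
    apply closure_minimal
    · intro x hx
      refine ⟨l⁻¹ • (x - x0), subset_tsupport φ hx, hinv2 x⟩
    · exact ((show IsCompact (tsupport φ) from h2).image (by fun_prop)).isClosed
  have hψc : HasCompactSupport ψ :=
    HasCompactSupport.of_support_subset_isCompact ((show IsCompact (tsupport φ) from h2).image (by fun_prop))
      ((subset_tsupport ψ).trans hsupp)
  have hψb : tsupport ψ ⊆ ball 0 R := by
    refine hsupp.trans ?_
    rintro _ ⟨y, hy, rfl⟩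
    have hy' := h3 hy
    rw [mem_ball, dist_zero_right] at hy' ⊢
    refine (norm_add_le _ _).trans_lt ?_
    rw [norm_smul, Real.norm_of_nonneg hl.le]
    nlinarith
  have key := h.2 ψ hψs hψc hψb
  have e1 : ∫ z, |φ z| = (l ^ 2)⁻¹ * ∫ x, |ψ x| := by
    rw [← int_resc (fun x => |ψ x|) x0 hl]
    simp only [hψ, hinv]
  have e2 : ∫ z, dot (Aop p (cgrad (resc u x0 l c Q) z)) (cgrad φ z) =
      ((l / Q) ^ (p - 1) * l) * ((l ^ 2)⁻¹ * ∫ x, dot (Aop p (cgrad u x)) (cgrad ψ x)) := by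
    rw [← int_resc (fun x => dot (Aop p (cgrad u x)) (cgrad ψ x)) x0 hl, ← integral_const_mul]
    congr 1; ext y
    rw [resc_cgrad h.1, hG, Aop_smul (by positivity)]
    simp only [dot, Complex.smul_re, Complex.smul_im, smul_eq_mul]; ring
  rw [e1, e2, abs_mul, abs_of_pos (by positivity : 0 < (l / Q) ^ (p - 1) * l), abs_mul, abs_of_pos (by positivity : 0 < (l ^ 2)⁻¹)]
  have e3 : (l / Q) ^ (p - 1) * l = l ^ p / Q ^ (p - 1) := by
    rw [div_rpow hl.le hQ.le, show l ^ p = l ^ (p - 1) * l by rw [← rpow_add_one hl.ne']; congr 1; ring]; ring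
  rw [e3]
  calc _ ≤ l ^ p / Q ^ (p - 1) * ((l ^ 2)⁻¹ * (δ * ∫ z, |ψ z|)) := by gcongr
    _ = _ := by ring

lemma Fm_diff {p t : ℝ} (hp : 2 < p) (ht : 0 < t) (ht1 : t ≤ 1) (z : ℂ) : ‖Fm (p - 1) t z - Aop p z‖ ≤ 2 * t := by
  rcases le_total t ‖z‖ with h | h
  · rw [Aop_eq_Fm ht h, sub_self, norm_zero]; positivity
  · have h1 : t ^ (p - 2) ≤ 1 := rpow_le_one ht.le ht1 (by linarith)
    have h2 : wf (p - 1) t (‖z‖ ^ 2) ≤ 1 := by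
      refine (wf_le (L := t ^ 2) (by linarith) (by positivity) (by gcongr)).trans ?_
      rw [sq_rpow_half ht, show p - 1 - 1 = p - 2 by ring]; exact h1
    have h3 : ‖z‖ ^ (p - 2) ≤ 1 := rpow_le_one (norm_nonneg _) (by linarith) (by linarith)
    have h0 := wf_nonneg (b := p - 1) (t := t) (q := ‖z‖ ^ 2) (by positivity)
    refine (norm_sub_le _ _).trans ?_
    unfold Fm Aop
    rw [norm_smul, norm_smul, Real.norm_of_nonneg h0, Real.norm_of_nonneg (rpow_nonneg (norm_nonneg _) _)]
    have a1 := mul_le_mul h2 h (norm_nonneg _) zero_le_one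
    have a2 := mul_le_mul h3 h (norm_nonneg _) zero_le_one
    linarith

lemma norm_rE {r : ℝ} (hr : 0 ≤ r) (x : ℝ) : ‖(r:ℂ) * E x‖ = r := by
  rw [norm_mul, norm_E, mul_one, Complex.norm_real, Real.norm_of_nonneg hr]

set_option maxHeartbeats 1000000 in
lemma center {p L : ℝ} (hp : 2 < p) (hL : 0 < L) : ∃ C : ℝ, 0 ≤ C ∧ ∃ β : ℝ, 0 < β ∧ ∀ u : ℂ → ℝ, Sol p 2 1 u →
    (∀ z, ‖z‖ ≤ 1 → ‖cgrad u z‖ ≤ L) → ∀ r : ℝ, 0 < r → r ≤ 1 / 2 →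
    ∫ x in (-π)..π, ‖Aop p (cgrad u (r * E x)) - Aop p (cgrad u 0)‖ ^ 2 ≤ C * r ^ (2 * β) := by
  have hp1 : 0 < p - 1 := by linarith
  set β := 1 / (2 * (p - 1)) with hβ
  have hβ0 : 0 < β := by positivity
  have hβ1 : β < 1 := by rw [hβ, div_lt_one (by positivity)]; linarith
  obtain ⟨C, hC, H⟩ := master (b := p - 1) (K := p - 1) (κ := 1) (m := 0) (β := β) hp (by linarith) le_rfl hp1 zero_le_one le_rfl
    hβ0 hβ1 (struct_full (by linarith)) (by rw [hβ, mul_one, one_div_mul_eq_div, div_lt_one (by positivity)]; linarith) hL circle_zero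
  refine ⟨6 * C + 100 * π, by positivity, β, hβ0, fun u hu huL r hr hr2 => ?_⟩
  have hZ := cgrad_cont hu.1
  have hA : Continuous (Aop p) := Aop_cont hp
  set R := r ^ β with hR
  have hR0 : 0 < R := rpow_pos_of_pos hr _
  have hRR : r ^ (2 * β) = R ^ 2 := by rw [hR, ← rpow_natCast, ← rpow_mul hr.le]; congr 1; push_cast; ring
  obtain ⟨r1, hr1, hr1r, hW⟩ : ∃ r1 : ℝ, 0 < r1 ∧ r1 ≤ r ∧ ∀ x, ‖Aop p (cgrad u (r1 * E x)) - Aop p (cgrad u 0)‖ ≤ R := by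
    have hc : Continuous fun z => Aop p (cgrad u z) := hA.comp hZ
    obtain ⟨d, hd, hd'⟩ := Metric.continuous_iff.1 hc 0 R hR0
    refine ⟨min r (d / 2), by positivity, min_le_left _ _, fun x => ?_⟩
    rw [← dist_eq_norm]
    refine (hd' _ ?_).le
    rw [dist_zero_right, norm_rE (by positivity)]
    exact (min_le_right _ _).trans_lt (by linarith)
  obtain ⟨t, ht, ht1, htR, htr⟩ : ∃ t > 0, t ≤ 1 ∧ t ≤ R ∧ t ^ (p - 2) ≤ r1 ^ 2 := by
    refine ⟨min 1 (min R ((r1 ^ 2) ^ (1 / (p - 2)))), by positivity, min_le_left _ _, (min_le_right _ _).trans (min_le_left _ _), ?_⟩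
    have : min 1 (min R ((r1 ^ 2) ^ (1 / (p - 2)))) ≤ (r1 ^ 2) ^ (1 / (p - 2)) := (min_le_right _ _).trans (min_le_right _ _)
    refine (rpow_le_rpow (by positivity) this (by linarith)).trans (le_of_eq ?_)
    rw [← rpow_mul (by positivity), one_div_mul_cancel (by linarith), rpow_one]
  have k := H u 1 r1 t r zero_le_one hu huL hr1 hr1r hr2 ht
  rw [sub_self, mul_zero, rpow_zero, hRR] at k
  have k1 : (t ^ (p - 1 - 1)) ^ 2 * ((r1 ^ 2) ^ 2)⁻¹ ≤ 1 := by
    rw [mul_inv_le_iff₀ (by positivity), one_mul, show p - 1 - 1 = p - 2 by ring]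
    gcongr
  have k2 : C * R ^ 2 * (1 + (t ^ (p - 1 - 1)) ^ 2 * ((r1 ^ 2) ^ 2)⁻¹ + 1 * 1 ^ 2) ≤ C * R ^ 2 * 3 := by
    gcongr; linarith
  have hFc : Continuous (Fm (p - 1) t) := (Fm_id_contDiff ht).continuous
  have hE := continuous_E
  have k7 : ∫ x in (-π)..π, ‖Aop p (cgrad u (r * E x)) - Aop p (cgrad u 0)‖ ^ 2 ≤
      ∫ x in (-π)..π, (2 * ‖Fm (p - 1) t (cgrad u (r * E x)) - Fm (p - 1) t (cgrad u (r1 * E x))‖ ^ 2 + 50 * R ^ 2) := by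
    apply intervalIntegral.integral_mono_on (by linarith [pi_pos])
    · exact Continuous.intervalIntegrable (by fun_prop) _ _
    · exact Continuous.intervalIntegrable (by fun_prop) _ _
    · intro x _
      have n1 := Fm_diff hp ht ht1 (cgrad u (r * E x))
      have n2 := Fm_diff hp ht ht1 (cgrad u (r1 * E x))
      have n0 := hW x
      set f := Aop p (cgrad u (r * E x))
      set g := Aop p (cgrad u (r1 * E x))
      set f' := Fm (p - 1) t (cgrad u (r * E x))
      set g' := Fm (p - 1) t (cgrad u (r1 * E x))
      set w := Aop p (cgrad u 0)
      have n3 : ‖f - w‖ ≤ ‖f' - g'‖ + 5 * R := by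
        have : f - w = (f' - g') - (f' - f) + (g' - g) + (g - w) := by ring
        rw [this]
        have q1 := norm_add_le ((f' - g') - (f' - f) + (g' - g)) (g - w)
        have q2 := norm_add_le ((f' - g') - (f' - f)) (g' - g)
        have q3 := norm_sub_le (f' - g') (f' - f)
        linarith
      have n4 : ‖f - w‖ ^ 2 ≤ (‖f' - g'‖ + 5 * R) ^ 2 := pow_le_pow_left₀ (norm_nonneg _) n3 2
      nlinarith [sq_nonneg (‖f' - g'‖ - 5 * R)]
  have i1 : IntervalIntegrable (fun x => 2 * ‖Fm (p - 1) t (cgrad u (r * E x)) - Fm (p - 1) t (cgrad u (r1 * E x))‖ ^ 2) volume (-π) π :=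
    Continuous.intervalIntegrable (by fun_prop) _ _
  rw [intervalIntegral.integral_add i1 (by simp), intervalIntegral.integral_const_mul, intervalIntegral.integral_const, smul_eq_mul] at k7
  rw [hRR]
  have e : (6 * C + 100 * π) * R ^ 2 = 2 * (C * R ^ 2 * 3) + (π - -π) * (50 * R ^ 2) := by ring
  rw [e]
  linarith

end PLap

namespace PLap

lemma int_resc_ball (f : ℂ → ℝ) (x0 : ℂ) {l : ℝ} (hl : 0 < l) (ρ : ℝ) :
    ∫ y in ball (0:ℂ) ρ, f (x0 + l • y) = (l ^ 2)⁻¹ * ∫ x in ball x0 (l * ρ), f x := by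
  rw [← integral_indicator measurableSet_ball, ← integral_indicator measurableSet_ball, ← int_resc _ x0 hl]
  congr 1; ext y
  have : x0 + l • y ∈ ball x0 (l * ρ) ↔ y ∈ ball (0:ℂ) ρ := by
    rw [mem_ball, mem_ball, dist_zero_right, dist_eq_norm, add_sub_cancel_left, norm_smul, Real.norm_of_nonneg hl.le]
    exact mul_lt_mul_iff_right₀ hl
  by_cases h : y ∈ ball (0:ℂ) ρ
  · rw [Set.indicator_of_mem h, Set.indicator_of_mem (this.2 h)]
  · rw [Set.indicator_of_notMem h, Set.indicator_of_notMem (mt this.1 h)]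

/-- mean of `f` from mean of squares -/
lemma mean_le {f : ℝ → ℝ} (hf : Continuous f) {A : ℝ} (h : ∫ x in (-π)..π, f x ^ 2 ≤ A) :
    (∫ x in (-π)..π, f x) ^ 2 ≤ 2 * π * A := by
  have := cs_one f hf (-π) π (by linarith [pi_pos])
  have h2 : (π - -π) * (∫ x in (-π)..π, f x ^ 2) ≤ (π - -π) * A :=
    mul_le_mul_of_nonneg_left h (by linarith [pi_pos])
  calc _ ≤ _ := this
    _ ≤ _ := h2
    _ = _ := by ring

lemma exists_small {a K : ℝ} (ha : 0 < a) (hK : 0 < K) (C : ℝ) (hC : 0 ≤ C) : ∃ s : ℝ, 0 < s ∧ s ≤ 1 / 2 ∧ C * s ^ a ≤ K := by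
  refine ⟨min (1 / 2) ((K / (C + 1)) ^ (1 / a)), by positivity, min_le_left _ _, ?_⟩
  have h1 : (min (1 / 2) ((K / (C + 1)) ^ (1 / a))) ^ a ≤ K / (C + 1) := by
    refine (rpow_le_rpow (by positivity) (min_le_right _ _) ha.le).trans (le_of_eq ?_)
    rw [← rpow_mul (by positivity), one_div_mul_cancel ha.ne', rpow_one]
  calc _ ≤ (C + 1) * (K / (C + 1)) := by gcongr; linarith
    _ = K := by field_simp

set_option maxHeartbeats 1000000 in
lemma lower {p : ℝ} (hp : 2 < p) : ∃ c0 : ℝ, 0 < c0 ∧ ∀ v : ℂ → ℝ, Sol p 2 1 v → (∀ z, ‖z‖ ≤ 1 → ‖cgrad v z‖ ≤ 8) →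
    ‖cgrad v 0‖ = 1 → c0 ≤ ∫ z in ball (0:ℂ) 1, |v z| := by
  obtain ⟨C, hC, β, hβ, H⟩ := center hp (by norm_num : (0:ℝ) < 8)
  obtain ⟨s, hs, hs2, hsC⟩ := exists_small (by positivity : 0 < 2 * β) (by positivity : 0 < π ^ 2) (2 * π * (4 * C)) (by positivity)
  set ψ : ℂ → ℝ := fun z => posq (s ^ 2 - ‖z‖ ^ 2) with hψ
  have hψ1 : ContDiff ℝ 1 ψ := posq_contDiff.comp (contDiff_const.sub (contDiff_normSq contDiff_id))
  have hψ0 : ∀ z, 0 ≤ ψ z := fun z => posq_nonneg _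
  have hψz : ∀ z, s ≤ ‖z‖ → ψ z = 0 := fun z hz => posq_of_nonpos (by
    have := pow_le_pow_left₀ hs.le hz 2; linarith)
  have hψc : HasCompactSupport ψ := compact_of_zero (fun z hz => hψz z hz.le)
  have hψi : 0 < ∫ z, ψ z := by
    refine hψ1.continuous.integral_pos_of_hasCompactSupport_nonneg_nonzero hψc hψ0 (x := 0) ?_
    simp only [hψ, norm_zero]
    have : 0 < s ^ 2 := by positivity
    rw [posq_of_nonneg (by nlinarith)]
    intro h; nlinarith [pow_pos this 2]
  have hfc : Continuous (cgrad ψ) := cgrad_cont hψ1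
  obtain ⟨N, hN⟩ := (isCompact_closedBall (0:ℂ) 1).exists_bound_of_continuousOn hfc.continuousOn
  have hN0 : 0 ≤ N := (norm_nonneg _).trans (hN 0 (by simp))
  refine ⟨(1 / 2 * ∫ z, ψ z) / (N + 1), by positivity, fun v hv hvL hv0 => ?_⟩
  have hZ := cgrad_cont hv.1
  set e := cgrad v 0 with he
  have hA : Continuous (Aop p) := Aop_cont hp
  have hE := continuous_E
  have hvc := hv.1.continuous
  have hψcc := hψ1.continuous
  have hclose : ∀ z, ‖cgrad v z - e‖ ≤ 2 * ‖Aop p (cgrad v z) - Aop p e‖ := fun z => by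
    have h1 := mono_A hp e (cgrad v z)
    rw [hv0, one_rpow, mul_one] at h1
    have h2 := (le_abs_self _).trans (abs_dot_le (Aop p (cgrad v z) - Aop p e) (cgrad v z - e))
    by_contra hh
    push Not at hh
    have : 0 < ‖cgrad v z - e‖ := lt_of_le_of_lt (by positivity) hh
    nlinarith
  have key : 0 ≤ ∫ z, ψ z * (1 / 2 - ‖cgrad v z - e‖) := by
    apply polar_nonneg
    intro r hr
    rcases le_total s r with h | h
    · have : ∀ x, ψ (r * E x) = 0 := fun x => hψz _ (by rwa [norm_rE hr.le])
      simp [this]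
    · have : ∀ x, ψ (r * E x) = posq (s ^ 2 - r ^ 2) := fun x => by
        simp only [hψ, norm_rE hr.le]
      simp only [this, intervalIntegral.integral_const_mul]
      apply mul_nonneg (posq_nonneg _)
      have h1 := H v hv hvL r hr (h.trans hs2)
      have h2 : ∫ x in (-π)..π, ‖cgrad v (r * E x) - e‖ ^ 2 ≤ 4 * (C * r ^ (2 * β)) := by
        refine le_trans ?_ (mul_le_mul_of_nonneg_left h1 (by norm_num : (0:ℝ) ≤ 4))
        rw [← intervalIntegral.integral_const_mul]
        apply intervalIntegral.integral_mono_on (by linarith [pi_pos])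
        · exact Continuous.intervalIntegrable (by fun_prop) _ _
        · exact Continuous.intervalIntegrable (by fun_prop) _ _
        · intro x _
          have := pow_le_pow_left₀ (norm_nonneg _) (hclose (r * E x)) 2
          rw [mul_pow] at this
          linarith
      have h3 := mean_le (by fun_prop : Continuous fun x => ‖cgrad v (r * E x) - e‖) h2
      have h4 : r ^ (2 * β) ≤ s ^ (2 * β) := rpow_le_rpow hr.le h (by positivity)
      have h5 : 2 * π * (4 * (C * r ^ (2 * β))) ≤ π ^ 2 := by
        refine le_trans ?_ hsC
        rw [mul_assoc (2 * π), mul_assoc 4]; gcongr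
      have h6 : ∫ x in (-π)..π, ‖cgrad v (r * E x) - e‖ ≤ π :=
        (abs_le_of_sq_le_sq' (h3.trans h5) pi_pos.le).2
      rw [intervalIntegral.integral_sub (by simp) (Continuous.intervalIntegrable (by fun_prop) _ _),
        intervalIntegral.integral_const, smul_eq_mul]
      linarith
  have iψ : ∀ g : ℂ → ℝ, Continuous g → Integrable fun z => ψ z * g z := fun g hg =>
    Continuous.integrable_of_hasCompactSupport (by fun_prop) hψc.mul_right
  have e1 : ∫ z, ψ z * (1 / 2 - ‖cgrad v z - e‖) ≤ ∫ z, (ψ z * dot (cgrad v z) e - ψ z * (1 / 2)) := by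
    apply integral_mono (iψ _ (by fun_prop)) ((iψ _ (by fun_prop)).sub (iψ _ (by fun_prop)))
    intro z
    have q1 : dot (cgrad v z) e = 1 + dot (cgrad v z - e) e := by
      have := norm_sq_eq e
      rw [hv0] at this
      simp only [dot, Complex.sub_re, Complex.sub_im]; linarith
    have q2 := (abs_le.1 (abs_dot_le (cgrad v z - e) e)).1
    rw [hv0, mul_one] at q2
    have q3 := mul_le_mul_of_nonneg_left (by linarith : 1 / 2 - ‖cgrad v z - e‖ ≤ dot (cgrad v z) e - 1 / 2) (hψ0 z)
    change ψ z * (1 / 2 - ‖cgrad v z - e‖) ≤ ψ z * dot (cgrad v z) e - ψ z * (1 / 2)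
    rw [mul_sub (ψ z) (dot _ _)] at q3
    exact q3
  rw [integral_sub (iψ _ (by fun_prop)) (iψ _ (by fun_prop)), integral_mul_const] at e1
  have e2 := ibp ψ v hψ1 hψc hv.1 e
  simp only [fderiv_apply_dot] at e2
  have e3 : |∫ z, dot (cgrad ψ z) e * v z| ≤ N * ∫ z in ball (0:ℂ) 1, |v z| := by
    have hz : ∀ z, z ∉ ball (0:ℂ) 1 → dot (cgrad ψ z) e * v z = 0 := fun z hz => by
      rw [mem_ball, dist_zero_right, not_lt] at hz
      rw [cgrad_zero (s := s) (fun z hz => hψz z hz.le) (by linarith)]; simp [dot]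
    rw [← setIntegral_eq_integral_of_forall_compl_eq_zero hz, ← integral_const_mul, ← Real.norm_eq_abs]
    have hi : IntegrableOn (fun z => N * |v z|) (ball (0:ℂ) 1) :=
      ((by fun_prop : Continuous fun z => N * |v z|).continuousOn.integrableOn_compact (isCompact_closedBall _ _)).mono_set ball_subset_closedBall
    apply norm_integral_le_of_norm_le hi
    filter_upwards [ae_restrict_mem measurableSet_ball] with z hz
    rw [Real.norm_eq_abs, abs_mul]
    apply mul_le_mul_of_nonneg_right _ (abs_nonneg _)
    have := abs_dot_le (cgrad ψ z) e
    rw [hv0, mul_one] at this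
    exact this.trans (hN z (ball_subset_closedBall hz))
  set J := ∫ z in ball (0:ℂ) 1, |v z|
  have hJ : 0 ≤ J := integral_nonneg fun _ => abs_nonneg _
  have e4 := neg_abs_le (∫ z, dot (cgrad ψ z) e * v z)
  rw [div_le_iff₀ (by positivity)]
  linarith

lemma gradbound {p : ℝ} (hp : 2 < p) : ∃ CA : ℝ, 0 < CA ∧ ∀ v : ℂ → ℝ, Sol p 1 1 v → ∫ z in ball (0:ℂ) 1, |v z| ≤ 4 →
    ∀ z, ‖z‖ ≤ 1 / 2 → ‖cgrad v z‖ ≤ CA := by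
  obtain ⟨c0, hc0, H⟩ := lower hp
  refine ⟨8 * (1 + 32 / c0), by positivity, fun v hv hv4 z hz => ?_⟩
  have hZ := cgrad_cont hv.1
  obtain ⟨x0, hx0, hmax⟩ := (isCompact_closedBall (0:ℂ) 1).exists_isMaxOn ⟨0, by simp⟩
    (by fun_prop : Continuous fun x : ℂ => (1 - ‖x‖) ^ 3 * ‖cgrad v x‖).continuousOn
  rw [mem_closedBall, dist_zero_right] at hx0
  have hm : ∀ x : ℂ, ‖x‖ ≤ 1 → (1 - ‖x‖) ^ 3 * ‖cgrad v x‖ ≤ (1 - ‖x0‖) ^ 3 * ‖cgrad v x0‖ := fun x hx =>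
    hmax (by rwa [mem_closedBall, dist_zero_right])
  set d := 1 - ‖x0‖ with hd
  set M := ‖cgrad v x0‖ with hM
  have hM0 : 0 ≤ M := norm_nonneg _
  have hd0 : 0 ≤ d := by linarith
  have hd1 : d ≤ 1 := by linarith [norm_nonneg x0]
  have main : d ^ 3 * M ≤ 1 + 32 / c0 := by
    have hq : 0 < 32 / c0 := by positivity
    rcases le_total M 1 with h | h
    · have : d ^ 3 * M ≤ 1 * 1 := mul_le_mul (pow_le_one₀ hd0 hd1) h hM0 zero_le_one
      linarith
    rcases hd0.eq_or_lt with h0 | h0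
    · rw [← h0]; norm_num; positivity
    set l := d / 2 with hl
    have hl0 : 0 < l := by positivity
    have hQ : 0 < l * M := by positivity
    have h1 := hv.rescale (R' := 2) (x0 := x0) hl0 hQ (by rw [hl]; linarith) 0
    have h2 : 1 * l ^ p / (l * M) ^ (p - 1) ≤ 1 := by
      rw [div_le_one (by positivity), one_mul]
      have a1 : l ^ p ≤ l ^ (p - 1) := rpow_le_rpow_of_exponent_ge hl0 (by linarith) (by linarith)
      refine a1.trans ?_
      rw [mul_rpow hl0.le hM0]
      exact le_mul_of_one_le_right (by positivity) (one_le_rpow h (by linarith))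
    have h3 := H _ (h1.mono le_rfl h2) (fun y hy => ?_) ?_
    · simp only [resc, sub_zero, abs_div, abs_of_pos hQ] at h3
      rw [integral_div, int_resc_ball (fun x => |v x|) x0 hl0] at h3
      have h4 : ∫ x in ball x0 (l * 1), |v x| ≤ 4 := by
        refine le_trans (setIntegral_mono_set ?_ ?_ ?_) hv4
        · have hvc := hv.1.continuous
          exact ((by fun_prop : Continuous fun z => |v z|).continuousOn.integrableOn_compact (isCompact_closedBall _ _)).mono_set ball_subset_closedBall
        · filter_upwards with x using abs_nonneg _
        · apply HasSubset.Subset.eventuallyLE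
          apply ball_subset_ball'
          rw [dist_zero_right]; linarith
      have h5 : c0 ≤ (l ^ 2)⁻¹ * 4 / (l * M) := by
        refine h3.trans ?_
        gcongr
      have h6 : (l ^ 2)⁻¹ * 4 / (l * M) = 32 / (d ^ 3 * M) := by rw [hl]; field_simp; norm_num
      rw [h6, le_div_iff₀ (by positivity)] at h5
      have : d ^ 3 * M ≤ 32 / c0 := by rw [le_div_iff₀ hc0]; linarith
      linarith
    · rw [resc_cgrad hv.1, norm_smul, Real.norm_of_nonneg (by positivity)]
      have n1 : ‖x0 + l • y‖ ≤ ‖x0‖ + l := by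
        refine (norm_add_le _ _).trans ?_
        rw [norm_smul, Real.norm_of_nonneg hl0.le]
        nlinarith
      have n2 := hm (x0 + l • y) (by linarith)
      have n3 : l ^ 3 * ‖cgrad v (x0 + l • y)‖ ≤ (1 - ‖x0 + l • y‖) ^ 3 * ‖cgrad v (x0 + l • y)‖ := by
        gcongr; linarith
      have n4 : l ^ 3 * ‖cgrad v (x0 + l • y)‖ ≤ l ^ 3 * (8 * M) := by
        have : d ^ 3 * M = l ^ 3 * (8 * M) := by rw [hl]; ring
        linarith
      have n5 := le_of_mul_le_mul_left n4 (by positivity)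
      have n6 : l / (l * M) = 1 / M := by field_simp
      rw [n6, one_div_mul_eq_div, div_le_iff₀ (by linarith)]
      exact n5
    · rw [resc_cgrad hv.1, norm_smul, Real.norm_of_nonneg (by positivity), smul_zero, add_zero, ← hM]
      field_simp
  have h1 := hm z (by linarith)
  have h2 : (1 / 2 : ℝ) ^ 3 * ‖cgrad v z‖ ≤ (1 - ‖z‖) ^ 3 * ‖cgrad v z‖ := by
    gcongr; linarith
  linarith

end PLap

namespace PLap

lemma pw_interp {x a m n : ℝ} (hx : 0 ≤ x) (ha : 0 < a) (hm : 0 ≤ m) (hmn : m ≤ n) :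
    x ^ m ≤ a ^ m + a ^ (m - n) * x ^ n := by
  rcases le_total x a with h | h
  · have := rpow_le_rpow hx h hm
    have h2 : 0 ≤ a ^ (m - n) * x ^ n := by positivity
    linarith
  · have hx0 : 0 < x := ha.trans_le h
    have h1 : x ^ m = x ^ (m - n) * x ^ n := by rw [← rpow_add hx0]; congr 1; ring
    have h2 : x ^ (m - n) ≤ a ^ (m - n) := rpow_le_rpow_of_nonpos ha h (by linarith)
    have h3 : 0 ≤ a ^ m := by positivity
    have h4 : x ^ (m - n) * x ^ n ≤ a ^ (m - n) * x ^ n := by gcongr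
    linarith

lemma ray {w : ℂ → ℝ} (hw : ContDiff ℝ 1 w) {A r0 : ℝ}
    (h : ∀ s : ℝ, 0 < s → s ≤ r0 → ∫ x in (-π)..π, ‖cgrad w (s * E x)‖ ≤ A) {r : ℝ} (hr : 0 < r) (hr0 : r ≤ r0) :
    ∫ x in (-π)..π, |w (r * E x) - w 0| ≤ r * A := by
  have hZ := cgrad_cont hw
  have hE := continuous_E
  have hwc := hw.continuous
  have hpi : -π ≤ π := by linarith [pi_pos]
  have hcj : Continuous fun q : ℝ × ℝ => ‖cgrad w (q.2 * E q.1)‖ := by fun_prop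
  have h1 : ∀ x : ℝ, |w (r * E x) - w 0| ≤ ∫ s in (0:ℝ)..r, ‖cgrad w (s * E x)‖ := fun x => by
    have hd : ∀ s : ℝ, HasDerivAt (fun s : ℝ => w (s * E x)) (dot (cgrad w (s * E x)) (E x)) s := fun s => by
      have h1 : HasFDerivAt w (fderiv ℝ w (s * E x)) (s * E x) :=
        ((hw.differentiable (by norm_num)) _).hasFDerivAt
      have h2 : HasDerivAt (fun r : ℝ => (r : ℂ) * E x) (1 * E x) s :=
        (Complex.ofRealCLM.hasDerivAt (x := s)).mul_const (E x)
      have := h1.comp_hasDerivAt s h2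
      rw [one_mul, fderiv_apply_dot] at this
      exact this
    have hcd : Continuous fun s : ℝ => dot (cgrad w (s * E x)) (E x) := by
      unfold dot
      fun_prop
    have := intervalIntegral.integral_eq_sub_of_hasDerivAt (a := 0) (b := r) (fun s _ => hd s) (hcd.intervalIntegrable _ _)
    simp only [Complex.ofReal_zero, zero_mul] at this
    rw [← this, ← Real.norm_eq_abs]
    apply intervalIntegral.norm_integral_le_of_norm_le hr.le
    · filter_upwards with s _
      have := abs_dot_le (cgrad w (s * E x)) (E x)
      rwa [norm_E, mul_one] at this
    · exact Continuous.intervalIntegrable (by fun_prop) _ _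
  have h_intg : IntegrableOn (Function.uncurry fun x s : ℝ => ‖cgrad w (s * E x)‖) (Set.uIoc (-π) π ×ˢ Set.uIoc 0 r) := by
    rw [Set.uIoc_of_le hpi, Set.uIoc_of_le hr.le]
    refine (hcj.continuousOn.integrableOn_compact (isCompact_Icc.prod isCompact_Icc (s := Set.Icc (-π) π) (t := Set.Icc 0 r))).mono_set ?_
    exact Set.prod_mono Set.Ioc_subset_Icc_self Set.Ioc_subset_Icc_self
  calc ∫ x in (-π)..π, |w (r * E x) - w 0| ≤ ∫ x in (-π)..π, ∫ s in (0:ℝ)..r, ‖cgrad w (s * E x)‖ := by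
        apply intervalIntegral.integral_mono_on hpi
        · exact Continuous.intervalIntegrable (by fun_prop) _ _
        · exact (intervalIntegral.continuous_parametric_intervalIntegral_of_continuous' hcj 0 r).intervalIntegrable _ _
        · exact fun x _ => h1 x
    _ = ∫ s in (0:ℝ)..r, ∫ x in (-π)..π, ‖cgrad w (s * E x)‖ := intervalIntegral_intervalIntegral_swap h_intg
    _ ≤ ∫ s in (0:ℝ)..r, A := by
        apply intervalIntegral.integral_mono_on_of_le_Ioo hr.le
        · have : Continuous fun q : ℝ × ℝ => ‖cgrad w (q.1 * E q.2)‖ := by fun_prop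
          exact (intervalIntegral.continuous_parametric_intervalIntegral_of_continuous' this (-π) π).intervalIntegrable _ _
        · simp
        · exact fun s hs => h s hs.1 (hs.2.le.trans hr0)
    _ = r * A := by simp

lemma ray_ball {w : ℂ → ℝ} (hw : ContDiff ℝ 1 w) {A r0 : ℝ} (hr0 : 0 < r0) (hA : 0 ≤ A)
    (h : ∀ s : ℝ, 0 < s → s ≤ r0 → ∫ x in (-π)..π, ‖cgrad w (s * E x)‖ ≤ A) :
    ∫ z in ball (0:ℂ) r0, |w z - w 0| ≤ A * r0 ^ 3 := by
  have hE := continuous_E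
  have hwc := hw.continuous
  have key : 0 ≤ ∫ z, (ball (0:ℂ) r0).indicator (fun z => r0 * A / (2 * π) - |w z - w 0|) z := by
    apply polar_nonneg
    intro r hr
    rcases lt_or_ge r r0 with h1 | h1
    · have : ∀ x, (ball (0:ℂ) r0).indicator (fun z => r0 * A / (2 * π) - |w z - w 0|) (r * E x) = r0 * A / (2 * π) - |w (r * E x) - w 0| :=
        fun x => Set.indicator_of_mem (by rw [mem_ball, dist_zero_right, norm_rE hr.le]; exact h1) _
      simp only [this]
      rw [intervalIntegral.integral_sub (by simp) (Continuous.intervalIntegrable (by fun_prop) _ _),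
        intervalIntegral.integral_const, smul_eq_mul]
      have h2 := ray hw h hr h1.le
      have h3 : (π - -π) * (r0 * A / (2 * π)) = r0 * A := by field_simp [pi_pos.ne']; ring
      have h4 : r * A ≤ r0 * A := by gcongr
      linarith
    · have : ∀ x, (ball (0:ℂ) r0).indicator (fun z => r0 * A / (2 * π) - |w z - w 0|) (r * E x) = 0 :=
        fun x => Set.indicator_of_notMem (by rw [mem_ball, dist_zero_right, norm_rE hr.le]; exact not_lt.2 h1) _
      simp [this]
  rw [integral_indicator measurableSet_ball] at key
  have hi : IntegrableOn (fun z => |w z - w 0|) (ball (0:ℂ) r0) :=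
      ((by fun_prop : Continuous fun z => |w z - w 0|).continuousOn.integrableOn_compact (isCompact_closedBall _ _)).mono_set ball_subset_closedBall
  have hi2 : IntegrableOn (fun z => r0 * A / (2 * π)) (ball (0:ℂ) r0) :=
      (continuousOn_const.integrableOn_compact (isCompact_closedBall _ _)).mono_set ball_subset_closedBall
  rw [integral_sub hi2 hi, setIntegral_const, smul_eq_mul] at key
  have hv : volume.real (ball (0:ℂ) r0) ≤ π * r0 ^ 2 := by
    rw [← vol_ball hr0.le]
    exact measureReal_mono ball_subset_closedBall (isCompact_closedBall _ _).measure_lt_top.ne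
  have h2 : volume.real (ball (0:ℂ) r0) * (r0 * A / (2 * π)) ≤ π * r0 ^ 2 * (r0 * A / (2 * π)) := by gcongr
  have h3 : π * r0 ^ 2 * (r0 * A / (2 * π)) = A * r0 ^ 3 / 2 := by field_simp
  have h4 : 0 ≤ A * r0 ^ 3 := by positivity
  linarith

lemma norm_Aop {p : ℝ} (hp : 2 < p) (z : ℂ) : ‖Aop p z‖ = ‖z‖ ^ (p - 1) := by
  unfold Aop
  rw [norm_smul, Real.norm_of_nonneg (by positivity)]
  nth_rewrite 2 [← rpow_one ‖z‖]
  rw [← rpow_add' (norm_nonneg _) (by linarith)]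
  congr 1; ring

lemma sq_rpow {x m : ℝ} (hx : 0 ≤ x) : (x ^ m) ^ 2 = x ^ (2 * m) := by
  rw [← rpow_natCast, ← rpow_mul hx]; congr 1; push_cast; ring

lemma Fm_le {b t : ℝ} (hb : 1 ≤ b) (z : ℂ) : ‖Fm b t z‖ ^ 2 ≤ ‖z‖ ^ (2 * b) := by
  unfold Fm
  rcases (norm_nonneg z).eq_or_lt with h | h
  · rw [norm_smul, ← h, mul_zero]; simp only [ne_eq, OfNat.ofNat_ne_zero, not_false_eq_true, zero_pow]; positivity
  rw [norm_smul, Real.norm_of_nonneg (wf_nonneg (by positivity)), ← sq_rpow h.le]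
  apply pow_le_pow_left₀ (mul_nonneg (wf_nonneg (by positivity)) h.le)
  have := wf_le (t := t) hb (by positivity : 0 ≤ ‖z‖ ^ 2) le_rfl
  rw [sq_rpow_half h] at this
  calc _ ≤ ‖z‖ ^ (b - 1) * ‖z‖ := by gcongr
    _ = _ := by nth_rewrite 2 [← rpow_one ‖z‖]; rw [← rpow_add h]; congr 1; ring

lemma Fm_ge {b t : ℝ} (hb : 1 ≤ b) (ht : 0 < t) (z : ℂ) : ‖z‖ ^ (2 * b) ≤ ‖Fm b t z‖ ^ 2 + t ^ (2 * b) := by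
  rcases le_total t ‖z‖ with h | h
  · have h0 : 0 < ‖z‖ := ht.trans_le h
    have : ‖Fm b t z‖ = ‖z‖ ^ b := by
      unfold Fm wf
      rw [zt_one (by rw [le_div_iff₀ (by positivity), one_mul]; gcongr), sq_rpow_half h0, mul_one, norm_smul,
        Real.norm_of_nonneg (by positivity)]
      nth_rewrite 2 [← rpow_one ‖z‖]; rw [← rpow_add h0]; congr 1; ring
    rw [this, sq_rpow h0.le]
    have : 0 ≤ t ^ (2 * b) := by positivity
    linarith
  · have := rpow_le_rpow (norm_nonneg z) h (by linarith : 0 ≤ 2 * b)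
    nlinarith [sq_nonneg ‖Fm b t z‖]

lemma norm_sq_le_two (a b : ℂ) : ‖a‖ ^ 2 ≤ 2 * ‖a - b‖ ^ 2 + 2 * ‖b‖ ^ 2 := by
  have h : ‖a‖ ≤ ‖a - b‖ + ‖b‖ := by simpa using norm_add_le (a - b) b
  have := pow_le_pow_left₀ (norm_nonneg _) h 2
  nlinarith [sq_nonneg (‖a - b‖ - ‖b‖)]

end PLap

namespace PLap

lemma imono {f g : ℝ → ℝ} (hf : Continuous f) (hg : Continuous g) (h : ∀ x, f x ≤ g x) :
    ∫ x in (-π)..π, f x ≤ ∫ x in (-π)..π, g x :=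
  intervalIntegral.integral_mono_on (by linarith [pi_pos]) (hf.intervalIntegrable _ _) (hg.intervalIntegrable _ _) fun x _ => h x

lemma iaff {f : ℝ → ℝ} (hf : Continuous f) (c d : ℝ) :
    ∫ x in (-π)..π, (c + d * f x) = 2 * π * c + d * ∫ x in (-π)..π, f x := by
  rw [intervalIntegral.integral_add (by simp) (Continuous.intervalIntegrable (by fun_prop) _ _),
    intervalIntegral.integral_const, intervalIntegral.integral_const_mul, smul_eq_mul]
  ring

lemma iaff2 {f g : ℝ → ℝ} (hf : Continuous f) (hg : Continuous g) (c d e : ℝ) :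
    ∫ x in (-π)..π, (c + d * f x + e * g x) = 2 * π * c + d * (∫ x in (-π)..π, f x) + e * ∫ x in (-π)..π, g x := by
  rw [intervalIntegral.integral_add (Continuous.intervalIntegrable (by fun_prop) _ _) (Continuous.intervalIntegrable (by fun_prop) _ _),
    intervalIntegral.integral_const_mul, iaff hf]

lemma exists_rpow_le {a K : ℝ} (ha : 0 < a) (hK : 0 < K) {M : ℝ} (hM : 0 < M) (C : ℝ) (hC : 0 ≤ C) :
    ∃ s : ℝ, 0 < s ∧ s ≤ M ∧ s ≤ 1 / 2 ∧ ∀ x, 0 ≤ x → x ≤ s → C * x ^ a ≤ K := by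
  obtain ⟨s, h1, h2, h3⟩ := exists_small ha hK C hC
  refine ⟨min s M, by positivity, min_le_right _ _, (min_le_left _ _).trans h2, fun x hx hxs => ?_⟩
  refine le_trans ?_ h3
  have := rpow_le_rpow hx (hxs.trans (min_le_left _ _)) ha.le
  gcongr

set_option maxHeartbeats 1000000 in
lemma circ_small {p L : ℝ} (hp : 2 < p) (hL : 0 < L) : ∃ C : ℝ, 0 ≤ C ∧ ∃ γ : ℝ, 1 / (p - 1) < γ ∧
    ∀ r0 : ℝ, 0 < r0 → r0 ≤ 1 / 2 → ∃ ε : ℝ, 0 < ε ∧ ∃ δ : ℝ, 0 < δ ∧ ∀ w : ℂ → ℝ, Sol p 2 δ w →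
      (∀ z, ‖z‖ ≤ 1 → ‖cgrad w z‖ ≤ L) → ‖cgrad w 0‖ ≤ ε → ∀ s : ℝ, 0 < s → s ≤ r0 →
      ∫ x in (-π)..π, ‖cgrad w (s * E x)‖ ≤ C * r0 ^ γ := by
  obtain ⟨C1, hC1, β1, hβ1, H1⟩ := center hp hL
  set k := √(p - 1) with hk
  have hk1 : 1 < k := by rw [hk, lt_sqrt (by norm_num)]; linarith
  have hk2 : k ^ 2 = p - 1 := sq_sqrt (by linarith)
  have hk0 : 0 < k := by linarith
  have hkp : k ≤ p - 1 := by nlinarith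
  have hm0 : 0 < (k ^ 2 - 1) / k ^ 2 := div_pos (by nlinarith) (by positivity)
  obtain ⟨κ, hκ0, hκ1, hcirc⟩ := circle_pos _ hm0
  have hstr := struct_sqrt hk1
  rw [hk2] at hstr hcirc hm0
  obtain ⟨β, hβ1', hβ2⟩ : ∃ β, 1 / k < β ∧ β < min 1 (1 / (κ * k)) := by
    apply exists_between
    apply lt_min
    · rw [div_lt_one hk0]; exact hk1
    · apply one_div_lt_one_div_of_lt (by positivity)
      nlinarith
  have hβ0 : 0 < β := lt_trans (by positivity) hβ1'
  have hβlt : β < 1 := hβ2.trans_le (min_le_left _ _)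
  have hβκ : β * κ * k < 1 := by
    have := hβ2.trans_le (min_le_right _ _)
    rw [lt_div_iff₀ (by positivity)] at this
    linarith
  obtain ⟨C2, hC2, H2⟩ := master hp hk1.le hkp hk0 hκ0.le hm0.le hβ0 hβlt hstr hβκ hL hcirc
  refine ⟨6 * C2 + 40, by linarith, β / k, ?_, fun r0 hr0 hr02 => ?_⟩
  · rw [← hk2, div_lt_div_iff₀ (by positivity) hk0]
    rw [div_lt_iff₀ hk0] at hβ1'
    nlinarith
  set a := r0 ^ (β / k) with ha
  have ha0 : 0 < a := by positivity
  have hak : a ^ (2 * k) = r0 ^ (2 * β) := by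
    rw [ha, ← rpow_mul hr0.le]; congr 1; field_simp
  have hap : 0 < a ^ (2 * (p - 1)) := by positivity
  obtain ⟨r1, hr1, hr1a, hr1b, hr1c⟩ := exists_rpow_le (by positivity : 0 < 2 * β1) (by positivity : 0 < a ^ (2 * (p - 1)) / 2) hr0 (2 * C1) (by positivity)
  obtain ⟨ε, hε, -, -, hεc⟩ := exists_rpow_le (by linarith : 0 < 2 * (p - 1)) (by positivity : 0 < a ^ (2 * (p - 1)) / 2) zero_lt_one (4 * π) (by positivity)
  obtain ⟨t, ht, hta, -, htc⟩ := exists_rpow_le (by linarith : 0 < k - 1) (by positivity : 0 < r1 ^ 2) ha0 1 zero_le_one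
  have htp : 0 < t ^ (-(k - (p - 1))) := by positivity
  refine ⟨ε, hε, min 1 (t ^ (-(k - (p - 1)))), by positivity, fun w hw hwL hw0 s hs hsr => ?_⟩
  set δ := min 1 (t ^ (-(k - (p - 1)))) with hδ
  have hδ0 : 0 < δ := by positivity
  have hZ := cgrad_cont hw.1
  have hE := continuous_E
  have hA : Continuous (Aop p) := Aop_cont hp
  have hF : Continuous (Fm k t) := (Fm_id_contDiff ht).continuous
  have hrk : Continuous fun x : ℝ => x ^ (2 * k) := continuous_id.rpow_const fun x => Or.inr (by positivity)
  have hpi4 : π ≤ 4 := pi_le_four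
  have hak0 : 0 < a ^ (2 * k) := by positivity
  -- small radii
  have S1 : ∀ s : ℝ, 0 < s → s ≤ r1 → ∫ x in (-π)..π, ‖cgrad w (s * E x)‖ ^ (2 * k) ≤ 9 * a ^ (2 * k) := by
    intro s hs hsr1
    have h1 := H1 w (hw.mono le_rfl (min_le_left _ _)) hwL s hs (hsr1.trans hr1b)
    have h2 := hr1c s hs.le hsr1
    have h3 := hεc _ (norm_nonneg _) hw0
    have pw : ∀ x, ‖cgrad w (s * E x)‖ ^ (2 * k) ≤ (a ^ (2 * k) + a ^ (2 * k - 2 * (p - 1)) * (2 * ‖cgrad w 0‖ ^ (2 * (p - 1)))) +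
        a ^ (2 * k - 2 * (p - 1)) * 2 * ‖Aop p (cgrad w (s * E x)) - Aop p (cgrad w 0)‖ ^ 2 := fun x => by
      have e1 := pw_interp (norm_nonneg (cgrad w (s * E x))) ha0 (by positivity : 0 ≤ 2 * k) (by linarith : 2 * k ≤ 2 * (p - 1))
      have e2 := norm_sq_le_two (Aop p (cgrad w (s * E x))) (Aop p (cgrad w 0))
      rw [norm_Aop hp, norm_Aop hp, sq_rpow (norm_nonneg _), sq_rpow (norm_nonneg _)] at e2
      have e3 : 0 ≤ a ^ (2 * k - 2 * (p - 1)) := by positivity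
      have e4 := mul_le_mul_of_nonneg_left e2 e3
      linarith
    refine (imono (by fun_prop) (by fun_prop) pw).trans ?_
    rw [iaff (by fun_prop)]
    have e5 : a ^ (2 * k - 2 * (p - 1)) * a ^ (2 * (p - 1)) = a ^ (2 * k) := by rw [← rpow_add ha0]; congr 1; ring
    have e3 : 0 ≤ a ^ (2 * k - 2 * (p - 1)) := by positivity
    set I := ∫ x in (-π)..π, ‖Aop p (cgrad w (s * E x)) - Aop p (cgrad w 0)‖ ^ 2
    set X := ‖cgrad w 0‖ ^ (2 * (p - 1))
    have e6 : 4 * π * X + 2 * I ≤ a ^ (2 * (p - 1)) := by linarith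
    have e7 := mul_le_mul_of_nonneg_left e6 e3
    rw [e5] at e7
    have e8 : π * a ^ (2 * k) ≤ 4 * a ^ (2 * k) := by gcongr
    linarith
  have S2 : ∀ s : ℝ, 0 < s → s ≤ r0 → ∫ x in (-π)..π, ‖cgrad w (s * E x)‖ ^ (2 * k) ≤ (6 * C2 + 26) * a ^ (2 * k) := by
    intro s hs hsr0
    rcases le_total s r1 with h | h
    · refine (S1 s hs h).trans ?_
      gcongr; linarith
    have h1 := H2 w δ r1 t s hδ0.le hw hwL hr1 h (hsr0.trans hr02) ht
    have h2 : (t ^ (k - 1)) ^ 2 * ((r1 ^ 2) ^ 2)⁻¹ ≤ 1 := by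
      rw [← div_eq_mul_inv, div_le_one (by positivity)]
      apply pow_le_pow_left₀ (by positivity)
      have := htc t ht.le le_rfl
      linarith
    have h3 : t ^ (2 * (k - (p - 1))) * δ ^ 2 ≤ 1 := by
      rw [← sq_rpow ht.le, ← mul_pow]
      apply pow_le_one₀ (by positivity)
      calc _ ≤ t ^ (k - (p - 1)) * t ^ (-(k - (p - 1))) := by gcongr; exact min_le_right _ _
        _ = 1 := by rw [← rpow_add ht, add_neg_cancel, rpow_zero]
    have h4 : s ^ (2 * β) ≤ a ^ (2 * k) := by rw [hak]; exact rpow_le_rpow hs.le hsr0 (by positivity)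
    have h5 : C2 * s ^ (2 * β) * (1 + (t ^ (k - 1)) ^ 2 * ((r1 ^ 2) ^ 2)⁻¹ + t ^ (2 * (k - (p - 1))) * δ ^ 2) ≤ C2 * a ^ (2 * k) * 3 := by
      gcongr; linarith
    have h6 := h1.trans h5
    have pw : ∀ x, ‖cgrad w (s * E x)‖ ^ (2 * k) ≤ a ^ (2 * k) + 2 * ‖Fm k t (cgrad w (s * E x)) - Fm k t (cgrad w (r1 * E x))‖ ^ 2
        + 2 * ‖cgrad w (r1 * E x)‖ ^ (2 * k) := fun x => by
      have e1 := Fm_ge hk1.le ht (cgrad w (s * E x))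
      have e2 := Fm_le (t := t) hk1.le (cgrad w (r1 * E x))
      have e3 := norm_sq_le_two (Fm k t (cgrad w (s * E x))) (Fm k t (cgrad w (r1 * E x)))
      have e4 := rpow_le_rpow ht.le hta (by positivity : 0 ≤ 2 * k)
      linarith
    refine (imono (by fun_prop) (by fun_prop) pw).trans ?_
    rw [iaff2 (by fun_prop) (by fun_prop)]
    have h7 := S1 r1 hr1 le_rfl
    have e8 : π * a ^ (2 * k) ≤ 4 * a ^ (2 * k) := by gcongr
    linarith
  have h8 := S2 s hs hsr
  have pw : ∀ x, ‖cgrad w (s * E x)‖ ≤ a + a ^ (1 - 2 * k) * ‖cgrad w (s * E x)‖ ^ (2 * k) := fun x => by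
    have := pw_interp (norm_nonneg (cgrad w (s * E x))) ha0 zero_le_one (by linarith : 1 ≤ 2 * k)
    rwa [rpow_one, rpow_one] at this
  refine (imono (by fun_prop) (by fun_prop) pw).trans ?_
  rw [iaff (by fun_prop)]
  have h9 := mul_le_mul_of_nonneg_left h8 (by positivity : 0 ≤ a ^ (1 - 2 * k))
  have h10 : a ^ (1 - 2 * k) * ((6 * C2 + 26) * a ^ (2 * k)) = (6 * C2 + 26) * a := by
    rw [mul_left_comm, ← rpow_add ha0, sub_add_cancel, rpow_one]
  have h11 : π * a ≤ 4 * a := by gcongr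
  linarith

end PLap

namespace PLap

lemma int_abs_le_four {v : ℂ → ℝ} (hv : Continuous v) (h : ∀ z, ‖z‖ < 1 → |v z| ≤ 1) :
    ∫ z in ball (0:ℂ) 1, |v z| ≤ 4 := by
  have h1 : ∫ z in ball (0:ℂ) 1, |v z| ≤ ∫ z in ball (0:ℂ) 1, (1:ℝ) := by
    apply setIntegral_mono_on
    · exact (hv.abs.continuousOn.integrableOn_compact (isCompact_closedBall _ _)).mono_set ball_subset_closedBall
    · exact (continuousOn_const.integrableOn_compact (isCompact_closedBall _ _)).mono_set ball_subset_closedBall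
    · exact measurableSet_ball
    · intro z hz
      exact h z (by rwa [mem_ball, dist_zero_right] at hz)
  rw [setIntegral_const, smul_eq_mul, mul_one] at h1
  have hv : volume.real (ball (0:ℂ) 1) ≤ π * 1 ^ 2 := by
    rw [← vol_ball zero_le_one]
    exact measureReal_mono ball_subset_closedBall (isCompact_closedBall _ _).measure_lt_top.ne
  linarith [pi_le_four]

set_option maxHeartbeats 1000000 in
lemma key_lemma {p : ℝ} (hp : 2 < p) : ∃ lam : ℝ, 0 < lam ∧ lam < 1 ∧ ∃ ε : ℝ, 0 < ε ∧ ∃ δ : ℝ, 0 < δ ∧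
    ∀ v : ℂ → ℝ, Sol p 1 δ v → (∀ z, ‖z‖ < 1 → |v z| ≤ 1) → ‖cgrad v 0‖ ≤ ε →
      ∀ z, ‖z‖ ≤ lam → |v z - v 0| ≤ lam ^ (p / (p - 1)) := by
  obtain ⟨CA, hCA, HA⟩ := gradbound hp
  obtain ⟨C, hC, γ, hγ, H⟩ := circ_small hp hCA
  have hp1 : 0 < p - 1 := by linarith
  obtain ⟨r0, hr0, hr02, hr0c⟩ := exists_small (by linarith : 0 < γ - 1 / (p - 1)) (by positivity : 0 < (4⁻¹ : ℝ) ^ (p / (p - 1)))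
    ((C + 1) * CA) (by positivity)
  obtain ⟨ε, hε, δ', hδ', H⟩ := H r0 hr0 hr02
  set Q := (C + 1) * r0 ^ (1 + γ) with hQ
  have hQ0 : 0 < Q := by positivity
  have hq : 0 < Q ^ (p - 1) / r0 ^ p := by positivity
  set δ := min 1 (min δ' (Q ^ (p - 1) / r0 ^ p)) with hδ
  have hδ0 : 0 < δ := by positivity
  refine ⟨r0 / 4, by positivity, by linarith, ε, hε, δ, hδ0, fun v hv hv1 hv0 z hz => ?_⟩
  have g1 := HA v (hv.mono le_rfl (min_le_left _ _)) (int_abs_le_four hv.1.continuous hv1)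
  set w := resc v 0 (1 / 2) 0 1 with hwdef
  have hw := hv.rescale (R' := 2) (x0 := 0) (l := 1 / 2) (Q := 1) (by norm_num) zero_lt_one (by norm_num) 0
  have hδw : δ * (1 / 2 : ℝ) ^ p / 1 ^ (p - 1) ≤ δ := by
    rw [one_rpow, div_one]
    apply mul_le_of_le_one_right hδ0.le
    exact rpow_le_one (by norm_num) (by norm_num) (by linarith)
  have hw := hw.mono le_rfl hδw
  have hgw : ∀ y, cgrad w y = (1 / 2 : ℝ) • cgrad v ((1 / 2 : ℝ) • y) := fun y => by
    rw [hwdef, resc_cgrad hv.1, zero_add, div_one]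
  have hgwn : ∀ y, ‖cgrad w y‖ ≤ ‖cgrad v ((1 / 2 : ℝ) • y)‖ := fun y => by
    rw [hgw, norm_smul, Real.norm_of_nonneg (by norm_num)]
    linarith [norm_nonneg (cgrad v ((1 / 2 : ℝ) • y))]
  have c1 := H w (hw.mono le_rfl ((min_le_right _ _).trans (min_le_left _ _)))
    (fun y hy => (hgwn y).trans (g1 _ (by rw [norm_smul, Real.norm_of_nonneg (by norm_num)]; linarith)))
    ((hgwn 0).trans (by rwa [smul_zero]))
  have c2 := ray_ball hw.1 hr0 (by positivity) c1
  -- second rescaling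
  have hw2 := hw.rescale (R' := 1) (x0 := 0) hr0 hQ0 (by rw [norm_zero]; linarith) (w 0)
  have hδ2 : δ * r0 ^ p / Q ^ (p - 1) ≤ 1 := by
    have : δ ≤ Q ^ (p - 1) / r0 ^ p := (min_le_right _ _).trans (min_le_right _ _)
    rw [le_div_iff₀ (by positivity)] at this
    rwa [div_le_one (by positivity)]
  set uu := resc w 0 r0 (w 0) Q with huu
  have c3 : ∫ y in ball (0:ℂ) 1, |uu y| ≤ 4 := by
    simp only [huu, resc, abs_div, abs_of_pos hQ0]
    rw [integral_div, int_resc_ball (fun x => |w x - w 0|) 0 hr0, mul_one, div_le_iff₀ hQ0]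
    have e1 : (r0 ^ 2)⁻¹ * (C * r0 ^ γ * r0 ^ 3) = C * r0 ^ (1 + γ) := by
      rw [rpow_add hr0, rpow_one]; field_simp
    have e2 := mul_le_mul_of_nonneg_left c2 (by positivity : 0 ≤ (r0 ^ 2)⁻¹)
    rw [e1] at e2
    refine e2.trans ?_
    rw [hQ]
    have : 0 < r0 ^ (1 + γ) := by positivity
    nlinarith
  have g2 := HA uu (hw2.mono le_rfl hδ2) c3
  have hzz : ‖(4 / r0 * (1 / 2 * (1 : ℝ))) • z‖ ≤ 1 / 2 := by
    rw [norm_smul, Real.norm_of_nonneg (by positivity)]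
    calc _ ≤ 4 / r0 * (1 / 2 * 1) * (r0 / 4) := by gcongr
      _ = 1 / 2 := by field_simp
  set y := (4 / r0 * (1 / 2 * (1 : ℝ))) • z with hy
  have c4 := lip_u hw2.1 (x0 := 0) (R := 1 / 2) (L := CA) (fun z hz => g2 z (by rwa [mem_closedBall, dist_zero_right] at hz))
    (a := y) (b := 0) (by rwa [mem_closedBall, dist_zero_right]) (by simp)
  have e1 : uu y - uu 0 = (v z - v 0) / Q := by
    simp only [huu, hwdef, resc, hy, zero_add, smul_zero, sub_zero, div_one, smul_smul, sub_self, zero_div]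
    congr 4
    rw [show (1 / 2 * (r0 * (4 / r0 * (1 / 2 * 1))) : ℝ) = 1 by field_simp; norm_num, one_smul]
  rw [e1, sub_zero, abs_div, abs_of_pos hQ0, div_le_iff₀ hQ0] at c4
  have e2 : |v z - v 0| ≤ CA * Q := by
    refine c4.trans ?_
    have : CA * ‖y‖ ≤ CA * 1 := by gcongr; linarith
    gcongr; linarith
  refine e2.trans ?_
  have e3 : r0 ^ (1 + γ) = r0 ^ (p / (p - 1)) * r0 ^ (γ - 1 / (p - 1)) := by
    rw [← rpow_add hr0]; congr 1; field_simp; ring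
  rw [div_eq_mul_inv, mul_rpow hr0.le (by norm_num), hQ, e3]
  have := mul_le_mul_of_nonneg_left hr0c (by positivity : 0 ≤ r0 ^ (p / (p - 1)))
  linarith

end PLap

namespace PLap

set_option maxHeartbeats 1000000 in
lemma iterate {p : ℝ} (hp : 2 < p) : ∃ C : ℝ, 1 < C ∧ ∀ u : ℂ → ℝ, Sol p (9 / 10) 1 u → (∀ z, ‖z‖ < 9 / 10 → |u z| ≤ 1) →
    ∀ r : ℝ, 0 < r → r ≤ 1 / 2 → ∀ z, ‖z‖ < r →
      |u z - u 0| ≤ C * r ^ (p / (p - 1)) * (1 + ‖cgrad u 0‖ * r ^ (1 / (1 - p))) := by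
  obtain ⟨lam, hl0, hl1, ε, hε, δ, hδ, H⟩ := key_lemma hp
  have hp1 : 0 < p - 1 := by linarith
  set q := p / (p - 1) with hq
  have hq1 : 1 ≤ q := by rw [hq, le_div_iff₀ hp1]; linarith
  set C0 := 2 + 1 / ε + δ ^ (-(1 / (p - 1))) with hC0
  have hx1 : 0 < 1 / ε := by positivity
  have hx2 : 0 < δ ^ (-(1 / (p - 1))) := by positivity
  have hC02 : 2 ≤ C0 := by linarith
  have hC00 : 0 < C0 := by linarith
  have hC0ε : 1 / C0 ≤ ε := by
    rw [div_le_iff₀ hC00]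
    have : 1 = ε * (1 / ε) := by field_simp
    have h2 : ε * (1 / ε) ≤ ε * C0 := by gcongr; linarith
    linarith
  have hC0δ : 1 ≤ δ * C0 ^ (p - 1) := by
    have h1 : δ ^ (-(1 / (p - 1))) ≤ C0 := by linarith
    have h2 := rpow_le_rpow hx2.le h1 hp1.le
    rw [← rpow_mul hδ.le, show -(1 / (p - 1)) * (p - 1) = -1 by field_simp, rpow_neg_one] at h2
    have h3 := mul_le_mul_of_nonneg_left h2 hδ.le
    rwa [mul_inv_cancel₀ hδ.ne'] at h3
  set μ := lam ^ q with hμ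
  have hμ0 : 0 < μ := by positivity
  have hμl : μ ≤ lam := by
    have := rpow_le_rpow_of_exponent_ge hl0 hl1.le hq1
    rwa [rpow_one] at this
  set D := 1 / (9 / 10 * lam) with hD
  have hD1 : 1 < D := by rw [hD, lt_div_iff₀ (by positivity)]; linarith
  have hDq : D ≤ D ^ q := by
    have := rpow_le_rpow_of_exponent_le hD1.le hq1
    rwa [rpow_one] at this
  refine ⟨C0 * D ^ q, by nlinarith, fun u hu hu1 r hr hr2 z hz => ?_⟩
  set g := ‖cgrad u 0‖ with hg
  have hg0 : 0 ≤ g := norm_nonneg _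
  have claim : ∀ n : ℕ, ∀ z : ℂ, ‖z‖ < 9 / 10 * lam ^ n → |u z - u 0| ≤ C0 * (μ ^ n + g * lam ^ n) := by
    intro n
    induction n with
    | zero =>
      intro z hz
      simp only [pow_zero, mul_one] at hz ⊢
      have h1 := abs_le.1 (hu1 z hz)
      have h2 := abs_le.1 (hu1 0 (by norm_num))
      have h3 : |u z - u 0| ≤ 2 := abs_le.2 ⟨by linarith [h1.1, h2.2], by linarith [h1.2, h2.1]⟩
      nlinarith
    | succ n ih =>
      intro z hz
      set l := 9 / 10 * lam ^ n with hl
      have hln : 0 < lam ^ n := by positivity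
      have hμn : 0 < μ ^ n := by positivity
      have hl0 : 0 < l := by positivity
      have hln1 : lam ^ n ≤ 1 := pow_le_one₀ (by positivity) hl1.le
      set T := μ ^ n + g * lam ^ n with hT
      have hgl : 0 ≤ g * lam ^ n := by positivity
      have hT0 : 0 < T := by positivity
      set Q := C0 * T with hQ
      have hQ0 : 0 < Q := by positivity
      have hv := hu.rescale (R' := 1) (x0 := 0) hl0 hQ0 (by rw [norm_zero]; linarith) (u 0)
      have hδv : 1 * l ^ p / Q ^ (p - 1) ≤ δ := by
        rw [one_mul, div_le_iff₀ (by positivity)]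
        have e1 : l ^ p ≤ (lam ^ n) ^ p := rpow_le_rpow hl0.le (by linarith) (by linarith)
        have e2 : (μ ^ n) ^ (p - 1) = (lam ^ n) ^ p := by
          rw [hμ, ← rpow_natCast, ← rpow_natCast, ← rpow_mul (by positivity), ← rpow_mul (by positivity), ← rpow_mul (by positivity)]
          congr 1; rw [hq]; field_simp
        have e3 : (μ ^ n) ^ (p - 1) ≤ T ^ (p - 1) := rpow_le_rpow hμn.le (by linarith) hp1.le
        rw [hQ, mul_rpow hC00.le hT0.le, ← mul_assoc]
        have e4 : 0 ≤ T ^ (p - 1) := by positivity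
        have e5 := mul_le_mul_of_nonneg_right hC0δ e4
        linarith
      have hv1 : ∀ y, ‖y‖ < 1 → |resc u 0 l (u 0) Q y| ≤ 1 := fun y hy => by
        simp only [resc, zero_add]
        rw [abs_div, abs_of_pos hQ0, div_le_one hQ0]
        apply ih
        rw [norm_smul, Real.norm_of_nonneg hl0.le]
        nlinarith
      have hvg : ‖cgrad (resc u 0 l (u 0) Q) 0‖ ≤ ε := by
        rw [resc_cgrad hu.1, norm_smul, Real.norm_of_nonneg (by positivity), smul_zero, add_zero, ← hg]
        refine le_trans ?_ hC0ε
        rw [div_mul_eq_mul_div, div_le_div_iff₀ hQ0 hC00, one_mul, hQ]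
        have e1 : l * g ≤ T := by
          have : l * g ≤ lam ^ n * g := by gcongr; linarith
          linarith
        nlinarith
      have h1 := H _ (hv.mono le_rfl hδv) hv1 hvg ((1 / l) • z) (by
        rw [norm_smul, Real.norm_of_nonneg (by positivity), one_div_mul_eq_div, div_le_iff₀ hl0]
        refine hz.le.trans (le_of_eq ?_)
        rw [hl, pow_succ]; ring)
      simp only [resc, zero_add, smul_zero, smul_smul, sub_self, zero_div, sub_zero] at h1
      rw [mul_one_div_cancel hl0.ne', one_smul, abs_div, abs_of_pos hQ0, div_le_iff₀ hQ0] at h1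
      refine h1.trans ?_
      have e1 : μ * T ≤ μ ^ (n + 1) + g * lam ^ (n + 1) := by
        rw [hT, pow_succ, pow_succ]
        have : μ * (g * lam ^ n) ≤ lam * (g * lam ^ n) := by gcongr
        linarith
      calc μ * Q = C0 * (μ * T) := by rw [hQ]; ring
        _ ≤ _ := by gcongr
  obtain ⟨n, hn1, hn2⟩ := exists_nat_pow_near_of_lt_one (x := r / (9 / 10)) (y := lam) (by positivity)
    (by rw [div_le_one (by norm_num)]; linarith) hl0 hl1
  have h1 := claim n z (by
    rw [div_le_iff₀ (by norm_num)] at hn2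
    linarith)
  have h2 : lam ^ n ≤ r * D := by
    rw [lt_div_iff₀ (by norm_num), pow_succ] at hn1
    rw [hD, mul_one_div, le_div_iff₀ (by positivity)]
    linarith
  have h3 : μ ^ n ≤ r ^ q * D ^ q := by
    rw [← mul_rpow hr.le (by positivity), hμ, ← rpow_natCast, ← rpow_mul hl0.le, mul_comm q, rpow_mul hl0.le, rpow_natCast]
    exact rpow_le_rpow (by positivity) h2 (by linarith)
  have h4 : r ^ q * r ^ (1 / (1 - p)) = r := by
    rw [← rpow_add hr, hq]
    have : p / (p - 1) + 1 / (1 - p) = 1 := by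
      rw [← neg_sub p 1, one_div, inv_neg]; field_simp; ring
    rw [this, rpow_one]
  have h5 : g * lam ^ n ≤ g * (r * D ^ q) := by
    gcongr
    exact h2.trans (by gcongr)
  calc |u z - u 0| ≤ C0 * (μ ^ n + g * lam ^ n) := h1
    _ ≤ C0 * (r ^ q * D ^ q + g * (r * D ^ q)) := by gcongr
    _ = C0 * D ^ q * (r ^ q + g * r) := by ring
    _ = C0 * D ^ q * (r ^ q + g * (r ^ q * r ^ (1 / (1 - p)))) := by rw [h4]
    _ = _ := by ring

end PLap

namespace PLap

abbrev V2 := EuclideanSpace ℝ (Fin 2)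

def Phi : ℂ ≃ₗᵢ[ℝ] V2 := Complex.orthonormalBasisOneI.repr

lemma Phi_mp : MeasurePreserving (Phi : ℂ → V2) volume volume := Phi.measurePreserving

lemma int_Phi (G : V2 → ℝ) : ∫ z, G (Phi z) = ∫ x, G x :=
  Phi_mp.integral_comp Phi.toHomeomorph.measurableEmbedding G

lemma dot_eq_inner (a b : ℂ) : dot a b = ⟪Phi a, Phi b⟫ := by
  rw [LinearIsometryEquiv.inner_map_map, Complex.inner]
  simp [dot]; ring

lemma Phi_cgrad (U : V2 → ℝ) (z : ℂ) : Phi (cgrad (fun y => U (Phi y)) z) = gradient U (Phi z) := by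
  apply ext_inner_right ℝ
  intro v
  obtain ⟨a, rfl⟩ := Phi.surjective v
  rw [← dot_eq_inner, ← fderiv_apply_dot]
  have h := Phi.toContinuousLinearEquiv.comp_right_fderiv (f := U) (x := z)
  have h2 : fderiv ℝ (fun y => U (Phi y)) z a = fderiv ℝ U (Phi z) (Phi a) := by
    have := congrArg (fun T => T a) h
    exact this
  rw [h2, gradient, InnerProductSpace.toDual_symm_apply]

lemma bound_ae {u : V2 → ℝ} (hu : ContDiffOn ℝ 1 u (B 2 1)) (h : eLpNorm u ⊤ (volume.restrict (B 2 1)) ≤ 1) :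
    ∀ x ∈ B 2 1, |u x| ≤ 1 := by
  intro x hx
  by_contra hc
  push Not at hc
  have ho : IsOpen (B 2 1 ∩ {y | 1 < |u y|}) :=
    hu.continuousOn.abs.isOpen_inter_preimage isOpen_ball isOpen_Ioi
  have hpos : 0 < volume (B 2 1 ∩ {y | 1 < |u y|}) := ho.measure_pos volume ⟨x, hx, hc⟩
  rw [eLpNorm_exponent_top] at h
  have hae : ∀ᵐ y ∂(volume.restrict (B 2 1)), ‖u y‖ₑ ≤ 1 := by
    filter_upwards [ae_le_eLpNormEssSup (f := u) (μ := volume.restrict (B 2 1))] with y hy using hy.trans h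
  rw [ae_restrict_iff' measurableSet_ball] at hae
  have : volume (B 2 1 ∩ {y | 1 < |u y|}) = 0 := by
    refine measure_mono_null ?_ hae
    rintro y ⟨hy1, hy2⟩ hy3
    have h4 := hy3 hy1
    rw [← ofReal_norm, ENNReal.ofReal_le_one, Real.norm_eq_abs] at h4
    exact absurd hy2 (not_lt.2 h4)
  exact hpos.ne' this

def bump : ContDiffBump (0 : V2) := ⟨91 / 100, 95 / 100, by norm_num, by norm_num⟩

lemma glob_contDiff {u : V2 → ℝ} (hu : ContDiffOn ℝ 1 u (B 2 1)) : ContDiff ℝ 1 fun x => bump x * u x := by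
  rw [contDiff_iff_contDiffAt]
  intro x
  by_cases hx : x ∈ B 2 1
  · exact (bump.contDiff.contDiffAt).mul (hu.contDiffAt (isOpen_ball.mem_nhds hx))
  · have : (fun x => bump x * u x) =ᶠ[nhds x] fun _ => 0 := by
      have ho : IsOpen (closedBall (0:V2) (95 / 100))ᶜ := isClosed_closedBall.isOpen_compl
      have hm : x ∈ (closedBall (0:V2) (95 / 100))ᶜ := by
        simp only [mem_ball, dist_zero_right, not_lt] at hx
        simp only [Set.mem_compl_iff, mem_closedBall, dist_zero_right, not_le]; linarith
      filter_upwards [ho.mem_nhds hm] with y hy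
      simp only [Set.mem_compl_iff, mem_closedBall, not_le] at hy
      rw [bump.zero_of_le_dist hy.le, zero_mul]
    exact contDiffAt_const.congr_of_eventuallyEq this

lemma glob_eq (u : V2 → ℝ) {x : V2} (hx : ‖x‖ < 91 / 100) : (fun x => bump x * u x) =ᶠ[nhds x] u := by
  filter_upwards [isOpen_ball.mem_nhds (by rwa [mem_ball, dist_zero_right] : x ∈ ball (0:V2) (91 / 100))] with y hy
  rw [bump.one_of_mem_closedBall (ball_subset_closedBall hy), one_mul]

lemma grad_glob (u : V2 → ℝ) {x : V2} (hx : ‖x‖ < 91 / 100) : gradient (fun x => bump x * u x) x = gradient u x := by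
  unfold gradient
  rw [(glob_eq u hx).fderiv_eq]

lemma glob_sol {p : ℝ} {u f : V2 → ℝ} (hu : ContDiffOn ℝ 1 u (B 2 1)) (hf : eLpNorm f ⊤ (volume.restrict (B 2 1)) ≤ 1)
    (h : IsPLaplaceWeakSolution p 1 u f) : Sol p (9 / 10) 1 fun z => bump (Phi z) * u (Phi z) := by
  refine ⟨(glob_contDiff hu).comp Phi.contDiff, fun φ hφ hφc hφs => ?_⟩
  set U : V2 → ℝ := fun x => bump x * u x with hU
  set ψ : V2 → ℝ := fun x => φ (Phi.symm x) with hψ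
  have hφψ : φ = fun z => ψ (Phi z) := by ext z; simp [hψ]
  have hψ1 : ContDiff ℝ (⊤ : ℕ∞) ψ := hφ.comp Phi.symm.contDiff
  have hψc : HasCompactSupport ψ := hφc.comp_homeomorph Phi.symm.toHomeomorph
  have hz0 : ∀ z, z ∉ ball (0:ℂ) (9 / 10) → cgrad φ z = 0 := fun z hz => by
    have : fderiv ℝ φ z = 0 := by
      have h1 : z ∉ tsupport (fderiv ℝ φ) := fun h => hz (hφs (tsupport_fderiv_subset ℝ h))
      exact image_eq_zero_of_notMem_tsupport h1
    unfold cgrad; rw [this]; rfl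
  have hts : tsupport ψ ⊆ B 2 1 := by
    have h1 : tsupport ψ = Phi.symm.toHomeomorph ⁻¹' tsupport φ := tsupport_comp_eq_preimage φ Phi.symm.toHomeomorph
    rw [h1]
    intro x hx
    have := hφs hx
    rw [mem_ball, dist_zero_right] at this ⊢
    have h2 : ‖Phi.symm x‖ < 9 / 10 := this
    rw [LinearIsometryEquiv.norm_map] at h2
    linarith
  have key := h ψ hψ1 hψc hts
  have e1 : ∫ x in B 2 1, ‖gradient u x‖ ^ (p - 2) * ⟪gradient u x, gradient ψ x⟫ = ∫ z, dot (Aop p (cgrad (fun z => U (Phi z)) z)) (cgrad φ z) := by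
    rw [setIntegral_eq_integral_of_forall_compl_eq_zero, ← int_Phi]
    · congr 1; ext z
      rw [← Phi_cgrad ψ z]
      simp only [← hφψ]
      by_cases hz : z ∈ ball (0:ℂ) (9 / 10)
      · rw [mem_ball, dist_zero_right] at hz
        have hg := grad_glob u (x := Phi z) (by rw [LinearIsometryEquiv.norm_map]; linarith)
        rw [← hg, ← hU, ← Phi_cgrad U z, ← dot_eq_inner, LinearIsometryEquiv.norm_map]
        simp only [Aop, dot, Complex.real_smul, Complex.mul_re, Complex.mul_im, Complex.ofReal_re, Complex.ofReal_im]
        ring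
      · rw [hz0 z hz]; simp [dot]
    · intro x hx
      obtain ⟨z, rfl⟩ := Phi.surjective x
      rw [← Phi_cgrad ψ z]
      simp only [← hφψ]
      rw [hz0 z]
      · simp
      · intro hh
        apply hx
        rw [mem_ball, dist_zero_right] at hh ⊢
        rw [LinearIsometryEquiv.norm_map]; linarith
  change |∫ z, dot (Aop p (cgrad (fun z => U (Phi z)) z)) (cgrad φ z)| ≤ _
  rw [← e1, key, one_mul]
  have hi : Integrable fun x => |ψ x| := hψ1.continuous.abs.integrable_of_hasCompactSupport hψc.abs
  have e2 : |∫ x in B 2 1, f x * ψ x| ≤ ∫ x in B 2 1, |ψ x| := by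
    rw [← Real.norm_eq_abs]
    apply norm_integral_le_of_norm_le hi.integrableOn
    rw [eLpNorm_exponent_top] at hf
    filter_upwards [ae_le_eLpNormEssSup (f := f) (μ := volume.restrict (B 2 1))] with y hy
    have h4 := hy.trans hf
    rw [← ofReal_norm, ENNReal.ofReal_le_one] at h4
    rw [norm_mul, Real.norm_eq_abs (ψ y)]
    exact mul_le_of_le_one_left (abs_nonneg _) h4
  refine e2.trans ?_
  have e3 : ∫ z, |φ z| = ∫ x, |ψ x| := by
    rw [← int_Phi, hφψ]
  rw [e3]
  exact setIntegral_le_integral hi (by filter_upwards with x using abs_nonneg _)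

end PLap
open PLap

theorem oscillation_estimate (p : ℝ) (hp : 2 < p) :
    ∃ δ₀ C : ℝ, 0 < δ₀ ∧ 1 < C ∧
      ∀ u f : EuclideanSpace ℝ (Fin 2) → ℝ,
        eLpNorm f ⊤ (volume.restrict (B 2 1)) ≤ ENNReal.ofReal δ₀ →
        ContDiffOn ℝ 1 u (B 2 1) →
        IsPLaplaceWeakSolution p 1 u f →
        eLpNorm u ⊤ (volume.restrict (B 2 1)) ≤ 1 →
        ∀ r : ℝ, 0 < r → r ≤ 1/2 →
          ∀ x ∈ B 2 r,
            |u x - u 0| ≤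
              C * r ^ (p / (p - 1)) * (1 + ‖gradient u 0‖ * r ^ (1 / (1 - p))) := by
  obtain ⟨C, hC, H⟩ := iterate hp
  refine ⟨1, C, one_pos, hC, fun u f hf hu hsol hu1 r hr hr2 x hx => ?_⟩
  rw [ENNReal.ofReal_one] at hf
  have hb := bound_ae hu hu1
  have hone : ∀ y : PLap.V2, ‖y‖ < 91 / 100 → PLap.bump y * u y = u y := fun y hy => (glob_eq u hy).self_of_nhds
  obtain ⟨z, rfl⟩ := Phi.surjective x
  rw [mem_ball, dist_zero_right, LinearIsometryEquiv.norm_map] at hx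
  have h1 := H _ (glob_sol hu hf hsol) (fun y hy => by
    have hy' : ‖Phi y‖ < 91 / 100 := by rw [LinearIsometryEquiv.norm_map]; linarith
    rw [hone _ hy']
    exact hb _ (by rw [mem_ball, dist_zero_right]; linarith)) r hr hr2 z hx
  have h2 : ‖cgrad (fun z => PLap.bump (Phi z) * u (Phi z)) 0‖ = ‖gradient u 0‖ := by
    rw [← Phi.norm_map, Phi_cgrad (fun x => PLap.bump x * u x) 0, map_zero, grad_glob u (by rw [norm_zero]; norm_num)]
  rw [h2, hone _ (by rw [LinearIsometryEquiv.norm_map]; linarith), map_zero, hone 0 (by rw [norm_zero]; norm_num)] at h1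
  exact h1
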